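/- Let K be a global function field of characteristic p, let q ≠ p be a prime, let 𝐊 be a (possibly infinite) algebraic extension of K, and let 𝔭_K be a prime of K. If 𝔭_K is uniformly q-bounded in 𝐊, then the integral closure O_{𝔭_K,𝐊} in 𝐊 of the valuation ring O_{𝔭_K} = {x ∈ K : ord_{𝔭_K} x ≥ 0} is first-order definable over 𝐊 in the language of rings with parameters from 𝐊. -/

import Mathlib

noncomputable section

/-- A normalized (surjective onto `ℤ`) discrete valuation on a field `K`, i.e. a
"prime" of a global function field. -/
structure FFPrime (K : Type) [Field K] where
  ord : K → WithTop ℤ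
  ord_zero : ord 0 = ⊤
  ord_ne_top : ∀ x : K, x ≠ 0 → ord x ≠ ⊤
  ord_one : ord 1 = 0
  ord_mul : ∀ x y : K, ord (x * y) = ord x + ord y
  ord_add : ∀ x y : K, min (ord x) (ord y) ≤ ord (x + y)
  ord_surj : ∀ n : ℤ, ∃ x : K, ord x = (n : WithTop ℤ)

namespace FFPrime

variable {K L : Type} [Field K] [Field L]

/-- `w` lies over `v` along `φ`, with ramification index `e`. -/
def LiesOverWith (w : FFPrime L) (v : FFPrime K) (φ : K →+* L) (e : ℕ) : Prop :=
  0 < e ∧ ∀ x : K, w.ord (φ x) = ((e : ℤ) : WithTop ℤ) * v.ord x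

/-- `w` lies over `v` along `φ`. -/
def LiesOver (w : FFPrime L) (v : FFPrime K) (φ : K →+* L) : Prop :=
  ∃ e : ℕ, w.LiesOverWith v φ e

open Classical in
/-- The ramification index `e(w/v)`. -/
noncomputable def ramIdx (w : FFPrime L) (v : FFPrime K) (φ : K →+* L) : ℕ :=
  if h : ∃ e : ℕ, w.LiesOverWith v φ e then h.choose else 0

/-- The residue field of `v` has exactly `n` elements. -/
def HasResidueCard (v : FFPrime K) (n : ℕ) : Prop :=
  ∃ s : Finset K, s.card = n ∧ (∀ x ∈ s, 0 ≤ v.ord x) ∧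
    (∀ x ∈ s, ∀ y ∈ s, x ≠ y → ¬ 0 < v.ord (x - y)) ∧
    (∀ z : K, 0 ≤ v.ord z → ∃ x ∈ s, 0 < v.ord (z - x))

open Classical in
/-- The residue (relative) degree `f(w/v)`: the unique `f ≥ 1` with
`#κ_w = (#κ_v) ^ f` (residue fields of global function fields are finite). -/
noncomputable def resDeg (w : FFPrime L) (v : FFPrime K) : ℕ :=
  if h : ∃ f : ℕ, 0 < f ∧ ∃ m n : ℕ, 1 < m ∧ v.HasResidueCard m ∧
      w.HasResidueCard n ∧ n = m ^ f then h.choose else 0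

/-- `v` splits completely in the extension given by `φ`: every prime above it has
ramification index and residue degree `1`. -/
def SplitsCompletely (v : FFPrime K) (φ : K →+* L) : Prop :=
  ∀ w : FFPrime L, w.LiesOver v φ → w.ramIdx v φ = 1 ∧ w.resDeg v = 1

/-- `v` is inert in the finite extension `M/K`: there is a unique prime above it, with
ramification index `1` and residue degree `[M : K]`. -/
def IsInert (v : FFPrime K) (M : Type) [Field M] [Algebra K M] : Prop :=
  (∃! w : FFPrime M, w.LiesOver v (algebraMap K M)) ∧
    ∀ w : FFPrime M, w.LiesOver v (algebraMap K M) →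
      w.ramIdx v (algebraMap K M) = 1 ∧ w.resDeg v = Module.finrank K M

/-- `v` ramifies in the extension given by `φ`: some prime above it has ramification
index `> 1`. -/
def Ramifies (v : FFPrime K) (φ : K →+* L) : Prop :=
  ∃ w : FFPrime L, w.LiesOver v φ ∧ 2 ≤ w.ramIdx v φ

/-- `ord_v z ≡ 0 mod q`. -/
def OrdDvd (v : FFPrime K) (q : ℕ) (z : K) : Prop :=
  ∃ n : ℤ, v.ord z = (((q : ℤ) * n : ℤ) : WithTop ℤ)

end FFPrime

/-- A nontrivial (rank one) valuation on a possibly infinite algebraic extension of a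
global function field, with values in `ℚ ∪ {∞}`. -/
structure FFVal (B : Type) [Field B] where
  ord : B → WithTop ℚ
  ord_zero : ord 0 = ⊤
  ord_ne_top : ∀ x : B, x ≠ 0 → ord x ≠ ⊤
  ord_one : ord 1 = 0
  ord_mul : ∀ x y : B, ord (x * y) = ord x + ord y
  ord_add : ∀ x y : B, min (ord x) (ord y) ≤ ord (x + y)
  nontrivial : ∃ x : B, ord x ≠ 0 ∧ ord x ≠ ⊤

/-- The valuation `V` of the big field restricts, up to a normalization factor `c`, to
the (normalized discrete) prime `v` of `K` along `φ`; i.e. `v` is the prime of `K`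
lying below `V`. -/
def FFVal.RestrictsTo {K B : Type} [Field K] [Field B] (V : FFVal B) (v : FFPrime K)
    (φ : K →+* B) : Prop :=
  ∃ c : ℚ, 0 < c ∧
    ∀ x : K, V.ord (φ x) = ((c : ℚ) : WithTop ℚ) * WithTop.map (fun n : ℤ => (n : ℚ)) (v.ord x)

/-- The algebraic extension `B` of the rational function field `F0 = 𝔽_p(t)` is
`q`-bounded: for every valuation of `B`, the `q`-adic valuations of the ramification
indices and residue degrees along every finite subextension are bounded. -/
def IsQBounded (q : ℕ) (F0 B : Type) [Field F0] [Field B] [Algebra F0 B] : Prop :=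
  ∀ V : FFVal B, ∃ C : ℕ,
    ∀ L : IntermediateField F0 B, FiniteDimensional F0 L →
      ∀ v0 : FFPrime F0, ∀ vL : FFPrime L,
        V.RestrictsTo v0 (algebraMap F0 B) →
        V.RestrictsTo vL L.val.toRingHom →
        padicValNat q (vL.ramIdx v0 (algebraMap F0 L)) ≤ C ∧
        padicValNat q (vL.resDeg v0) ≤ C

/-- The prime `v` of `K` has uniformly `q`-bounded ramification in `B`. -/
def UnifQBoundedRam (q : ℕ) {K : Type} [Field K] (B : Type) [Field B] [Algebra K B]
    (v : FFPrime K) : Prop :=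
  ∃ C : ℕ, ∀ F : IntermediateField K B, FiniteDimensional K F →
    ∀ w : FFPrime F, w.LiesOver v (algebraMap K F) →
      padicValNat q (w.ramIdx v (algebraMap K F)) ≤ C

/-- The prime `v` of `K` has uniformly absolutely bounded ramification in `B`. -/
def UnifAbsBoundedRam {K : Type} [Field K] (B : Type) [Field B] [Algebra K B]
    (v : FFPrime K) : Prop :=
  ∃ C : ℕ, ∀ F : IntermediateField K B, FiniteDimensional K F →
    ∀ w : FFPrime F, w.LiesOver v (algebraMap K F) →
      w.ramIdx v (algebraMap K F) ≤ C

/-- The prime `v` of `K` has uniformly `q`-bounded relative (residue) degree in `B`. -/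
def UnifQBoundedRes (q : ℕ) {K : Type} [Field K] (B : Type) [Field B] [Algebra K B]
    (v : FFPrime K) : Prop :=
  ∃ C : ℕ, ∀ F : IntermediateField K B, FiniteDimensional K F →
    ∀ w : FFPrime F, w.LiesOver v (algebraMap K F) →
      padicValNat q (w.resDeg v) ≤ C

/-- The prime `v` of `K` is uniformly `q`-bounded in `B`. -/
def UniformlyQBoundedAt (q : ℕ) {K : Type} [Field K] (B : Type) [Field B] [Algebra K B]
    (v : FFPrime K) : Prop :=
  UnifQBoundedRam q B v ∧ UnifQBoundedRes q B v

/-- The integral closure in `B` of the valuation ring `O_v = {x ∈ K : ord_v x ≥ 0}`. -/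
def valIntegralClosure {K : Type} [Field K] (v : FFPrime K) (B : Type) [Field B]
    [Algebra K B] : Set B :=
  {x : B | ∃ P : Polynomial K, P.Monic ∧ (∀ n : ℕ, 0 ≤ v.ord (P.coeff n)) ∧
    Polynomial.aeval x P = 0}

/-- The integral closure in `B` of the ring `O_{K,S}` of `S`-integers of `K`. -/
def sIntegralClosure {K : Type} [Field K] (S : Set (FFPrime K)) (B : Type) [Field B]
    [Algebra K B] : Set B :=
  {x : B | ∃ P : Polynomial K, P.Monic ∧
    (∀ n : ℕ, ∀ v : FFPrime K, v ∉ S → 0 ≤ v.ord (P.coeff n)) ∧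
    Polynomial.aeval x P = 0}

/-- Elements of `B` that are units at every prime of `B` lying over a prime of `S`. -/
def unitsAtS {K : Type} [Field K] (S : Set (FFPrime K)) (B : Type) [Field B]
    [Algebra K B] : Set B :=
  {x : B | ∀ V : FFVal B, (∃ v ∈ S, V.RestrictsTo v (algebraMap K B)) → V.ord x = 0}

/-- Elements `x` of `B` with `ord (x - 1) > 0` at every prime of `B` lying over a
prime of `S`. -/
def onesAtS {K : Type} [Field K] (S : Set (FFPrime K)) (B : Type) [Field B]
    [Algebra K B] : Set B :=
  {x : B | ∀ V : FFVal B, (∃ v ∈ S, V.RestrictsTo v (algebraMap K B)) → 0 < V.ord (x - 1)}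

/-- A subset of a commutative ring is first-order definable in the language of rings
`{0, 1, +, ·}` with parameters from the ring. -/
def FODefinable {R : Type} [CommRing R] (X : Set R) : Prop :=
  letI : FirstOrder.Ring.CompatibleRing R := FirstOrder.Ring.compatibleRingOfRing R
  Set.Definable₁ (Set.univ : Set R) FirstOrder.Language.ring X

/-- A subset of a commutative ring is existentially (diophantine) definable: it is cut
out by a block of existential quantifiers followed by a system of polynomial equations,
with parameters (coefficients) from the ring. -/
def ExistDefinable {R : Type} [CommRing R] (X : Set R) : Prop :=
  ∃ (k m : ℕ) (P : Fin m → MvPolynomial (Fin (k + 1)) R),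
    ∀ x : R, x ∈ X ↔ ∃ y : Fin k → R, ∀ i : Fin m,
      MvPolynomial.eval (Fin.cons x y) (P i) = 0

/-- Solvability of the norm equation `N(y) = b·x^q + b^q` over (every realization of)
the tower `L₂(a^{1/q})/L₂`, where `L₁ = F((1+(b x^q+b^q)⁻¹)^{1/q})` and
`L₂ = L₁((1+(a+a⁻¹)b⁻¹)^{1/q})`. -/
def NormTower2Solvable (q : ℕ) (F : Type) [Field F] (a b x : F) : Prop :=
  ∀ (M1 : Type) [Field M1] [Algebra F M1] (α1 : M1),
    α1 ^ q = algebraMap F M1 (1 + (b * x ^ q + b ^ q)⁻¹) →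
    IntermediateField.adjoin F {α1} = ⊤ →
    ∀ (M2 : Type) [Field M2] [Algebra M1 M2] (α2 : M2),
      α2 ^ q = algebraMap M1 M2 (algebraMap F M1 (1 + (a + a⁻¹) * b⁻¹)) →
      IntermediateField.adjoin M1 {α2} = ⊤ →
      ∀ (M3 : Type) [Field M3] [Algebra M2 M3] (α3 : M3),
        α3 ^ q = algebraMap M2 M3 (algebraMap M1 M2 (algebraMap F M1 a)) →
        IntermediateField.adjoin M2 {α3} = ⊤ →
        ∃ y : M3, Algebra.norm M2 y = algebraMap M1 M2 (algebraMap F M1 (b * x ^ q + b ^ q))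

/-- Solvability of the norm equation `N(y) = b·x^q + b^q` over (every realization of)
the tower `L₄(a^{1/q})/L₄`, where `L₁ = F((1+(b x^q+b^q)⁻¹)^{1/q})`,
`L₃ = L₁((1+x⁻¹)^{1/q})` and `L₄ = L₃((1+(a+a⁻¹)x⁻¹)^{1/q})`. -/
def NormTower4Solvable (q : ℕ) (F : Type) [Field F] (a b x : F) : Prop :=
  ∀ (M1 : Type) [Field M1] [Algebra F M1] (α1 : M1),
    α1 ^ q = algebraMap F M1 (1 + (b * x ^ q + b ^ q)⁻¹) →
    IntermediateField.adjoin F {α1} = ⊤ →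
    ∀ (M3 : Type) [Field M3] [Algebra M1 M3] (α3 : M3),
      α3 ^ q = algebraMap M1 M3 (algebraMap F M1 (1 + x⁻¹)) →
      IntermediateField.adjoin M1 {α3} = ⊤ →
      ∀ (M4 : Type) [Field M4] [Algebra M3 M4] (α4 : M4),
        α4 ^ q = algebraMap M3 M4 (algebraMap M1 M3 (algebraMap F M1 (1 + (a + a⁻¹) * x⁻¹))) →
        IntermediateField.adjoin M3 {α4} = ⊤ →
        ∀ (M5 : Type) [Field M5] [Algebra M4 M5] (α5 : M5),
          α5 ^ q = algebraMap M4 M5 (algebraMap M3 M4 (algebraMap M1 M3 (algebraMap F M1 a))) →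
          IntermediateField.adjoin M4 {α5} = ⊤ →
          ∃ y : M5, Algebra.norm M4 y =
            algebraMap M3 M4 (algebraMap M1 M3 (algebraMap F M1 (b * x ^ q + b ^ q)))

/-- Unsolvability of the norm equation `N(y) = b·x^q + b^q` over (every realization of)
the tower `L₄(a^{1/q})/L₄` as in `NormTower4Solvable`. -/
def NormTower4Unsolvable (q : ℕ) (F : Type) [Field F] (a b x : F) : Prop :=
  ∀ (M1 : Type) [Field M1] [Algebra F M1] (α1 : M1),
    α1 ^ q = algebraMap F M1 (1 + (b * x ^ q + b ^ q)⁻¹) →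
    IntermediateField.adjoin F {α1} = ⊤ →
    ∀ (M3 : Type) [Field M3] [Algebra M1 M3] (α3 : M3),
      α3 ^ q = algebraMap M1 M3 (algebraMap F M1 (1 + x⁻¹)) →
      IntermediateField.adjoin M1 {α3} = ⊤ →
      ∀ (M4 : Type) [Field M4] [Algebra M3 M4] (α4 : M4),
        α4 ^ q = algebraMap M3 M4 (algebraMap M1 M3 (algebraMap F M1 (1 + (a + a⁻¹) * x⁻¹))) →
        IntermediateField.adjoin M3 {α4} = ⊤ →
        ∀ (M5 : Type) [Field M5] [Algebra M4 M5] (α5 : M5),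
          α5 ^ q = algebraMap M4 M5 (algebraMap M3 M4 (algebraMap M1 M3 (algebraMap F M1 a))) →
          IntermediateField.adjoin M4 {α5} = ⊤ →
          ¬ ∃ y : M5, Algebra.norm M4 y =
            algebraMap M3 M4 (algebraMap M1 M3 (algebraMap F M1 (b * x ^ q + b ^ q)))

section
namespace FFPrime
variable {K : Type} [Field K] (v : FFPrime K)

def o (x : K) : ℤ := (v.ord x).untopD 0

lemma ord_eq {x : K} (hx : x ≠ 0) : v.ord x = ((v.o x : ℤ) : WithTop ℤ) := by
  have h := v.ord_ne_top x hx
  unfold o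
  cases h' : v.ord x with
  | top => exact absurd h' h
  | coe a => simp

lemma o_of_ord {x : K} {n : ℤ} (h : v.ord x = (n : WithTop ℤ)) : v.o x = n := by
  simp [o, h]

lemma ne_zero_of_ord {x : K} {n : ℤ} (h : v.ord x = (n : WithTop ℤ)) : x ≠ 0 := by
  rintro rfl; rw [v.ord_zero] at h; exact absurd h (by simp)

@[simp] lemma o_one : v.o 1 = 0 := by simp [o, v.ord_one]

@[simp] lemma o_zero : v.o 0 = 0 := by simp [o, v.ord_zero]

lemma o_mul {x y : K} (hx : x ≠ 0) (hy : y ≠ 0) : v.o (x * y) = v.o x + v.o y := by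
  apply v.o_of_ord
  rw [v.ord_mul, v.ord_eq hx, v.ord_eq hy]; simp

@[simp] lemma o_inv (x : K) : v.o x⁻¹ = - v.o x := by
  by_cases hx : x = 0
  · simp [hx]
  have := v.o_mul hx (inv_ne_zero hx)
  rw [mul_inv_cancel₀ hx, o_one] at this
  omega

lemma o_div {x y : K} (hx : x ≠ 0) (hy : y ≠ 0) : v.o (x / y) = v.o x - v.o y := by
  rw [div_eq_mul_inv, o_mul _ hx (inv_ne_zero hy), o_inv]; ring

@[simp] lemma o_pow (x : K) (n : ℕ) : v.o (x ^ n) = n * v.o x := by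
  by_cases hx : x = 0
  · rcases n with _ | n <;> simp [hx]
  induction n with
  | zero => simp
  | succ n ih => rw [pow_succ, o_mul _ (pow_ne_zero _ hx) hx, ih]; push_cast; ring

@[simp] lemma o_zpow (x : K) (n : ℤ) : v.o (x ^ n) = n * v.o x := by
  cases n with
  | ofNat n => simp
  | negSucc n => rw [zpow_negSucc, o_inv, o_pow, Int.negSucc_eq]; push_cast; ring

lemma o_neg_one : v.o (-1) = 0 := by
  have h := v.o_mul (x := (-1 : K)) (y := -1) (by simp) (by simp)
  simp at h; omega

@[simp] lemma o_neg (x : K) : v.o (-x) = v.o x := by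
  by_cases hx : x = 0
  · simp [hx]
  rw [← neg_one_mul, o_mul _ (by simp) hx, o_neg_one, zero_add]

lemma exists_o (n : ℤ) : ∃ x : K, x ≠ 0 ∧ v.o x = n := by
  obtain ⟨x, hx⟩ := v.ord_surj n
  exact ⟨x, v.ne_zero_of_ord hx, v.o_of_ord hx⟩

/-- `{x | ord x ≥ k}` -/
def M (k : ℤ) : AddSubgroup K where
  carrier := {x | (k : WithTop ℤ) ≤ v.ord x}
  zero_mem' := by simp [v.ord_zero]
  add_mem' := by
    intro a b ha hb
    exact le_trans (le_min ha hb) (v.ord_add a b)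
  neg_mem' := by
    intro a ha
    by_cases h : a = 0
    · simpa [h] using ha
    · change (k : WithTop ℤ) ≤ v.ord a at ha
      change (k : WithTop ℤ) ≤ v.ord (-a)
      rw [v.ord_eq (neg_ne_zero.mpr h), o_neg, ← v.ord_eq h]; exact ha

lemma mem_M' {x : K} {k : ℤ} : x ∈ v.M k ↔ (k : WithTop ℤ) ≤ v.ord x := Iff.rfl

lemma mem_M {x : K} (hx : x ≠ 0) {k : ℤ} : x ∈ v.M k ↔ k ≤ v.o x := by
  rw [mem_M', v.ord_eq hx]; exact WithTop.coe_le_coe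

lemma mem_M_iff {x : K} {k : ℤ} : x ∈ v.M k ↔ x = 0 ∨ k ≤ v.o x := by
  by_cases hx : x = 0
  · simp [hx, zero_mem]
  · simp [hx, v.mem_M hx]

lemma M_anti {k l : ℤ} (h : k ≤ l) : v.M l ≤ v.M k := fun x hx =>
  le_trans (WithTop.coe_le_coe.mpr h) (v.mem_M'.mp hx)

lemma mem_of_le {k l : ℤ} {x : K} (hx : x ∈ v.M l) (h : k ≤ l) : x ∈ v.M k := v.M_anti h hx

lemma mul_mem_M {x y : K} {k l : ℤ} (hx : x ∈ v.M k) (hy : y ∈ v.M l) : x * y ∈ v.M (k + l) := by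
  by_cases h1 : x = 0
  · simp [h1, zero_mem]
  by_cases h2 : y = 0
  · simp [h2, zero_mem]
  rw [v.mem_M (mul_ne_zero h1 h2), o_mul _ h1 h2]
  rw [v.mem_M h1] at hx
  rw [v.mem_M h2] at hy
  omega

lemma one_mem_M : (1 : K) ∈ v.M 0 := by rw [v.mem_M one_ne_zero]; simp

lemma mul_mem_M_left {x y : K} {l : ℤ} (hx : x ∈ v.M 0) (hy : y ∈ v.M l) : x * y ∈ v.M l := by
  simpa using v.mul_mem_M hx hy

lemma mul_mem_M_right {x y : K} {l : ℤ} (hx : x ∈ v.M l) (hy : y ∈ v.M 0) : x * y ∈ v.M l := by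
  simpa using v.mul_mem_M hx hy

lemma pow_mem_M {x : K} {k : ℤ} (hx : x ∈ v.M k) (n : ℕ) : x ^ n ∈ v.M (n * k) := by
  induction n with
  | zero => simpa using v.one_mem_M
  | succ n ih =>
    rw [pow_succ]; have := v.mul_mem_M ih hx; convert this using 2; push_cast; ring

lemma pow_mem_M0 {x : K} (hx : x ∈ v.M 0) (n : ℕ) : x ^ n ∈ v.M 0 := by
  simpa using v.pow_mem_M hx n

lemma self_mem_M (x : K) : x ∈ v.M (v.o x) := by rw [mem_M_iff]; right; rfl

lemma prod_mem_M0 {ι : Type*} (s : Finset ι) (f : ι → K) (h : ∀ i ∈ s, f i ∈ v.M 0) :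
    ∏ i ∈ s, f i ∈ v.M 0 := by
  classical
  induction s using Finset.induction_on with
  | empty => simpa using v.one_mem_M
  | insert a s ha ih =>
    rw [Finset.prod_insert ha]
    exact v.mul_mem_M_left (h a (by simp)) (ih fun i hi => h i (by simp [hi]))

lemma natCast_mem_M (n : ℕ) : (n : K) ∈ v.M 0 := by
  induction n with
  | zero => simp [zero_mem]
  | succ n ih => push_cast; exact add_mem ih v.one_mem_M

lemma ne_zero_of_not_mem {x : K} {k : ℤ} (h : x ∉ v.M k) : x ≠ 0 := by
  rintro rfl; exact h (zero_mem _)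

lemma o_eq_of {x : K} {k : ℤ} (h : x ∈ v.M k) (h' : x ∉ v.M (k + 1)) : v.o x = k := by
  have := v.ne_zero_of_not_mem h'
  rw [v.mem_M this] at h h'
  omega

lemma o_lt_of_not_mem {x : K} {k : ℤ} (h : x ∉ v.M k) : v.o x < k := by
  have := v.ne_zero_of_not_mem h
  rw [v.mem_M this] at h; omega

lemma not_mem_of {x : K} (hx : x ≠ 0) {k : ℤ} (h : v.o x < k) : x ∉ v.M k := by
  rw [v.mem_M hx]; omega

lemma o_add {x y : K} (hx : x ≠ 0) (hy : y ∈ v.M (v.o x + 1)) : x + y ≠ 0 ∧ v.o (x + y) = v.o x := by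
  have h1 : x + y ∈ v.M (v.o x) := add_mem (v.self_mem_M x) (v.mem_of_le hy (by omega))
  have h2 : x + y ∉ v.M (v.o x + 1) := by
    intro h
    have := sub_mem h hy
    rw [add_sub_cancel_right, v.mem_M hx] at this; omega
  exact ⟨v.ne_zero_of_not_mem h2, v.o_eq_of h1 h2⟩

lemma o_of_sub {x y : K} (hx : x ≠ 0) (h : y - x ∈ v.M (v.o x + 1)) : y ≠ 0 ∧ v.o y = v.o x := by
  have := v.o_add hx h; simpa using this

lemma mem_M_add_mul {x y : K} (hy : y ≠ 0) {k : ℤ} : x * y ∈ v.M k ↔ x ∈ v.M (k - v.o y) := by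
  by_cases hx : x = 0
  · simp [hx, zero_mem]
  rw [v.mem_M hx, v.mem_M (mul_ne_zero hx hy), v.o_mul hx hy]; omega

lemma ext_o {v w : FFPrime K} (h : ∀ x ≠ 0, v.o x = w.o x) : v = w := by
  have : v.ord = w.ord := by
    funext x
    by_cases hx : x = 0
    · rw [hx, v.ord_zero, w.ord_zero]
    · rw [v.ord_eq hx, w.ord_eq hx, h x hx]
  cases v; cases w; congr

/-- Build a prime from an integer valued function. -/
def mk' (f : K → ℤ) (h1 : ∀ x y, x ≠ 0 → y ≠ 0 → f (x * y) = f x + f y)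
    (h2 : ∀ x y, x ≠ 0 → y ≠ 0 → x + y ≠ 0 → min (f x) (f y) ≤ f (x + y))
    (h3 : ∃ x, x ≠ 0 ∧ f x = 1) : FFPrime K where
  ord x := by classical exact if x = 0 then ⊤ else ((f x : ℤ) : WithTop ℤ)
  ord_zero := by simp
  ord_ne_top x hx := by simp [hx]
  ord_one := by
    have := h1 1 1 one_ne_zero one_ne_zero
    simp at this; simp [this]
  ord_mul x y := by
    by_cases hx : x = 0
    · simp [hx]
    by_cases hy : y = 0
    · simp [hy]
    simp [hx, hy, h1]
  ord_add x y := by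
    by_cases hx : x = 0
    · subst hx; rw [zero_add]; exact min_le_right _ _
    by_cases hy : y = 0
    · subst hy; rw [add_zero]; exact min_le_left _ _
    by_cases hxy : x + y = 0
    · simp [hxy]
    simp only [hx, hy, hxy, if_false]
    exact_mod_cast h2 x y hx hy hxy
  ord_surj n := by
    obtain ⟨x, hx, hx1⟩ := h3
    have h10 : f 1 = 0 := by
      have := h1 1 1 one_ne_zero one_ne_zero
      simpa using this
    have hinv : f x⁻¹ = -1 := by
      have := h1 x x⁻¹ hx (inv_ne_zero hx)
      rw [mul_inv_cancel₀ hx] at this; omega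
    have hp : ∀ (y : K), y ≠ 0 → ∀ n : ℕ, f (y ^ n) = n * f y := by
      intro y hy n
      induction n with
      | zero => simpa using h10
      | succ n ih => rw [pow_succ, h1 _ _ (pow_ne_zero _ hy) hy, ih]; push_cast; ring
    rcases Int.eq_nat_or_neg n with ⟨m, rfl | rfl⟩
    · exact ⟨x ^ m, by simp [hx, hp x hx, hx1]⟩
    · exact ⟨x⁻¹ ^ m, by rw [if_neg (by simp [hx]), hp _ (inv_ne_zero hx), hinv]; simp⟩

lemma o_mk' (f : K → ℤ) (h1 h2 h3) {x : K} (hx : x ≠ 0) : (mk' f h1 h2 h3).o x = f x := by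
  apply o_of_ord; simp [mk', hx]

lemma eq_of_M_le {v w : FFPrime K} (h : ∀ x, x ∈ v.M 0 → x ∈ w.M 0) : v = w := by
  obtain ⟨π, hπ, hπ1⟩ := v.exists_o 1
  have hunit : ∀ x, x ≠ 0 → v.o x = 0 → w.o x = 0 := by
    intro x hx h0
    have a := h x (by rw [v.mem_M hx]; omega)
    have b := h x⁻¹ (by rw [v.mem_M (inv_ne_zero hx)]; simp [h0])
    rw [w.mem_M hx] at a
    rw [w.mem_M (inv_ne_zero hx), o_inv] at b
    omega
  have hgen : ∀ x, x ≠ 0 → w.o x = v.o x * w.o π := by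
    intro x hx
    have hz : π ^ (v.o x) ≠ 0 := zpow_ne_zero _ hπ
    have := hunit (x / π ^ (v.o x)) (div_ne_zero hx hz) (by rw [v.o_div hx hz]; simp [hπ1])
    rw [w.o_div hx hz, o_zpow] at this; omega
  obtain ⟨y, hy, hy1⟩ := w.exists_o 1
  have h1 := hgen y hy
  rw [hy1] at h1
  have h2 := h π (by rw [v.mem_M hπ]; omega)
  rw [w.mem_M hπ] at h2
  have h3 : w.o π = 1 := by
    have := Int.isUnit_iff.mp (IsUnit.of_mul_eq_one (v.o y) (by rw [mul_comm]; exact h1.symm))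
    omega
  apply ext_o
  intro x hx
  rw [hgen x hx, h3, mul_one]

lemma exists_sep {v w : FFPrime K} (h : v ≠ w) : ∃ x : K, x ≠ 0 ∧ 0 ≤ v.o x ∧ w.o x < 0 := by
  by_contra hc
  push Not at hc
  apply h
  apply eq_of_M_le
  intro x hx
  by_cases h0 : x = 0
  · simp [h0, zero_mem]
  · rw [v.mem_M h0] at hx; rw [w.mem_M h0]; exact hc x h0 hx

/-- positive at `v`, negative at `w` -/
lemma exists_sep' {v w : FFPrime K} (h : v ≠ w) : ∃ x : K, x ≠ 0 ∧ 0 < v.o x ∧ w.o x < 0 := by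
  obtain ⟨x, hx, h1, h2⟩ := exists_sep h
  obtain ⟨y, hy, h3, h4⟩ := exists_sep (Ne.symm h)
  refine ⟨x / y, div_ne_zero hx hy, ?_, ?_⟩
  · rw [o_div _ hx hy]; omega
  · rw [o_div _ hx hy]; omega

/-- `z` with negative order at `v` and positive order on all of `S`. -/
lemma exists_one (v : FFPrime K) (S : Finset (FFPrime K)) (hS : v ∉ S) :
    ∃ z : K, z ≠ 0 ∧ v.o z < 0 ∧ ∀ w ∈ S, 0 < w.o z := by
  classical
  induction S using Finset.induction_on with
  | empty =>
    obtain ⟨z, h, h'⟩ := v.exists_o (-1)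
    exact ⟨z, h, by omega, by simp⟩
  | insert w S hw ih =>
    obtain ⟨y, hy, hyv, hyS⟩ := ih (fun h => hS (by simp [h]))
    have hvw : v ≠ w := fun h => hS (by simp [h])
    obtain ⟨z, hz, hzv, hzw⟩ := exists_sep' (Ne.symm hvw)
    rcases lt_or_ge (w.o y) 0 with h | h
    · -- z' = z * y^r/(1+y^r)
      -- choose u = y + ... use y^r/(1+y^r) * z
      have key : ∃ r : ℕ, 0 < r ∧ ∀ u ∈ S, 0 < r * u.o y + u.o z := by
        refine ⟨1 + ∑ u ∈ S, (u.o z).natAbs, by omega, ?_⟩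
        intro u hu
        have h1 := hyS u hu
        have h2 : (u.o z).natAbs ≤ ∑ u ∈ S, (u.o z).natAbs :=
          Finset.single_le_sum (f := fun u : FFPrime K => (u.o z).natAbs) (by simp) hu
        have h3 : (((1 + ∑ u ∈ S, (u.o z).natAbs : ℕ)) : ℤ) * 1 ≤
          ((1 + ∑ u ∈ S, (u.o z).natAbs : ℕ)) * u.o y :=
          mul_le_mul_of_nonneg_left (by omega) (by positivity)
        have : (((1 + ∑ u ∈ S, (u.o z).natAbs : ℕ)) : ℤ) ≥ 1 + (u.o z).natAbs := by
          exact_mod_cast by omega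
        omega
      obtain ⟨r, hr, hrS⟩ := key
      have neg : ∀ u : FFPrime K, u.o y < 0 → 1 + y ^ r ≠ 0 ∧ u.o (1 + y ^ r) = r * u.o y := by
        intro u hu
        have := u.o_add (x := y ^ r) (y := 1) (pow_ne_zero _ hy)
          (by rw [u.mem_M one_ne_zero]; simp; nlinarith)
        rw [add_comm, this.2]; exact ⟨this.1, by simp⟩
      have pos : ∀ u : FFPrime K, 0 < u.o y → u.o (1 + y ^ r) = 0 := by
        intro u hu
        have := u.o_add (x := 1) (y := y ^ r) (one_ne_zero)
          (by rw [u.mem_M (pow_ne_zero _ hy)]; simp; nlinarith)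
        rw [this.2]; simp
      have hne := (neg v hyv).1
      have hoo : ∀ u : FFPrime K, u.o (z * y ^ r / (1 + y ^ r)) = u.o z + r * u.o y - u.o (1 + y ^ r) := by
        intro u
        rw [o_div _ (mul_ne_zero hz (pow_ne_zero _ hy)) hne, o_mul _ hz (pow_ne_zero _ hy), o_pow]
      refine ⟨z * y ^ r / (1 + y ^ r), div_ne_zero (mul_ne_zero hz (pow_ne_zero _ hy)) hne, ?_, ?_⟩
      · rw [hoo, (neg v hyv).2]; omega
      · intro u hu
        rcases Finset.mem_insert.mp hu with rfl | hu
        · rw [hoo, (neg u h).2]; omega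
        · rw [hoo, pos u (hyS u hu)]; have := hrS u hu; omega
    · have key : ∃ r : ℕ, 0 < r ∧ (∀ u ∈ S, 0 < r * u.o y + u.o z) ∧ r * v.o y + v.o z < 0 := by
        refine ⟨1 + (v.o z).natAbs + ∑ u ∈ S, (u.o z).natAbs, by omega, ?_, ?_⟩
        · intro u hu
          have h1 := hyS u hu
          have h2 : (u.o z).natAbs ≤ ∑ u ∈ S, (u.o z).natAbs :=
            Finset.single_le_sum (f := fun u : FFPrime K => (u.o z).natAbs) (by simp) hu
          generalize ∑ u ∈ S, (u.o z).natAbs = A at *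
          have : ((1 + (v.o z).natAbs + A : ℕ) : ℤ) * 1 ≤
            ((1 + (v.o z).natAbs + A : ℕ) : ℤ) * u.o y :=
            mul_le_mul_of_nonneg_left (by omega) (by positivity)
          omega
        · generalize ∑ u ∈ S, (u.o z).natAbs = A at *
          have : ((1 + (v.o z).natAbs + A : ℕ) : ℤ) * 1 ≤
            ((1 + (v.o z).natAbs + A : ℕ) : ℤ) * (-v.o y) :=
            mul_le_mul_of_nonneg_left (by omega) (by positivity)
          rw [mul_neg] at this
          omega
      obtain ⟨r, hr, hrS, hrv⟩ := key
      have hoo : ∀ u : FFPrime K, u.o (y ^ r * z) = r * u.o y + u.o z := by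
        intro u
        rw [o_mul _ (pow_ne_zero _ hy) hz, o_pow]
      refine ⟨y ^ r * z, mul_ne_zero (pow_ne_zero _ hy) hz, by rw [hoo]; exact hrv, ?_⟩
      intro u hu
      rcases Finset.mem_insert.mp hu with rfl | hu
      · rw [hoo]
        have : (0:ℤ) ≤ r * u.o y := mul_nonneg (by positivity) h
        omega
      · rw [hoo]; exact hrS u hu

/-- Weak approximation. -/
theorem weak_approx (S : Finset (FFPrime K)) (a : FFPrime K → K) (N : ℤ) :
    ∃ x : K, ∀ w ∈ S, x - a w ∈ w.M N := by
  classical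
  -- approximate idempotents
  have idem : ∀ v ∈ S, ∀ n : ℕ, ∃ e : K, e - 1 ∈ v.M n ∧ ∀ w ∈ S, w ≠ v → e ∈ w.M n := by
    intro v _ n
    obtain ⟨z, hz, hzv, hzS⟩ := exists_one v (S.erase v) (by simp)
    have hzn : z ^ (n+1) ≠ 0 := pow_ne_zero _ hz
    have h1 := v.o_add (x := z ^ (n+1)) (y := 1) hzn
      (by rw [v.mem_M one_ne_zero]; simp; nlinarith)
    have hne := h1.1
    refine ⟨z ^ (n+1) / (z ^ (n+1) + 1), ?_, ?_⟩
    · have : z ^ (n+1) / (z ^ (n+1) + 1) - 1 = - (z ^ (n+1) + 1)⁻¹ := by field_simp; ring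
      rw [this, neg_mem_iff, v.mem_M (inv_ne_zero hne), o_inv, h1.2, o_pow]
      push_cast; nlinarith
    · intro w hw hwv
      have hp := hzS w (by simp [hw, hwv])
      have h2 := w.o_add (x := 1) (y := z ^ (n+1)) one_ne_zero
        (by rw [w.mem_M hzn]; simp; nlinarith)
      rw [add_comm] at h2
      rw [w.mem_M (div_ne_zero hzn hne), o_div _ hzn hne, h2.2, o_pow]
      simp; nlinarith
  obtain ⟨B, hB⟩ : ∃ B : ℕ, ∀ v ∈ S, ∀ w ∈ S, N - w.o (a v) ≤ B := by
    refine ⟨∑ v ∈ S, ∑ w ∈ S, (N - w.o (a v)).natAbs, ?_⟩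
    intro v hv w hw
    have h1 := Finset.single_le_sum (f := fun v => ∑ w ∈ S, (N - w.o (a v)).natAbs)
      (fun _ _ => Nat.zero_le _) hv
    have h2 := Finset.single_le_sum (f := fun w : FFPrime K => (N - w.o (a v)).natAbs)
      (fun _ _ => Nat.zero_le _) hw
    have := h2.trans h1
    generalize (∑ v ∈ S, ∑ w ∈ S, (N - w.o (a v)).natAbs) = A at *
    omega
  choose! e he1 he2 using fun v (hv : v ∈ S) => idem v hv B
  refine ⟨∑ v ∈ S, e v * a v, ?_⟩
  intro w hw
  rw [← Finset.add_sum_erase _ _ hw]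
  have : e w * a w + ∑ x ∈ S.erase w, e x * a x - a w =
    (e w - 1) * a w + ∑ x ∈ S.erase w, e x * a x := by ring
  rw [this]
  refine add_mem ?_ (sum_mem ?_)
  · exact w.mem_of_le (w.mul_mem_M (he1 w hw) (w.self_mem_M (a w))) (by have := hB w hw w hw; omega)
  · intro u hu
    have hu' := Finset.mem_erase.mp hu
    exact w.mem_of_le (w.mul_mem_M (he2 u hu'.2 w hw (Ne.symm hu'.1)) (w.self_mem_M (a u)))
      (by have := hB u hu'.2 w hw; omega)

end FFPrime

end

section
open IntermediateField

/-- function field in one variable over `𝔽_p` -/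
def IsFF (p : ℕ) [Fact p.Prime] (E : Type) [Field E] [Algebra (ZMod p) E] : Prop :=
  ∃ t : E, Transcendental (ZMod p) t ∧ FiniteDimensional (adjoin (ZMod p) {t}) E

section
variable {p : ℕ} [Fact p.Prime] {E : Type} [Field E] [Algebra (ZMod p) E]

lemma IsFF.trdeg_le (hE : IsFF p E) : Algebra.trdeg (ZMod p) E ≤ 1 := by
  obtain ⟨t, ht, hfin⟩ := hE
  have h2 : Algebra.IsAlgebraic (adjoin (ZMod p) {t}) E := inferInstance
  have h3 : Algebra.IsAlgebraic (Algebra.adjoin (ZMod p) {t}) E := 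
    ⟨fun x => isAlgebraic_adjoin_iff.mp (h2.isAlgebraic x)⟩
  have := Algebra.IsAlgebraic.trdeg_le_cardinalMk (ZMod p) (A := E) ({t} : Set E)
  simpa using this

lemma IsFF.fin (hE : IsFF p E) {f : E} (hf : Transcendental (ZMod p) f) :
    FiniteDimensional (adjoin (ZMod p) {f}) E := by
  have h1 := hE.trdeg_le
  have hind : AlgebraicIndependent (ZMod p) (fun _ : Unit => f) := by
    rw [algebraicIndependent_unique_type_iff]; exact hf
  have hb := hind.isTranscendenceBasis_of_trdeg_le_of_finite (by simpa using h1)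
  have halg := hb.isAlgebraic_field
  rw [Set.range_const] at halg
  obtain ⟨t, ht, hfin⟩ := hE
  obtain ⟨s, hs⟩ := Module.Finite.fg_top (R := adjoin (ZMod p) {t}) (M := E)
  have hs2 : adjoin (adjoin (ZMod p) {f}) (insert t (s : Set E)) = ⊤ := by
    rw [eq_top_iff]
    intro x hxt
    clear hxt
    have hx : x ∈ Submodule.span (adjoin (ZMod p) {t}) (s : Set E) := by rw [hs]; trivial
    induction hx using Submodule.span_induction with
    | mem x h => exact subset_adjoin _ _ (by simp [show x ∈ s from h])
    | zero => exact zero_mem _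
    | add x y _ _ h1 h2 => exact add_mem h1 h2
    | smul a x _ h =>
      rw [Algebra.smul_def]
      refine mul_mem ?_ h
      have ha : (a : E) ∈ adjoin (ZMod p) {t} := a.2
      have hle : adjoin (ZMod p) {t} ≤
          (adjoin (adjoin (ZMod p) {f}) (insert t (s : Set E))).restrictScalars (ZMod p) := by
        rw [adjoin_le_iff]
        intro y hy
        rw [Set.mem_singleton_iff] at hy; subst hy
        exact subset_adjoin (adjoin (ZMod p) {f}) _ (by simp)
      exact hle ha
  have : FiniteDimensional (adjoin (ZMod p) {f}) (adjoin (adjoin (ZMod p) {f}) (insert t (s : Set E))) := by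
    have : Finite ↑(insert t (s : Set E)) := (Set.Finite.insert t s.finite_toSet)
    apply finiteDimensional_adjoin
    intro x _
    exact (halg.isAlgebraic x).isIntegral
  rw [hs2] at this
  exact Module.Finite.equiv (topEquiv (F := adjoin (ZMod p) {f}) (E := E)).toLinearEquiv

/-- Linear independence over `𝔽_p(f)` may be checked with polynomial coefficients. -/
lemma linInd_of_poly {f : E} {ι : Type} [Finite ι] (y : ι → E)
    (h : ∀ P : ι → Polynomial (ZMod p), ∑ᶠ i, Polynomial.aeval f (P i) * y i = 0 → ∀ i, P i = 0) :
    LinearIndependent (adjoin (ZMod p) {f}) y := by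
  classical
  cases nonempty_fintype ι
  rw [Fintype.linearIndependent_iff]
  intro g hg
  have hg' : ∀ i, ∃ r s : Polynomial (ZMod p), Polynomial.aeval f s ≠ 0 ∧
      (g i : E) = Polynomial.aeval f r / Polynomial.aeval f s := by
    intro i
    obtain ⟨r, s, hrs⟩ := (mem_adjoin_simple_iff (ZMod p) (α := f) (g i : E)).mp (g i).2
    by_cases hs : Polynomial.aeval f s = 0
    · refine ⟨0, 1, by simp, ?_⟩
      rw [hrs, hs]; simp
    · exact ⟨r, s, hs, hrs⟩
  choose r s hs hrs using hg'
  have key := h (fun i => r i * ∏ j ∈ Finset.univ.erase i, s j) (by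
    rw [finsum_eq_sum_of_fintype]
    have : (∏ j, Polynomial.aeval f (s j)) * ∑ i, g i • y i = 0 := by rw [hg, mul_zero]
    rw [← this, Finset.mul_sum]
    refine Finset.sum_congr rfl fun i _ => ?_
    rw [Algebra.smul_def, ← Finset.mul_prod_erase Finset.univ _ (Finset.mem_univ i)]
    rw [map_mul, map_prod]
    change _ = _ * ((g i : E) * y i)
    rw [hrs i]
    have := hs i
    field_simp)
  intro i
  have hi := key i
  rw [mul_eq_zero] at hi
  rcases hi with hi | hi
  · apply Subtype.ext
    rw [hrs i, hi]; simp
  · rw [Finset.prod_eq_zero_iff] at hi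
    obtain ⟨j, _, hj⟩ := hi
    exact absurd (by rw [hj]; simp) (hs j)

lemma alg_pow_eq_one {x : E} (hx : IsAlgebraic (ZMod p) x) (h0 : x ≠ 0) : ∃ n : ℕ, 0 < n ∧ x ^ n = 1 := by
  have hfd : FiniteDimensional (ZMod p) (adjoin (ZMod p) {x}) :=
    adjoin.finiteDimensional hx.isIntegral
  have : Finite (adjoin (ZMod p) {x}) := Module.finite_of_finite (ZMod p)
  let x' : (adjoin (ZMod p) {x}) := ⟨x, mem_adjoin_simple_self _ _⟩
  have hx' : x' ≠ 0 := fun h => h0 (congrArg Subtype.val h)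
  obtain ⟨n, hn, hn'⟩ := isOfFinOrder_iff_pow_eq_one.mp (isOfFinOrder_of_finite (Units.mk0 x' hx'))
  refine ⟨n, hn, ?_⟩
  have := congrArg (fun u : (adjoin (ZMod p) {x})ˣ => ((u : adjoin (ZMod p) {x}) : E)) hn'
  simpa using this

lemma FFPrime.o_alg (w : FFPrime E) {x : E} (hx : IsAlgebraic (ZMod p) x) : w.o x = 0 := by
  by_cases h0 : x = 0
  · simp [h0]
  obtain ⟨n, hn, h⟩ := alg_pow_eq_one hx h0
  have := w.o_pow x n
  rw [h, w.o_one] at this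
  have hn' : (n : ℤ) ≠ 0 := by exact_mod_cast hn.ne'
  have h2 := mul_eq_zero.mp this.symm
  tauto

lemma FFPrime.transc (w : FFPrime E) {x : E} (hx : w.o x ≠ 0) : Transcendental (ZMod p) x :=
  fun h => hx (w.o_alg h)

lemma FFPrime.zmod_mem (w : FFPrime E) (a : ZMod p) : algebraMap (ZMod p) E a ∈ w.M 0 := by
  rw [w.mem_M_iff]; right
  exact (w.o_alg (isAlgebraic_algebraMap a)).ge

lemma FFPrime.zmod_unit (w : FFPrime E) {a : ZMod p} (ha : a ≠ 0) : algebraMap (ZMod p) E a ∉ w.M 1 := by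
  apply w.not_mem_of (by simpa using ha)
  rw [w.o_alg (isAlgebraic_algebraMap a)]; omega

/-- Reduction to nonzero constant terms. -/
lemma poly_div_X {ι : Type} [Fintype ι] {f : E} (hf0 : f ≠ 0) (y : ι → E)
    (h : ∀ P : ι → Polynomial (ZMod p), (∃ i, (P i).coeff 0 ≠ 0) →
      ∑ i, Polynomial.aeval f (P i) * y i ≠ 0) :
    ∀ P : ι → Polynomial (ZMod p), ∑ᶠ i, Polynomial.aeval f (P i) * y i = 0 → ∀ i, P i = 0 := by
  have main : ∀ (n : ℕ) (P : ι → Polynomial (ZMod p)), (∀ i, (P i).natDegree ≤ n) →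
      ∑ i, Polynomial.aeval f (P i) * y i = 0 → ∀ i, P i = 0 := by
    intro n
    induction n with
    | zero =>
      intro P hP hs i
      by_contra hne
      refine h P ⟨i, ?_⟩ hs
      intro h0
      apply hne
      rw [Polynomial.eq_C_of_natDegree_le_zero (hP i), h0]; simp
    | succ n ih =>
      intro P hP hs
      have hc : ∀ i, (P i).coeff 0 = 0 := by
        by_contra hc
        push Not at hc
        exact h P hc hs
      have hd : ∀ i, P i = Polynomial.X * (P i).divX := by
        intro i
        conv_lhs => rw [← Polynomial.X_mul_divX_add (P i), hc i]
        simp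
      have := ih (fun i => (P i).divX) (fun i => by
        rw [Polynomial.natDegree_divX_eq_natDegree_tsub_one]; have := hP i; omega) (by
        have h2 : f * ∑ i, Polynomial.aeval f ((P i).divX) * y i = 0 := by
          rw [← hs, Finset.mul_sum]
          refine Finset.sum_congr rfl fun i _ => ?_
          conv_rhs => rw [hd i]
          simp [mul_assoc]
        exact (mul_eq_zero.mp h2).resolve_left hf0)
      intro i
      rw [hd i, this i, mul_zero]
  intro P hP
  rw [finsum_eq_sum_of_fintype] at hP
  exact main (∑ i, (P i).natDegree) P (fun i =>
    Finset.single_le_sum (f := fun i => (P i).natDegree) (fun _ _ => Nat.zero_le _) (Finset.mem_univ i)) hP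

/-- aeval at `f` is constant term plus multiple of `f` -/
lemma aeval_split (f : E) (P : Polynomial (ZMod p)) :
    Polynomial.aeval f P = algebraMap (ZMod p) E (P.coeff 0) + f * Polynomial.aeval f P.divX := by
  have := congrArg (Polynomial.aeval f) (Polynomial.X_mul_divX_add P)
  rw [← this, map_add, map_mul, Polynomial.aeval_X, Polynomial.aeval_C, add_comm]

end

end

section
open IntermediateField

section
variable {p : ℕ} [Fact p.Prime] {E : Type} [Field E] [Algebra (ZMod p) E]

lemma val_alg {Γ : Type*} [LinearOrderedCommGroupWithZero Γ] (v : Valuation E Γ) {x : E}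
    (hx : IsAlgebraic (ZMod p) x) (h0 : x ≠ 0) : v x = 1 := by
  obtain ⟨n, hn, h⟩ := alg_pow_eq_one hx h0
  have := v.map_pow x n
  rw [h, v.map_one] at this
  exact (pow_eq_one_iff_of_nonneg zero_le hn.ne').mp this.symm

lemma val_zmod_le {Γ : Type*} [LinearOrderedCommGroupWithZero Γ] (v : Valuation E Γ) (a : ZMod p) :
    v (algebraMap (ZMod p) E a) ≤ 1 := by
  by_cases h : algebraMap (ZMod p) E a = 0
  · simp [h]
  · rw [val_alg v (isAlgebraic_algebraMap a) h]

lemma val_aeval_le {Γ : Type*} [LinearOrderedCommGroupWithZero Γ] (v : Valuation E Γ) {f : E}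
    (hf : v f ≤ 1) (P : Polynomial (ZMod p)) : v (Polynomial.aeval f P) ≤ 1 := by
  rw [Polynomial.aeval_eq_sum_range]
  refine v.map_sum_le fun i _ => ?_
  rw [Algebra.smul_def, v.map_mul, v.map_pow]
  exact mul_le_one' (val_zmod_le v _) (pow_le_one' hf i)

lemma chain_bound (hE : IsFF p E) {Γ : Type*} [LinearOrderedCommGroupWithZero Γ] (v : Valuation E Γ)
    {f : E} (hf0 : f ≠ 0) (hf : v f < 1) :
    {γ : Γ | v f ≤ γ ∧ γ < 1 ∧ ∃ x, v x = γ}.Finite := by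
  have htr : Transcendental (ZMod p) f := fun h => hf.ne (val_alg v h hf0)
  have hfd := hE.fin htr
  by_contra hinf
  set N := Module.finrank (adjoin (ZMod p) {f}) E
  obtain ⟨t, ht, htc⟩ := Set.Infinite.exists_subset_card_eq (hinf) (N + 1)
  let e := t.orderEmbOfFin htc
  have he : ∀ i, e i ∈ {γ : Γ | v f ≤ γ ∧ γ < 1 ∧ ∃ x, v x = γ} := fun i =>
    ht (t.orderEmbOfFin_mem htc i)
  choose x hx using fun i => (he i).2.2
  have hli : LinearIndependent (adjoin (ZMod p) {f}) x := by
    apply linInd_of_poly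
    apply poly_div_X hf0
    intro P ⟨i0, hi0⟩ hsum
    classical
    let S := Finset.univ.filter (fun i => (P i).coeff 0 ≠ 0)
    have hS : S.Nonempty := ⟨i0, by simp [S, hi0]⟩
    let j := S.max' hS
    have hj : j ∈ S := S.max'_mem hS
    have hjc : (P j).coeff 0 ≠ 0 := (Finset.mem_filter.mp hj).2
    have vf0 : v f ≠ 0 := (v.ne_zero_iff).mpr hf0
    have hxj : v (x j) ≠ 0 := by
      rw [hx]; exact ((zero_lt_iff.mpr vf0).trans_le (he j).1).ne'
    have hPj : v (Polynomial.aeval f (P j)) = 1 := by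
      rw [aeval_split]
      have h1 : v (algebraMap (ZMod p) E ((P j).coeff 0)) = 1 :=
        val_alg v (isAlgebraic_algebraMap _) (by simpa using hjc)
      rw [v.map_add_eq_of_lt_left, h1]
      rw [h1, v.map_mul]
      exact mul_lt_one_of_lt_of_le hf (val_aeval_le v hf.le _)
    rw [← Finset.add_sum_erase _ _ (Finset.mem_univ j)] at hsum
    have hlt : v (∑ i ∈ Finset.univ.erase j, Polynomial.aeval f (P i) * x i) < v (x j) := by
      refine v.map_sum_lt hxj fun i hi => ?_
      have hij := (Finset.mem_erase.mp hi).1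
      rw [v.map_mul]
      by_cases hc : (P i).coeff 0 = 0
      · rw [aeval_split, hc, map_zero, zero_add, v.map_mul]
        calc v f * v (Polynomial.aeval f (P i).divX) * v (x i)
            ≤ v f * v (x i) := by
              gcongr
              exact mul_le_of_le_one_right' (val_aeval_le v hf.le _)
          _ < v f * 1 := by
              apply mul_lt_mul_of_pos_left _ (zero_lt_iff.mpr vf0)
              rw [hx]; exact (he i).2.1
          _ = v f := mul_one _
          _ ≤ v (x j) := by rw [hx]; exact (he j).1
      · have hlt : i < j := lt_of_le_of_ne (S.le_max' i (by simp [S, hc])) hij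
        calc v (Polynomial.aeval f (P i)) * v (x i) ≤ v (x i) :=
              mul_le_of_le_one_left' (val_aeval_le v hf.le _)
          _ < v (x j) := by rw [hx, hx]; exact e.strictMono hlt
    have heq : Polynomial.aeval f (P j) * x j = - ∑ i ∈ Finset.univ.erase j, Polynomial.aeval f (P i) * x i :=
      eq_neg_of_add_eq_zero_left hsum
    have : v (x j) < v (x j) := by
      calc v (x j) = v (Polynomial.aeval f (P j) * x j) := by rw [v.map_mul, hPj, one_mul]
        _ = _ := by rw [heq, v.map_neg]
        _ < _ := hlt
    exact lt_irrefl _ this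
  have := hli.fintype_card_le_finrank
  simp [N] at this

theorem exists_prime_of_valuationSubring (hE : IsFF p E) (V : ValuationSubring E) (hV : V ≠ ⊤) :
    ∃ w : FFPrime E, ∀ x, x ∈ V ↔ x ∈ w.M 0 := by
  set v := V.valuation
  have hmem : ∀ x, x ∈ V ↔ v x ≤ 1 := fun x => (V.valuation_le_one_iff x).symm
  obtain ⟨g, hg⟩ : ∃ g, g ∉ V := by
    by_contra h
    push Not at h
    exact hV (by ext x; simp [h x])
  have hg0 : g ≠ 0 := fun h => hg (h ▸ V.zero_mem)
  have hg1 : 1 < v g := by rw [hmem] at hg; exact not_le.mp hg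
  have hf : v g⁻¹ < 1 := by rw [map_inv₀]; exact inv_lt_one_of_one_lt₀ hg1
  have hf0 : g⁻¹ ≠ 0 := inv_ne_zero hg0
  obtain ⟨γ, ⟨hγ1, hγ2, π, rfl⟩, hmax⟩ := Set.exists_max_image _ id (chain_bound hE v hf0 hf)
    ⟨v g⁻¹, le_rfl, hf, _, rfl⟩
  have hπ : ∀ x, v x < 1 → v x ≤ v π := by
    intro x hx
    by_cases h : v g⁻¹ ≤ v x
    · exact hmax (v x) ⟨h, hx, x, rfl⟩
    · exact (not_le.mp h).le.trans hγ1
  have hπ0 : v π ≠ 0 := by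
    intro h
    rw [h, le_zero_iff, v.zero_iff] at hγ1
    exact hf0 hγ1
  have hπpos : 0 < v π := zero_lt_iff.mpr hπ0
  have hanti : StrictAnti (fun n : ℤ => v π ^ n) := zpow_right_strictAnti₀ hπpos hγ2
  have hint1 : ∀ x, x ≠ 0 → v x ≤ 1 → ∃ n : ℤ, v x = v π ^ n := by
    intro x hx hx1
    rcases hx1.lt_or_eq with hlt | heq
    swap
    · exact ⟨0, by simpa using heq⟩
    have hex : ∃ n : ℕ, v π ^ (n + 1) < v x := by
      by_contra hcon
      push Not at hcon
      refine (Set.infinite_of_injective_forall_mem (f := fun n : ℕ => v π ^ (n+1)) ?_ ?_)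
        (chain_bound hE v hx hlt)
      · intro a b hab
        have := (pow_right_strictAnti₀ hπpos hγ2).injective hab
        omega
      · intro n
        exact ⟨hcon n, pow_lt_one₀ zero_le hγ2 (by omega), π ^ (n+1), by simp⟩
    classical
    have hn := Nat.find_spec hex
    set n := Nat.find hex
    have hle : v x ≤ v π ^ n := by
      rcases Nat.eq_zero_or_pos n with h0 | hpos
      · rw [h0, pow_zero]; exact hx1
      · have := Nat.find_min hex (m := n - 1) (by omega)
        rw [not_lt] at this
        convert this using 2; omega
    refine ⟨n, ?_⟩
    rw [zpow_natCast]
    apply le_antisymm hle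
    by_contra hlt2
    push Not at hlt2
    have h1 : v (x / π ^ n) < 1 := by
      rw [map_div₀, map_pow, div_lt_one₀ (pow_pos hπpos n)]; exact hlt2
    have h2 := hπ _ h1
    rw [map_div₀, map_pow, div_le_iff₀ (pow_pos hπpos n), ← pow_succ'] at h2
    exact absurd hn (not_lt.mpr h2)
  have hintg : ∀ x, x ≠ 0 → ∃ n : ℤ, v x = v π ^ n := by
    intro x hx
    rcases le_total (v x) 1 with h | h
    · exact hint1 x hx h
    · obtain ⟨n, hn⟩ := hint1 x⁻¹ (inv_ne_zero hx) (by rw [map_inv₀]; exact inv_le_one_of_one_le₀ h)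
      exact ⟨-n, by rw [zpow_neg, ← hn, map_inv₀, inv_inv]⟩
  choose! F hF using hintg
  have hπne : π ≠ 0 := fun h => hπ0 (by rw [h, map_zero])
  let w : FFPrime E := FFPrime.mk' F
    (by
      intro x y hx hy
      apply hanti.injective
      simp only
      rw [← hF _ (mul_ne_zero hx hy), zpow_add₀ hπ0, ← hF x hx, ← hF y hy, map_mul])
    (by
      intro x y hx hy hxy
      have h := v.map_add x y
      rw [hF _ hx, hF _ hy, hF _ hxy] at h
      by_contra hlt
      push Not at hlt
      rw [lt_min_iff] at hlt
      have h1 := hanti hlt.1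
      have h2 := hanti hlt.2
      exact absurd h (not_le.mpr (max_lt h1 h2)))
    ⟨π, hπne, by
      apply hanti.injective
      simp only
      rw [← hF _ hπne, zpow_one]⟩
  refine ⟨w, fun x => ?_⟩
  by_cases hx : x = 0
  · subst hx; exact ⟨fun _ => zero_mem _, fun _ => V.zero_mem⟩
  rw [hmem, w.mem_M hx, FFPrime.o_mk' _ _ _ _ hx, hF x hx]
  rw [← zpow_zero (v π)]
  exact hanti.le_iff_ge

/-- Existence of places. -/
theorem exists_prime_of_ideal (hE : IsFF p E) (A : Subring E) (I : Ideal A) (hI : I ≠ ⊤) (hI0 : I ≠ ⊥) :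
    ∃ w : FFPrime E, (∀ x ∈ A, x ∈ w.M 0) ∧ ∀ x : A, x ∈ I → (x : E) ∈ w.M 1 := by
  obtain ⟨V, hAV, hIV⟩ := Ideal.image_subset_nonunits_valuationSubring I hI
  have hnon : ∀ x : A, x ∈ I → (x : E) ∈ V ∧ (x : E) ≠ 0 → (x:E)⁻¹ ∉ V := by
    intro x hx h hx'
    have h1 : (x : E) ∈ V.nonunits := hIV ⟨x, hx, rfl⟩
    rw [ValuationSubring.mem_nonunits_iff] at h1
    rw [← V.valuation_le_one_iff, map_inv₀] at hx'
    have h2 : 1 < (V.valuation (x:E))⁻¹ := (one_lt_inv₀ (zero_lt_iff.mpr (V.valuation.ne_zero_iff.mpr h.2))).mpr h1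
    exact absurd hx' (not_le.mpr h2)
  have hV : V ≠ ⊤ := by
    rintro rfl
    obtain ⟨x, hx, hx0⟩ := Submodule.exists_mem_ne_zero_of_ne_bot hI0
    exact hnon x hx ⟨trivial, fun h => hx0 (Subtype.ext h)⟩ trivial
  obtain ⟨w, hw⟩ := exists_prime_of_valuationSubring hE V hV
  refine ⟨w, fun x hx => (hw x).mp (hAV hx), fun x hx => ?_⟩
  by_cases hx0 : (x : E) = 0
  · rw [hx0]; exact zero_mem _
  have h1 : (x : E) ∈ w.M 0 := (hw _).mp (hAV x.2)
  have h2 := hnon x hx ⟨hAV x.2, hx0⟩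
  rw [hw, w.mem_M (inv_ne_zero hx0), w.o_inv] at h2
  rw [w.mem_M hx0]; omega

lemma exists_zero (hE : IsFF p E) {f : E} (hf : Transcendental (ZMod p) f) : ∃ w : FFPrime E, 0 < w.o f := by
  have hf0 : f ≠ 0 := fun h => hf (by rw [h]; exact isAlgebraic_zero)
  let A := (Algebra.adjoin (ZMod p) {f}).toSubring
  let f' : A := ⟨f, Algebra.self_mem_adjoin_singleton _ _⟩
  obtain ⟨w, _, hw⟩ := exists_prime_of_ideal hE A (Ideal.span {f'})
    (by
      rw [Ne, Ideal.span_singleton_eq_top]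
      intro hu
      obtain ⟨g, hg⟩ := hu.exists_right_inv
      have hgm : (g : E) ∈ Algebra.adjoin (ZMod p) {f} := g.2
      rw [Algebra.adjoin_singleton_eq_range_aeval] at hgm
      obtain ⟨P, hP⟩ := hgm
      have h1 : f * (g : E) = 1 := congrArg Subtype.val hg
      apply hf
      refine ⟨Polynomial.X * P - 1, ?_, ?_⟩
      · intro h
        have := congrArg (Polynomial.coeff · 0) h
        simp at this
      · have hP' : Polynomial.aeval f P = (g : E) := hP
        simp [hP', h1])
    (by
      rw [Ne, Ideal.span_singleton_eq_bot]
      intro h; exact hf0 (congrArg Subtype.val h))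
  exact ⟨w, by
    have := hw f' (Ideal.mem_span_singleton_self _)
    rw [w.mem_M hf0] at this; omega⟩

lemma exists_pole (hE : IsFF p E) {f : E} (hf : Transcendental (ZMod p) f) : ∃ w : FFPrime E, w.o f < 0 := by
  have : Transcendental (ZMod p) f⁻¹ := fun h => hf (by simpa using h.inv)
  obtain ⟨w, hw⟩ := exists_zero hE this
  exact ⟨w, by rw [w.o_inv] at hw; omega⟩

lemma isAlgebraic_of_o_nonneg (hE : IsFF p E) {f : E} (h : ∀ w : FFPrime E, 0 ≤ w.o f) :
    IsAlgebraic (ZMod p) f := by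
  by_contra hf
  obtain ⟨w, hw⟩ := exists_pole hE hf
  have := h w; omega

lemma IsFF.nonempty (hE : IsFF p E) : Nonempty (FFPrime E) := by
  obtain ⟨t, ht, h⟩ := hE
  obtain ⟨w, -⟩ := exists_zero ⟨t, ht, h⟩ ht
  exact ⟨w⟩

end

end

section
open IntermediateField

namespace FFPrime
variable {K F : Type} [Field K] [Field F]

lemma liesOverWith_iff (w : FFPrime F) (v : FFPrime K) (φ : K →+* F) (e : ℕ) :
    w.LiesOverWith v φ e ↔ 0 < e ∧ ∀ x, w.o (φ x) = e * v.o x := by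
  constructor
  · rintro ⟨h1, h2⟩
    refine ⟨h1, fun x => ?_⟩
    by_cases hx : x = 0
    · simp [hx]
    · apply w.o_of_ord
      rw [h2, v.ord_eq hx]; norm_cast
  · rintro ⟨h1, h2⟩
    refine ⟨h1, fun x => ?_⟩
    by_cases hx : x = 0
    · rw [hx, map_zero, w.ord_zero, v.ord_zero, WithTop.mul_top]
      simp; omega
    · rw [w.ord_eq (by simpa using hx), v.ord_eq hx, h2]; norm_cast

lemma LiesOverWith.o {w : FFPrime F} {v : FFPrime K} {φ : K →+* F} {e : ℕ}
    (h : w.LiesOverWith v φ e) (x : K) : w.o (φ x) = e * v.o x :=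
  ((liesOverWith_iff w v φ e).mp h).2 x

lemma LiesOverWith.mem0 {w : FFPrime F} {v : FFPrime K} {φ : K →+* F} {e : ℕ}
    (h : w.LiesOverWith v φ e) {x : K} : φ x ∈ w.M 0 ↔ x ∈ v.M 0 := by
  have he := h.1
  by_cases hx : x = 0
  · subst hx; simp [zero_mem]
  · rw [w.mem_M (by simpa using hx), v.mem_M hx, h.o]
    constructor
    · intro h; by_contra h'; push Not at h'
      have : (e:ℤ) * v.o x < 0 := mul_neg_of_pos_of_neg (by omega) h'
      omega
    · intro h; positivity

lemma LiesOverWith.mem {w : FFPrime F} {v : FFPrime K} {φ : K →+* F} {e : ℕ}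
    (h : w.LiesOverWith v φ e) {x : K} (k : ℤ) : φ x ∈ w.M (e * k) ↔ x ∈ v.M k := by
  have he := h.1
  by_cases hx : x = 0
  · subst hx; simp [zero_mem]
  · rw [w.mem_M (by simpa using hx), v.mem_M hx, h.o]
    exact mul_le_mul_iff_right₀ (by omega)

lemma ramIdx_eq {w : FFPrime F} {v : FFPrime K} {φ : K →+* F} {e : ℕ}
    (h : w.LiesOverWith v φ e) : w.ramIdx v φ = e := by
  have h' : ∃ e, w.LiesOverWith v φ e := ⟨e, h⟩
  unfold ramIdx
  rw [dif_pos h']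
  obtain ⟨x, hx, hx1⟩ := v.exists_o 1
  have h1 := h'.choose_spec.o x
  rw [h.o x, hx1] at h1
  simp at h1
  exact h1.symm

lemma liesOver_unique {w : FFPrime F} {v v' : FFPrime K} {φ : K →+* F}
    (h : w.LiesOver v φ) (h' : w.LiesOver v' φ) : v = v' := by
  obtain ⟨e, h⟩ := h
  obtain ⟨e', h'⟩ := h'
  exact eq_of_M_le fun x hx => h'.mem0.mp (h.mem0.mpr hx)

lemma exists_restrict (w : FFPrime F) (φ : K →+* F) (y : K) (hy : w.o (φ y) ≠ 0) :
    ∃ u : FFPrime K, w.LiesOver u φ := by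
  classical
  have hne : ∀ x, x ≠ 0 → φ x ≠ 0 := fun x hx => by simpa using hx
  let A : AddSubgroup ℤ :=
    { carrier := {n | ∃ x : K, x ≠ 0 ∧ w.o (φ x) = n}
      zero_mem' := ⟨1, one_ne_zero, by simp⟩
      add_mem' := by
        rintro _ _ ⟨x, hx, rfl⟩ ⟨y, hy, rfl⟩
        exact ⟨x * y, mul_ne_zero hx hy, by rw [map_mul, w.o_mul (hne x hx) (hne y hy)]⟩
      neg_mem' := by
        rintro _ ⟨x, hx, rfl⟩
        exact ⟨x⁻¹, inv_ne_zero hx, by rw [map_inv₀, w.o_inv]⟩ }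
  obtain ⟨g, hg⟩ := Int.subgroup_cyclic A
  have hy0 : y ≠ 0 := by rintro rfl; simp at hy
  have hmem : ∀ x, x ≠ 0 → (g.natAbs : ℤ) ∣ w.o (φ x) := by
    intro x hx
    have : w.o (φ x) ∈ A := ⟨x, hx, rfl⟩
    rw [hg, ← AddSubgroup.zmultiples_eq_closure, Int.mem_zmultiples_iff] at this
    exact Int.natAbs_dvd.mpr this
  have hgA : (g.natAbs : ℤ) ∈ A := by
    have : g ∈ A := by rw [hg]; exact AddSubgroup.mem_closure_singleton_self g
    rcases Int.natAbs_eq g with h | h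
    · rwa [← h]
    · rw [h] at this; simpa using A.neg_mem this
  have hg0 : 0 < g.natAbs := by
    rcases Nat.eq_zero_or_pos g.natAbs with h | h
    · have := hmem y hy0
      rw [h] at this; simp at this; exact absurd this hy
    · exact h
  set e := g.natAbs
  have he : (0:ℤ) < e := by exact_mod_cast hg0
  have hdiv : ∀ x, x ≠ 0 → w.o (φ x) = e * (w.o (φ x) / e) := fun x hx =>
    (Int.mul_ediv_cancel' (hmem x hx)).symm
  let u : FFPrime K := mk' (fun x => w.o (φ x) / e)
    (by
      intro x y hx hy
      apply mul_left_cancel₀ he.ne'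
      rw [← hdiv _ (mul_ne_zero hx hy), mul_add, ← hdiv x hx, ← hdiv y hy, map_mul,
        w.o_mul (hne x hx) (hne y hy)])
    (by
      intro x y hx hy hxy
      have h1 : φ (x + y) ∈ w.M (min (w.o (φ x)) (w.o (φ y))) := by
        rw [map_add]
        exact add_mem (w.mem_of_le (w.self_mem_M _) (min_le_left _ _))
          (w.mem_of_le (w.self_mem_M _) (min_le_right _ _))
      rw [w.mem_M (hne _ hxy)] at h1
      rcases min_le_iff.mp h1 with h | h
      · exact min_le_iff.mpr (Or.inl (Int.ediv_le_ediv he h))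
      · exact min_le_iff.mpr (Or.inr (Int.ediv_le_ediv he h)))
    (by
      obtain ⟨x, hx, h⟩ := hgA
      exact ⟨x, hx, by rw [h]; exact Int.ediv_self he.ne'⟩)
  refine ⟨u, e, (liesOverWith_iff _ _ _ _).mpr ⟨hg0, fun x => ?_⟩⟩
  by_cases hx : x = 0
  · simp [hx]
  · rw [o_mk' _ _ _ _ hx, ← hdiv x hx]

lemma mem_of_integral (w : FFPrime F) (φ : K →+* F) {P : Polynomial K} (hP : P.Monic)
    (hc : ∀ n, φ (P.coeff n) ∈ w.M 0) {y : F} (hy : P.eval₂ φ y = 0) : y ∈ w.M 0 := by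
  by_contra hcon
  have hy0 := w.ne_zero_of_not_mem hcon
  have hlt := w.o_lt_of_not_mem hcon
  rw [Polynomial.eval₂_eq_sum_range, Finset.sum_range_succ, hP.coeff_natDegree, map_one, one_mul] at hy
  have h1 : y ^ P.natDegree = - ∑ i ∈ Finset.range P.natDegree, φ (P.coeff i) * y ^ i :=
    eq_neg_of_add_eq_zero_right hy
  have h2 : y ^ P.natDegree ∈ w.M (P.natDegree * w.o y + 1) := by
    rw [h1]
    apply neg_mem
    apply sum_mem
    intro i hi
    rw [Finset.mem_range] at hi
    apply w.mul_mem_M_left (hc i)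
    apply w.mem_of_le (w.pow_mem_M (w.self_mem_M y) i)
    have : (i:ℤ) + 1 ≤ P.natDegree := by exact_mod_cast hi
    nlinarith
  rw [w.mem_M (pow_ne_zero _ hy0), w.o_pow] at h2
  omega

/-- the valuation ring as a subring -/
def O (v : FFPrime K) : Subring K where
  carrier := {x | x ∈ v.M 0}
  mul_mem' h1 h2 := v.mul_mem_M_left h1 h2
  one_mem' := v.one_mem_M
  add_mem' {x y} h1 h2 := (v.M 0).add_mem (x := x) (y := y) h1 h2
  zero_mem' := zero_mem (v.M 0)
  neg_mem' {x} h := (v.M 0).neg_mem (x := x) h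

lemma mem_O {v : FFPrime K} {x : K} : x ∈ v.O ↔ x ∈ v.M 0 := Iff.rfl

end FFPrime

lemma zmod_tower (p : ℕ) (E E' : Type) [Field E] [Field E'] [Algebra (ZMod p) E]
    [Algebra (ZMod p) E'] [Algebra E E'] : IsScalarTower (ZMod p) E E' :=
  IsScalarTower.of_algebraMap_eq' (Subsingleton.elim _ _)

section
variable {p : ℕ} [Fact p.Prime] {E E' : Type} [Field E] [Field E'] [Algebra (ZMod p) E]
  [Algebra (ZMod p) E'] [Algebra E E']

theorem IsFF.ext (hE : IsFF p E) [FiniteDimensional E E'] : IsFF p E' := by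
  have := zmod_tower p E E'
  obtain ⟨t, ht, hfd⟩ := hE
  refine ⟨algebraMap E E' t, ?_, ?_⟩
  · exact (transcendental_algebraMap_iff (algebraMap E E').injective).mpr ht
  · have hf2 : FiniteDimensional (adjoin (ZMod p) {t}) E' := FiniteDimensional.trans _ E E'
    obtain ⟨s, hs⟩ := hf2.fg_top
    refine ⟨s, ?_⟩
    rw [eq_top_iff]
    intro x _
    have hx : x ∈ Submodule.span (adjoin (ZMod p) {t}) (s : Set E') := by rw [hs]; trivial
    induction hx using Submodule.span_induction with
    | mem x h => exact Submodule.subset_span h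
    | zero => exact zero_mem _
    | add x y _ _ h1 h2 => exact add_mem (h1 trivial) (h2 trivial)
    | smul a x _ h =>
      have ha : algebraMap E E' (a : E) ∈ adjoin (ZMod p) {algebraMap E E' t} := by
        have h1 : (a : E) ∈ adjoin (ZMod p) {t} := a.2
        have h2 : (IsScalarTower.toAlgHom (ZMod p) E E') (a : E) ∈ (adjoin (ZMod p) {t}).map (IsScalarTower.toAlgHom (ZMod p) E E') :=
          ⟨_, h1, rfl⟩
        rw [adjoin_map, Set.image_singleton] at h2
        exact h2
      have h3 := Submodule.smul_mem _ (⟨_, ha⟩ : adjoin (ZMod p) {algebraMap E E' t}) (h trivial)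
      convert h3 using 1
      rw [Algebra.smul_def, Algebra.smul_def]
      rfl

lemma IsFF.ratFunc : IsFF p (RatFunc (ZMod p)) := by
  refine ⟨RatFunc.X, RatFunc.transcendental_X, ?_⟩
  rw [RatFunc.adjoin_X]
  refine ⟨{1}, ?_⟩
  rw [eq_top_iff]
  intro x _
  have := Submodule.smul_mem (Submodule.span (⊤ : IntermediateField (ZMod p) (RatFunc (ZMod p))) (({1} : Finset (RatFunc (ZMod p))) : Set (RatFunc (ZMod p)))) ⟨x, trivial⟩ (Submodule.subset_span (by simp : (1 : RatFunc (ZMod p)) ∈ _))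
  simpa [Algebra.smul_def] using this

/-- extension of places -/
theorem exists_extend (hE' : IsFF p E') (u : FFPrime E) :
    ∃ W : FFPrime E', W.LiesOver u (algebraMap E E') := by
  set φ := algebraMap E E'
  let A : Subring E' := u.O.map φ
  let I : Ideal A :=
    { carrier := {x | ∃ y ∈ u.M 1, φ y = x}
      add_mem' := by
        rintro a b ⟨y, hy, h⟩ ⟨z, hz, h'⟩
        exact ⟨y + z, add_mem hy hz, by simp [h, h']⟩
      zero_mem' := ⟨0, zero_mem _, by simp⟩
      smul_mem' := by
        rintro ⟨_, c, hc, rfl⟩ a ⟨y, hy, h⟩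
        exact ⟨c * y, u.mul_mem_M_left hc hy, by simp [h]⟩ }
  obtain ⟨π, hπ0, hπ⟩ := u.exists_o 1
  have hπ1 : π ∈ u.M 1 := by rw [u.mem_M hπ0, hπ]
  obtain ⟨W, hW1, hW2⟩ := exists_prime_of_ideal hE' A I
    (by
      rw [Ne, Ideal.eq_top_iff_one]
      rintro ⟨y, hy, h⟩
      have : y = 1 := φ.injective (by rw [h]; simp)
      rw [this, u.mem_M one_ne_zero] at hy
      simp at hy)
    (by
      intro h
      have : (⟨φ π, π, u.mem_of_le hπ1 (by norm_num), rfl⟩ : A) ∈ I := ⟨π, hπ1, rfl⟩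
      rw [h, Submodule.mem_bot] at this
      have := congrArg Subtype.val this
      exact hπ0 (by simpa using this))
  have hWπ : φ π ∈ W.M 1 := hW2 ⟨φ π, π, u.mem_of_le hπ1 (by norm_num), rfl⟩ ⟨π, hπ1, rfl⟩
  have hφπ : φ π ≠ 0 := by simpa using hπ0
  rw [W.mem_M hφπ] at hWπ
  obtain ⟨u', e, h⟩ := W.exists_restrict φ π (by omega)
  have : u = u' := FFPrime.eq_of_M_le fun x hx => h.mem0.mp (hW1 _ ⟨x, hx, rfl⟩)
  exact ⟨W, e, this ▸ h⟩

end

section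
variable {p : ℕ} [Fact p.Prime] {K F : Type} [Field K] [Field F] [Algebra (ZMod p) F] [Algebra K F]

/-- places lie over some place -/
theorem exists_below [Algebra.IsAlgebraic K F] (w : FFPrime F) :
    ∃ u : FFPrime K, w.LiesOver u (algebraMap K F) := by
  by_contra hcon
  have h0 : ∀ y : K, w.o (algebraMap K F y) = 0 := by
    intro y
    by_contra h
    exact hcon (w.exists_restrict (algebraMap K F) y h)
  obtain ⟨y, hy0, hy⟩ := w.exists_o (-1)
  have hi : IsIntegral K y := (Algebra.IsAlgebraic.isAlgebraic y).isIntegral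
  have := w.mem_of_integral (algebraMap K F) (minpoly.monic hi) (fun n => by
    rw [w.mem_M_iff, h0]; right; rfl) (minpoly.aeval K y)
  rw [w.mem_M hy0] at this; omega

theorem mem_closure_of_forall (hF : IsFF p F) [Algebra.IsAlgebraic K F] (v : FFPrime K) (y : F)
    (h : ∀ w : FFPrime F, w.LiesOver v (algebraMap K F) → y ∈ w.M 0) :
    y ∈ valIntegralClosure v F := by
  by_contra hy
  let R0 : Subring F := v.O.map (algebraMap K F)
  let R : Subring F := (integralClosure R0 F).toSubring
  have hyR : y ∉ R := by
    intro hyR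
    apply hy
    obtain ⟨P, hP, hP0⟩ : IsIntegral R0 y := hyR
    have hlift : P.map R0.subtype ∈ Polynomial.lifts (algebraMap K F) := by
      rw [Polynomial.lifts_iff_coeff_lifts]
      intro n
      obtain ⟨x, hx, h⟩ := (P.coeff n).2
      exact ⟨x, by rw [Polynomial.coeff_map]; exact h⟩
    obtain ⟨Q, hQ, hQd, hQm⟩ := Polynomial.lifts_and_degree_eq_and_monic hlift (hP.map _)
    refine ⟨Q, hQm, fun n => ?_, ?_⟩
    · have h1 : algebraMap K F (Q.coeff n) = (P.coeff n : F) := by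
        rw [← Polynomial.coeff_map, hQ, Polynomial.coeff_map]; rfl
      obtain ⟨x, hx, h⟩ := (P.coeff n).2
      have : Q.coeff n = x := (algebraMap K F).injective (by rw [h1]; exact h.symm)
      rw [this]; exact hx
    · rw [Polynomial.aeval_def, Polynomial.eval₂_eq_eval_map, hQ, ← Polynomial.eval₂_eq_eval_map]
      exact hP0
  have : IsIntegrallyClosedIn R F := by
    change IsIntegrallyClosedIn (integralClosure R0 F) F
    infer_instance
  obtain ⟨V, hRV, hyV⟩ := Subring.exists_le_valuationSubring_of_isIntegrallyClosedIn hyR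
  obtain ⟨w, hw⟩ := exists_prime_of_valuationSubring hF V (by rintro rfl; exact hyV trivial)
  obtain ⟨u, e, hu⟩ := exists_below (K := K) w
  have : v = u := FFPrime.eq_of_M_le fun x hx => hu.mem0.mp ((hw _).mp (hRV (by
    have : algebraMap K F x ∈ R0 := ⟨x, hx, rfl⟩
    exact algebraMap_mem (integralClosure R0 F) ⟨_, this⟩)))
  exact hyV ((hw y).mpr (h w ⟨e, this ▸ hu⟩))

theorem mem_M_of_mem_closure (v : FFPrime K) {y : F} (hy : y ∈ valIntegralClosure v F)
    (w : FFPrime F) (h : w.LiesOver v (algebraMap K F)) : y ∈ w.M 0 := by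
  obtain ⟨e, h⟩ := h
  obtain ⟨P, hP, hc, hP0⟩ := hy
  exact w.mem_of_integral (algebraMap K F) hP (fun n => h.mem0.mpr (by exact hc n)) hP0

end

end

section
open IntermediateField

section
variable {p : ℕ} [Fact p.Prime] {E : Type} [Field E] [Algebra (ZMod p) E]

lemma FFPrime.aeval_mem (w : FFPrime E) {f : E} (hf : f ∈ w.M 0) (P : Polynomial (ZMod p)) :
    Polynomial.aeval f P ∈ w.M 0 := by
  rw [Polynomial.aeval_eq_sum_range]
  refine sum_mem fun i _ => ?_
  rw [Algebra.smul_def]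
  exact w.mul_mem_M_left (w.zmod_mem _) (w.pow_mem_M0 hf i)

theorem fund_ineq (hE : IsFF p E) {f : E} (hf : Transcendental (ZMod p) f) (S : Finset (FFPrime E))
    (hpos : ∀ w ∈ S, 0 < w.o f) (n : FFPrime E → ℕ) (u : ∀ w, Fin (n w) → E)
    (hu0 : ∀ w ∈ S, ∀ b, u w b ∈ w.M 0)
    (hu : ∀ w ∈ S, ∀ c : Fin (n w) → ZMod p, ∑ b, algebraMap (ZMod p) E (c b) * u w b ∈ w.M 1 → c = 0) :
    ∑ w ∈ S, (w.o f).toNat * n w ≤ Module.finrank (adjoin (ZMod p) {f}) E := by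
  classical
  have hfd := hE.fin hf
  have hf0 : f ≠ 0 := fun h => hf (by rw [h]; exact isAlgebraic_zero)
  choose π hπ0 hπ using fun w : FFPrime E => w.exists_o 1
  let ι := Σ w : S, Fin (w.1.o f).toNat × Fin (n w)
  let N : ℤ := ∑ w ∈ S, w.o f
  have hN : ∀ w ∈ S, w.o f ≤ N := fun w hw =>
    Finset.single_le_sum (f := fun w => w.o f) (fun w hw => (hpos w hw).le) hw
  have hex : ∀ i : ι, ∃ y : E, ∀ w ∈ S, y - (if w = i.1.1 then π i.1.1 ^ (i.2.1 : ℕ) * u i.1.1 i.2.2 else 0) ∈ w.M N :=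
    fun i => FFPrime.weak_approx S (fun w => if w = i.1.1 then π i.1.1 ^ (i.2.1 : ℕ) * u i.1.1 i.2.2 else 0) N
  choose y hy using hex
  have hfm : ∀ w ∈ S, f ∈ w.M (w.o f) := fun w _ => w.self_mem_M f
  have hfm0 : ∀ w ∈ S, f ∈ w.M 0 := fun w hw => w.mem_of_le (hfm w hw) (hpos w hw).le
  have hπm : ∀ w : FFPrime E, ∀ a : ℕ, π w ^ a ∈ w.M a := fun w a => by
    rw [w.mem_M (pow_ne_zero _ (hπ0 w)), w.o_pow, hπ]; simp
  have hy0 : ∀ i, ∀ w ∈ S, y i ∈ w.M 0 := by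
    intro i w hw
    have h1 := w.mem_of_le (hy i w hw) ((hpos w hw).le.trans (hN w hw))
    have h2 : (if w = i.1.1 then π i.1.1 ^ (i.2.1 : ℕ) * u i.1.1 i.2.2 else 0) ∈ w.M 0 := by
      split_ifs with h
      · subst h
        exact i.1.1.mul_mem_M_left (i.1.1.mem_of_le (hπm _ _) (by positivity)) (hu0 _ hw _)
      · exact zero_mem _
    simpa using add_mem h1 h2
  have hli : LinearIndependent (adjoin (ZMod p) {f}) y := by
    apply linInd_of_poly
    apply poly_div_X hf0
    rintro P ⟨i0, hi0⟩ hsum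
    let c : ι → ZMod p := fun i => (P i).coeff 0
    let w := i0.1.1
    have hw : w ∈ S := i0.1.2
    -- sum of constants
    have h1 : ∑ i, algebraMap (ZMod p) E (c i) * y i ∈ w.M (w.o f) := by
      have : ∑ i, algebraMap (ZMod p) E (c i) * y i = - (f * ∑ i, Polynomial.aeval f (P i).divX * y i) := by
        rw [eq_neg_iff_add_eq_zero, ← hsum, Finset.mul_sum, ← Finset.sum_add_distrib]
        refine Finset.sum_congr rfl fun i _ => ?_
        rw [aeval_split f (P i)]; ring
      rw [this]
      exact neg_mem (w.mul_mem_M_right (hfm w hw) (sum_mem fun i _ => w.mul_mem_M_left (w.aeval_mem (hfm0 w hw) _) (hy0 i w hw)))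
    let z : ι → E := fun i => if w = i.1.1 then π i.1.1 ^ (i.2.1 : ℕ) * u i.1.1 i.2.2 else 0
    have h2 : ∑ i, algebraMap (ZMod p) E (c i) * z i ∈ w.M (w.o f) := by
      have h3 : ∑ i, algebraMap (ZMod p) E (c i) * (y i - z i) ∈ w.M (w.o f) :=
        sum_mem fun i _ => w.mul_mem_M_left (w.zmod_mem _) (w.mem_of_le (hy i w hw) (hN w hw))
      have := sub_mem h1 h3
      rw [← Finset.sum_sub_distrib] at this
      convert this using 2
      ring
    have h4 : ∑ a : Fin (w.o f).toNat, π w ^ (a : ℕ) * ∑ b : Fin (n w), algebraMap (ZMod p) E (c ⟨i0.1, a, b⟩) * u w b ∈ w.M (w.o f) := by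
      convert h2 using 1
      rw [Fintype.sum_sigma, Finset.sum_eq_single i0.1]
      · rw [Fintype.sum_prod_type]
        refine Finset.sum_congr rfl fun a _ => ?_
        rw [Finset.mul_sum]
        refine Finset.sum_congr rfl fun b _ => ?_
        simp only [z, w, if_true]
        ring
      · intro w' _ hne
        apply Finset.sum_eq_zero
        intro x _
        have : w ≠ w'.1 := fun h => hne (Subtype.ext h.symm)
        simp [z, this]
      · simp
    set g : Fin (w.o f).toNat → E := fun a => ∑ b : Fin (n w), algebraMap (ZMod p) E (c ⟨i0.1, a, b⟩) * u w b with hg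
    change ∑ a : Fin (w.o f).toNat, π w ^ (a : ℕ) * g a ∈ _ at h4
    -- all constants vanish by strong induction
    have key : ∀ k : ℕ, ∀ a : Fin (w.o f).toNat, (a : ℕ) = k → ∀ b, c ⟨i0.1, a, b⟩ = 0 := by
      intro k
      induction k using Nat.strong_induction_on with
      | _ k ih =>
        intro a ha
        have hga : π w ^ (a:ℕ) * g a ∈ w.M (a + 1) := by
          rw [← Finset.add_sum_erase _ _ (Finset.mem_univ a)] at h4
          have h5 : ∑ a' ∈ Finset.univ.erase a, π w ^ (a' : ℕ) * g a' ∈ w.M (a + 1) := by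
            refine sum_mem fun a' ha' => ?_
            have hne := (Finset.mem_erase.mp ha').1
            rcases lt_or_ge (a' : ℕ) a with hlt | hge
            · have : g a' = 0 := by
                simp only [hg]
                exact Finset.sum_eq_zero fun b _ => by rw [ih a' (ha ▸ hlt) a' rfl b]; simp
              rw [this, mul_zero]; exact zero_mem _
            · have hgt : (a : ℕ) < a' := lt_of_le_of_ne hge (fun h => hne (Fin.ext h.symm))
              refine w.mul_mem_M_right (w.mem_of_le (hπm w a') (by exact_mod_cast hgt)) ?_
              exact sum_mem fun b _ => w.mul_mem_M_left (w.zmod_mem _) (hu0 w hw b)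
          have h6 := w.mem_of_le h4 (show (a:ℤ) + 1 ≤ w.o f by have := a.2; omega)
          have h7 := sub_mem h6 h5
          rwa [add_sub_cancel_right] at h7
        have : g a ∈ w.M 1 := by
          rw [mul_comm, w.mem_M_add_mul (pow_ne_zero _ (hπ0 w)), w.o_pow, hπ] at hga
          simpa using hga
        intro b
        exact congrFun (hu w hw (fun b => c ⟨i0.1, a, b⟩) this) b
    exact hi0 (key _ i0.2.1 rfl i0.2.2)
  have := hli.fintype_card_le_finrank
  convert this using 1
  simp only [ι, Fintype.card_sigma, Fintype.card_prod, Fintype.card_fin]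
  exact (Finset.sum_coe_sort S (fun w => (w.o f).toNat * n w)).symm

end

end

section
open IntermediateField

namespace FFPrime
section
variable {E : Type} [Field E]

/-- the maximal ideal -/
def mI (w : FFPrime E) : Ideal w.O where
  carrier := {x | (x : E) ∈ w.M 1}
  add_mem' {x y} h1 h2 := (w.M 1).add_mem (x := x) (y := y) h1 h2
  zero_mem' := zero_mem (w.M 1)
  smul_mem' := fun c _ hx => w.mul_mem_M_left (mem_O.mp c.2) hx

lemma mem_mI {w : FFPrime E} {x : w.O} : x ∈ w.mI ↔ (x : E) ∈ w.M 1 := Iff.rfl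

instance (w : FFPrime E) : w.mI.IsMaximal := by
  rw [Ideal.isMaximal_iff]
  constructor
  · rw [mem_mI]
    exact w.not_mem_of (x := 1) one_ne_zero (by simp)
  · intro J x hJ hx hxJ
    have h0 : (x : E) ∈ w.M 0 := x.2
    have hne := w.ne_zero_of_not_mem (x := (x:E)) (k := 1) hx
    have ho := w.o_lt_of_not_mem (x := (x:E)) (k := 1) hx
    rw [w.mem_M hne] at h0
    have hinv : (x : E)⁻¹ ∈ w.O := by
      rw [mem_O, w.mem_M (inv_ne_zero hne), w.o_inv]; omega
    have := J.mul_mem_left ⟨_, hinv⟩ hxJ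
    convert this using 1
    ext
    exact (inv_mul_cancel₀ hne).symm

/-- the residue field -/
def κ (w : FFPrime E) : Type := w.O ⧸ w.mI

/-- field structure on the residue field -/
@[irreducible] def κField (w : FFPrime E) : { F : Field w.κ // F.toCommRing = Ideal.Quotient.commRing w.mI } :=
  ⟨Ideal.Quotient.field w.mI, rfl⟩

instance (w : FFPrime E) : Field w.κ := (κField w).1

/-- residue map -/
def res (w : FFPrime E) : w.O →+* w.κ where
  toFun := Ideal.Quotient.mk w.mI
  map_one' := by
    change (1 : w.O ⧸ w.mI) = (κField w).1.toCommRing.toOne.one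
    rw [(κField w).2]; rfl
  map_mul' x y := by
    change (Ideal.Quotient.mk w.mI (x * y)) = (κField w).1.toCommRing.toMul.mul _ _
    rw [(κField w).2]; rfl
  map_zero' := by
    change (0 : w.O ⧸ w.mI) = (κField w).1.toCommRing.toZero.zero
    rw [(κField w).2]; rfl
  map_add' x y := by
    change (Ideal.Quotient.mk w.mI (x + y)) = (κField w).1.toCommRing.toAdd.add _ _
    rw [(κField w).2]; rfl

lemma res_surj (w : FFPrime E) : Function.Surjective w.res := Ideal.Quotient.mk_surjective (I := w.mI)

lemma res_eq_zero (w : FFPrime E) {x : w.O} : w.res x = 0 ↔ (x : E) ∈ w.M 1 := by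
  rw [← map_zero w.res]
  change (Ideal.Quotient.mk w.mI x) = Ideal.Quotient.mk w.mI 0 ↔ _
  rw [map_zero, Ideal.Quotient.eq_zero_iff_mem]; rfl

lemma res_eq (w : FFPrime E) {x y : w.O} : w.res x = w.res y ↔ (x - y : E) ∈ w.M 1 := by
  rw [← sub_eq_zero, ← map_sub, res_eq_zero]; rfl

lemma card_of_hasResidueCard (w : FFPrime E) {n : ℕ} (h : w.HasResidueCard n) :
    Nat.card w.κ = n := by
  obtain ⟨s, hn, h0, h1, h2⟩ := h
  have h0' : ∀ x ∈ s, x ∈ w.O := h0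
  have hpos : ∀ z : E, 0 < w.ord z ↔ z ∈ w.M 1 := by
    intro z
    by_cases hz : z = 0
    · subst hz; simp [zero_mem, w.ord_zero]
    · rw [w.mem_M hz, w.ord_eq hz]
      norm_cast
  let g : s → w.κ := fun x => w.res ⟨x, h0' x x.2⟩
  have hg : Function.Bijective g := by
    constructor
    · intro x y hxy
      by_contra hne
      have := (w.res_eq).mp hxy
      exact h1 x x.2 y y.2 (fun h => hne (Subtype.ext h)) ((hpos _).mpr this)
    · intro k
      obtain ⟨z, rfl⟩ := w.res_surj k
      obtain ⟨x, hx, hz⟩ := h2 z z.2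
      refine ⟨⟨x, hx⟩, ?_⟩
      apply ((w.res_eq).mpr _).symm
      exact (hpos _).mp hz
  rw [← Nat.card_eq_of_bijective g hg, Nat.card_eq_fintype_card, Fintype.card_coe, hn]

lemma hasResidueCard_card (w : FFPrime E) [Finite w.κ] : w.HasResidueCard (Nat.card w.κ) := by
  classical
  cases nonempty_fintype w.κ
  have hpos : ∀ z : E, 0 < w.ord z ↔ z ∈ w.M 1 := by
    intro z
    by_cases hz : z = 0
    · subst hz; simp [zero_mem, w.ord_zero]
    · rw [w.mem_M hz, w.ord_eq hz]
      norm_cast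
  choose r hr using w.res_surj
  have hinj : Function.Injective (fun k => (r k : E)) := by
    intro a b hab
    have : r a = r b := Subtype.ext hab
    rw [← hr a, ← hr b, this]
  refine ⟨Finset.univ.image (fun k => (r k : E)), ?_, ?_, ?_, ?_⟩
  · rw [Finset.card_image_of_injective _ hinj, Nat.card_eq_fintype_card]; rfl
  · intro x hx
    obtain ⟨k, -, rfl⟩ := Finset.mem_image.mp hx
    exact (r k).2
  · intro x hx y hy hne h
    obtain ⟨k, -, rfl⟩ := Finset.mem_image.mp hx
    obtain ⟨l, -, rfl⟩ := Finset.mem_image.mp hy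
    rw [hpos, ← w.res_eq, hr, hr] at h
    exact hne (by rw [h])
  · intro z hz
    refine ⟨r (w.res ⟨z, hz⟩), Finset.mem_image_of_mem _ (Finset.mem_univ _), ?_⟩
    rw [hpos]
    exact (w.res_eq (x := ⟨z, hz⟩)).mp (hr _).symm

end

section
variable {p : ℕ} [Fact p.Prime] {E : Type} [Field E] [Algebra (ZMod p) E]

instance (w : FFPrime E) : Algebra (ZMod p) w.O :=
  ((algebraMap (ZMod p) E).codRestrict w.O (w.zmod_mem)).toAlgebra

instance (w : FFPrime E) : Algebra (ZMod p) w.κ := (w.res.comp (algebraMap (ZMod p) w.O)).toAlgebra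

lemma coe_algebraMap_O (w : FFPrime E) (a : ZMod p) : ((algebraMap (ZMod p) w.O a : w.O) : E) = algebraMap (ZMod p) E a := rfl

variable (p) in
/-- degree over the prime field -/
def deg (w : FFPrime E) : ℕ := Module.finrank (ZMod p) w.κ

lemma res_alg (w : FFPrime E) (a : ZMod p) : w.res (algebraMap (ZMod p) w.O a) = algebraMap (ZMod p) w.κ a := rfl

/-- independent residues -/
lemma res_ind (w : FFPrime E) {n : ℕ} (u : Fin n → w.O) (hu : LinearIndependent (ZMod p) (fun i => w.res (u i)))
    (c : Fin n → ZMod p) (h : ∑ b, algebraMap (ZMod p) E (c b) * u b ∈ w.M 1) : c = 0 := by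
  rw [Fintype.linearIndependent_iff] at hu
  funext i
  refine hu c ?_ i
  have : w.res (∑ b, algebraMap (ZMod p) w.O (c b) * u b) = 0 := by
    rw [res_eq_zero]
    convert h using 1
    push_cast
    rfl
  rw [map_sum] at this
  rw [← this]
  refine Finset.sum_congr rfl fun b _ => ?_
  rw [map_mul, res_alg, Algebra.smul_def]

theorem finite_res (hE : IsFF p E) (w : FFPrime E) : Module.Finite (ZMod p) w.κ := by
  obtain ⟨f, hf0, hf⟩ := w.exists_o 1
  have htr : Transcendental (ZMod p) f := w.transc (by omega)
  have : Module.rank (ZMod p) w.κ ≤ (Module.finrank (adjoin (ZMod p) {f}) E : ℕ) := by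
    apply rank_le
    intro s hs
    let e := s.equivFin
    choose r hr using w.res_surj
    have h := fund_ineq hE htr {w} (by simp [hf]) (fun _ => s.card)
      (fun _ i => (r (e.symm i) : E)) (by
        intro w' hw' b
        rw [Finset.mem_singleton] at hw'; subst hw'
        exact (r (e.symm b)).2) (by
        intro w' hw' c hc
        rw [Finset.mem_singleton] at hw'; subst hw'
        refine w'.res_ind (fun i => r (e.symm i)) ?_ c hc
        simp only [hr]
        exact hs.comp _ e.symm.injective)
    simpa [hf] using h
  exact Module.rank_lt_aleph0_iff.mp (this.trans_lt (Cardinal.natCast_lt_aleph0))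

theorem finite_κ (hE : IsFF p E) (w : FFPrime E) : Finite w.κ := by
  have := finite_res hE w
  exact Module.finite_of_finite (ZMod p)

theorem card_κ (hE : IsFF p E) (w : FFPrime E) : Nat.card w.κ = p ^ w.deg p := by
  have := finite_res hE w
  rw [Module.natCard_eq_pow_finrank (K := ZMod p), Nat.card_zmod]; rfl

theorem deg_pos (hE : IsFF p E) (w : FFPrime E) : 0 < w.deg p := by
  have := finite_res hE w
  exact Module.finrank_pos

theorem frob (hE : IsFF p E) (w : FFPrime E) {x : E} (hx : x ∈ w.M 0) : x ^ (p ^ w.deg p) - x ∈ w.M 1 := by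
  have := finite_κ hE w
  cases nonempty_fintype w.κ
  have h := FiniteField.pow_card (w.res ⟨x, hx⟩)
  rw [← Nat.card_eq_fintype_card, card_κ hE, ← map_pow, res_eq] at h
  exact h

theorem frob_iter (hE : IsFF p E) (w : FFPrime E) {x : E} (hx : x ∈ w.M 0) {m : ℕ} (hm : w.deg p ∣ m) :
    x ^ (p ^ m) - x ∈ w.M 1 := by
  obtain ⟨k, rfl⟩ := hm
  have := finite_κ hE w
  cases nonempty_fintype w.κ
  have h := FiniteField.pow_card_pow k (w.res ⟨x, hx⟩)
  rw [← Nat.card_eq_fintype_card, card_κ hE, ← map_pow, res_eq, ← pow_mul] at h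
  exact h

theorem fund (hE : IsFF p E) {f : E} (hf : Transcendental (ZMod p) f) (S : Finset (FFPrime E))
    (hpos : ∀ w ∈ S, 0 < w.o f) :
    ∑ w ∈ S, w.o f * w.deg p ≤ Module.finrank (adjoin (ZMod p) {f}) E := by
  have hb : ∀ w : FFPrime E, ∃ u : Fin (w.deg p) → w.O, LinearIndependent (ZMod p) (fun i => w.res (u i)) := by
    intro w
    have := finite_res hE w
    choose r hr using w.res_surj
    refine ⟨fun i => r (Module.finBasis (ZMod p) w.κ i), ?_⟩
    simp only [hr]
    exact (Module.finBasis (ZMod p) w.κ).linearIndependent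
  choose u hu using hb
  have h := fund_ineq hE hf S hpos (fun w => w.deg p) (fun w i => (u w i : E)) (fun w _ b => (u w b).2)
    (fun w _ c hc => w.res_ind (u w) (hu w) c hc)
  have h' : ((∑ w ∈ S, (w.o f).toNat * w.deg p : ℕ) : ℤ) ≤ Module.finrank (adjoin (ZMod p) {f}) E := by
    exact_mod_cast h
  refine le_trans (le_of_eq ?_) h'
  push_cast
  refine Finset.sum_congr rfl fun w hw => ?_
  rw [Int.toNat_of_nonneg (hpos w hw).le]

theorem finite_zeros (hE : IsFF p E) (f : E) : {w : FFPrime E | 0 < w.o f}.Finite := by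
  by_cases hf : Transcendental (ZMod p) f
  swap
  · convert Set.finite_empty
    ext w
    simp [w.o_alg (not_not.mp hf)]
  by_contra hinf
  obtain ⟨t, ht, htc⟩ := Set.Infinite.exists_subset_card_eq hinf (Module.finrank (adjoin (ZMod p) {f}) E + 1)
  have h := fund hE hf t (fun w hw => ht hw)
  have h2 : (∑ w ∈ t, (1:ℤ)) ≤ ∑ w ∈ t, w.o f * w.deg p := by
    refine Finset.sum_le_sum fun w hw => ?_
    have h1 : 0 < w.o f := ht hw
    have := deg_pos hE w
    have : (1:ℤ) ≤ w.deg p := by exact_mod_cast this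
    nlinarith
  simp [htc] at h2
  omega

theorem finite_supp (hE : IsFF p E) (f : E) : {w : FFPrime E | w.o f ≠ 0}.Finite := by
  refine ((finite_zeros hE f).union (finite_zeros hE f⁻¹)).subset fun w hw => ?_
  simp only [Set.mem_ofPred_eq, Set.mem_union, o_inv] at *
  omega

end
end FFPrime

section
variable {p : ℕ} [Fact p.Prime] {K F : Type} [Field K] [Field F] [Algebra (ZMod p) K] [Algebra (ZMod p) F]

open FFPrime in
/-- residue extension -/
lemma deg_eq_mul (hK : IsFF p K) (hF : IsFF p F) {φ : K →+* F} {w : FFPrime F} {v : FFPrime K} (h : w.LiesOver v φ) :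
    ∃ f, 0 < f ∧ w.deg p = v.deg p * f := by
  obtain ⟨e, h⟩ := h
  have := finite_res hK v
  have := finite_res hF w
  let g0 : v.O →+* w.O := (φ.comp v.O.subtype).codRestrict w.O (fun x => h.mem0.mpr x.2)
  let g : v.κ →+* w.κ := v.res.liftOfSurjective v.res_surj ⟨w.res.comp g0, by
    intro x hx
    rw [RingHom.mem_ker, res_eq_zero] at hx
    rw [RingHom.mem_ker, RingHom.comp_apply, res_eq_zero]
    refine w.mem_of_le ((h.mem 1).mpr hx) ?_
    have := h.1; omega⟩
  algebraize [g]
  have := zmod_tower p v.κ w.κ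
  have := FiniteDimensional.right (ZMod p) v.κ w.κ
  exact ⟨Module.finrank v.κ w.κ, Module.finrank_pos, (Module.finrank_mul_finrank (ZMod p) v.κ w.κ).symm⟩

open FFPrime in
lemma resDeg_spec (hK : IsFF p K) (hF : IsFF p F) {φ : K →+* F} {w : FFPrime F} {v : FFPrime K} (h : w.LiesOver v φ) :
    w.deg p = v.deg p * w.resDeg v ∧ 0 < w.resDeg v := by
  have := finite_κ hK v
  have := finite_κ hF w
  obtain ⟨f, hf0, hf⟩ := deg_eq_mul hK hF h
  have hp : 1 < p := (Fact.out : p.Prime).one_lt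
  have hex : ∃ f : ℕ, 0 < f ∧ ∃ m n : ℕ, 1 < m ∧ v.HasResidueCard m ∧
      w.HasResidueCard n ∧ n = m ^ f :=
    ⟨f, hf0, _, _, by
      rw [card_κ hK]; exact Nat.one_lt_pow (deg_pos hK v).ne' hp, v.hasResidueCard_card, w.hasResidueCard_card, by
      rw [card_κ hK, card_κ hF, hf, pow_mul]⟩
  unfold resDeg
  rw [dif_pos hex]
  obtain ⟨h1, m, n, hm, hvm, hwn, hn⟩ := hex.choose_spec
  have e1 := v.card_of_hasResidueCard hvm
  have e2 := w.card_of_hasResidueCard hwn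
  rw [card_κ hK] at e1
  rw [card_κ hF] at e2
  refine ⟨?_, h1⟩
  rw [← e1, ← e2, ← pow_mul] at hn
  exact Nat.pow_right_injective hp hn

end

end

section
open IntermediateField

/-- divisors -/
abbrev Dv (E : Type) [Field E] := FFPrime E →₀ ℤ

section
variable {p : ℕ} [Fact p.Prime] {E : Type} [Field E] [Algebra (ZMod p) E]

variable (p) in
/-- degree of divisors -/
def dg : Dv E →+ ℤ := Finsupp.liftAddHom (fun w : FFPrime E => AddMonoidHom.mulRight (w.deg p : ℤ))

@[simp] lemma dg_single (w : FFPrime E) (n : ℤ) : dg p (Finsupp.single w n) = n * w.deg p := by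
  simp [dg]

lemma dg_eq (D : Dv E) : dg p D = ∑ w ∈ D.support, D w * w.deg p := rfl

lemma dg_nonneg {D : Dv E} (h : 0 ≤ D) : 0 ≤ dg p D := by
  rw [dg_eq]
  exact Finset.sum_nonneg fun w _ => mul_nonneg (h w) (by positivity)

lemma single_nonneg' (w w' : FFPrime E) : (0:ℤ) ≤ Finsupp.single w 1 w' := by
  classical
  rw [Finsupp.single_apply]; split_ifs <;> simp

lemma dg_mono {D D' : Dv E} (h : D ≤ D') : dg p D ≤ dg p D' := by
  have := dg_nonneg (p := p) (sub_nonneg.mpr h)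
  rw [map_sub] at this; omega

/-- principal divisors -/
def dv (hE : IsFF p E) (f : E) : Dv E := Finsupp.ofSupportFinite (fun w => w.o f) (FFPrime.finite_supp hE f)

@[simp] lemma dv_apply (hE : IsFF p E) (f : E) (w : FFPrime E) : dv hE f w = w.o f := rfl

lemma dv_mul (hE : IsFF p E) {f g : E} (hf : f ≠ 0) (hg : g ≠ 0) : dv hE (f * g) = dv hE f + dv hE g := by
  ext w; simp [w.o_mul hf hg]

lemma dv_inv (hE : IsFF p E) (f : E) : dv hE f⁻¹ = - dv hE f := by
  ext w; simp

lemma dv_one (hE : IsFF p E) : dv hE 1 = 0 := by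
  ext w; simp

variable (p) in
/-- Riemann–Roch space -/
def RL (D : Dv E) : Submodule (ZMod p) E where
  carrier := {x | ∀ w : FFPrime E, x ∈ w.M (- D w)}
  add_mem' h1 h2 w := add_mem (h1 w) (h2 w)
  zero_mem' w := zero_mem _
  smul_mem' c x hx w := by
    rw [Algebra.smul_def]
    exact w.mul_mem_M_left (w.zmod_mem c) (hx w)

lemma mem_RL {D : Dv E} {x : E} : x ∈ RL p D ↔ ∀ w : FFPrime E, x ∈ w.M (- D w) := Iff.rfl

lemma mem_RL_iff (hE : IsFF p E) {D : Dv E} {x : E} (hx : x ≠ 0) : x ∈ RL p D ↔ 0 ≤ dv hE x + D := by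
  rw [mem_RL]
  refine forall_congr' fun w => ?_
  rw [w.mem_M hx]
  simp
  omega

lemma RL_mono {D D' : Dv E} (h : D ≤ D') : RL p D ≤ RL p D' := fun x hx w =>
  w.mem_of_le (hx w) (by have := h w; omega)

/-- one step -/
lemma exists_step (D : Dv E) (w : FFPrime E) :
    ∃ T : RL p (D + Finsupp.single w 1) →ₗ[ZMod p] w.κ,
      ∀ x, T x = 0 ↔ (x : E) ∈ RL p D := by
  obtain ⟨π, hπ0, hπ⟩ := w.exists_o 1
  have hmem : ∀ x : RL p (D + Finsupp.single w 1), (x : E) * π ^ (D w + 1) ∈ w.M 0 := by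
    intro x
    rw [w.mem_M_add_mul (zpow_ne_zero _ hπ0), w.o_zpow, hπ]
    have := x.2 w
    simp at this
    convert this using 2
    ring
  refine ⟨{ toFun := fun x => w.res ⟨(x : E) * π ^ (D w + 1), hmem x⟩, map_add' := ?_, map_smul' := ?_ }, ?_⟩
  · intro x y
    rw [← map_add]
    congr 1
    ext
    push_cast
    ring
  · intro c x
    rw [RingHom.id_apply, Algebra.smul_def, ← FFPrime.res_alg, ← map_mul]
    congr 1
    ext
    push_cast
    rw [Algebra.smul_def, mul_assoc, FFPrime.coe_algebraMap_O]
  · intro x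
    simp only [LinearMap.coe_mk, AddHom.coe_mk]
    rw [w.res_eq_zero, w.mem_M_add_mul (zpow_ne_zero _ hπ0), w.o_zpow, hπ]
    constructor
    · intro h w'
      by_cases hw : w' = w
      · subst hw
        convert h using 2
        ring
      · have := x.2 w'
        simpa [Finsupp.single_apply, Ne.symm hw] using this
    · intro h
      convert h w using 2
      ring

lemma RL_step (hE : IsFF p E) (D : Dv E) (w : FFPrime E) [Module.Finite (ZMod p) (RL p D)] :
    Module.Finite (ZMod p) (RL p (D + Finsupp.single w 1)) ∧
    Module.finrank (ZMod p) (RL p (D + Finsupp.single w 1)) ≤ Module.finrank (ZMod p) (RL p D) + w.deg p := by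
  have := FFPrime.finite_res hE w
  obtain ⟨T, hT⟩ := exists_step (p := p) D w
  let e : LinearMap.ker T →ₗ[ZMod p] RL p D :=
    ((RL p (D + Finsupp.single w 1)).subtype.comp (LinearMap.ker T).subtype).codRestrict (RL p D)
      (fun x => (hT x.1).mp x.2)
  have he : Function.Injective e := by
    intro x y h
    have := congrArg Subtype.val h
    exact Subtype.ext (Subtype.ext this)
  have hk : Module.Finite (ZMod p) (LinearMap.ker T) := Module.Finite.of_injective e he
  have hfin : Module.Finite (ZMod p) (RL p (D + Finsupp.single w 1)) := by
    rw [← Module.rank_lt_aleph0_iff, ← T.rank_range_add_rank_ker]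
    exact Cardinal.add_lt_aleph0 (Module.rank_lt_aleph0 _ _) (Module.rank_lt_aleph0 _ _)
  refine ⟨hfin, ?_⟩
  have h1 := T.finrank_range_add_finrank_ker
  have h2 := LinearMap.finrank_le_finrank_of_injective he
  have h3 := (LinearMap.range T).finrank_le
  have : w.deg p = Module.finrank (ZMod p) w.κ := rfl
  omega

lemma Dv_induction {P : Dv E → Prop} (D0 : Dv E) (h0 : P D0) (hup : ∀ D w, P D → P (D + Finsupp.single w 1))
    (hdn : ∀ D w, P (D + Finsupp.single w 1) → P D) (D : Dv E) : P D := by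
  have key : ∀ D : Dv E, ∀ D1, P D1 → P (D1 + D) := by
    intro D
    induction D using Finsupp.induction_linear with
    | zero => intro D1 h; simpa using h
    | add f g hf hg => intro D1 h; rw [← add_assoc]; exact hg _ (hf _ h)
    | single w n =>
      induction n using Int.induction_on with
      | zero => intro D1 h; simpa using h
      | succ n ih =>
        intro D1 h
        rw [Finsupp.single_add, ← add_assoc]
        exact hup _ _ (ih _ h)
      | pred n ih =>
        intro D1 h
        apply hdn _ w
        rw [add_assoc, ← Finsupp.single_add]
        convert ih _ h using 3
        ring
  have := key (D - D0) D0 h0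
  simpa using this

lemma RL_neg (hE : IsFF p E) (w : FFPrime E) : RL p (- Finsupp.single w 1 : Dv E) = ⊥ := by
  rw [eq_bot_iff]
  intro x hx
  by_contra hne
  have hx0 : x ≠ 0 := hne
  have h1 : ∀ w' : FFPrime E, 0 ≤ w'.o x := by
    intro w'
    have := hx w'
    rw [w'.mem_M hx0] at this
    by_cases h : w' = w
    · subst h; simp at this; omega
    · simp [Finsupp.single_apply, Ne.symm h] at this; exact this
  have h2 := w.o_alg (isAlgebraic_of_o_nonneg hE h1)
  have := hx w
  rw [w.mem_M hx0] at this
  simp at this; omega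

theorem RL_fin (hE : IsFF p E) (D : Dv E) : Module.Finite (ZMod p) (RL p D) := by
  obtain ⟨w⟩ := hE.nonempty
  refine Dv_induction (P := fun D => Module.Finite (ZMod p) (RL p D)) (- Finsupp.single w 1) ?_ ?_ ?_ D
  · rw [RL_neg hE]; infer_instance
  · intro D w h
    exact (RL_step hE D w).1
  · intro D w' h
    refine Module.Finite.of_injective (Submodule.inclusion (RL_mono (p := p) (D := D) (D' := D + Finsupp.single w' 1) ?_)) (Submodule.inclusion_injective _)
    intro w; have := single_nonneg' w' w; simp [this]

variable (p) in
/-- speciality-type index -/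
def rr (D : Dv E) : ℤ := dg p D - Module.finrank (ZMod p) (RL p D)

lemma rr_step (hE : IsFF p E) (D : Dv E) (w : FFPrime E) : rr p D ≤ rr p (D + Finsupp.single w 1) := by
  have := RL_fin hE D
  have h := (RL_step hE D w).2
  unfold rr
  rw [map_add, dg_single]
  have : ((Module.finrank (ZMod p) (RL p (D + Finsupp.single w 1)) : ℕ) : ℤ) ≤ Module.finrank (ZMod p) (RL p D) + w.deg p := by
    exact_mod_cast h
  omega

lemma rr_mono (hE : IsFF p E) {D D' : Dv E} (h : D ≤ D') : rr p D ≤ rr p D' := by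
  have key : ∀ A : FFPrime E →₀ ℕ, ∀ D : Dv E, rr p D ≤ rr p (D + A.mapRange (fun n : ℕ => (n : ℤ)) rfl) := by
    intro A
    induction A using Finsupp.induction_linear with
    | zero => intro D; simp
    | add f g hf hg =>
      intro D
      rw [Finsupp.mapRange_add (by intros; push_cast; rfl), ← add_assoc]
      exact (hf D).trans (hg _)
    | single w n =>
      induction n with
      | zero => intro D; simp
      | succ n ih =>
        intro D
        refine (ih D).trans ?_
        refine (rr_step hE (D + (Finsupp.single w n).mapRange (fun n : ℕ => (n : ℤ)) rfl) w).trans (le_of_eq ?_)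
        congr 1
        rw [add_assoc]
        congr 1
        simp [← Finsupp.single_add]
  have := key ((D' - D).mapRange Int.toNat rfl) D
  convert this using 2
  ext w
  have := h w
  simp
  omega

lemma rr_principal (hE : IsFF p E) (D : Dv E) {z : E} (hz : z ≠ 0) :
    Module.finrank (ZMod p) (RL p (D + dv hE z)) = Module.finrank (ZMod p) (RL p D) := by
  let e : RL p (D + dv hE z) ≃ₗ[ZMod p] RL p D :=
    { toFun := fun x => ⟨x * z, fun w => by
        rw [w.mem_M_add_mul hz]
        have := x.2 w
        simp at this
        convert this using 2; ring⟩
      invFun := fun x => ⟨x * z⁻¹, fun w => by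
        rw [w.mem_M_add_mul (inv_ne_zero hz)]
        have := x.2 w
        simp
        convert this using 2⟩
      map_add' := fun x y => by ext; simp [add_mul]
      map_smul' := fun c x => by ext; simp
      left_inv := fun x => by ext; simp [hz]
      right_inv := fun x => by ext; simp [hz] }
  exact e.finrank_eq

/-- pole divisor -/
def dvp (hE : IsFF p E) (f : E) : Dv E := (dv hE f).mapRange (fun n => max (-n) 0) rfl

@[simp] lemma dvp_apply (hE : IsFF p E) (f : E) (w : FFPrime E) : dvp hE f w = max (- w.o f) 0 := rfl

lemma dvp_nonneg (hE : IsFF p E) (f : E) : 0 ≤ dvp hE f := fun w => by simp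

/-- family of basis elements with bounded poles -/
lemma exists_bound (hE : IsFF p E) {f : E} (hf : Transcendental (ZMod p) f) :
    ∃ C : Dv E, 0 ≤ C ∧ ∀ l : ℕ, (Module.finrank (adjoin (ZMod p) {f}) E : ℤ) * (l + 1) ≤
      Module.finrank (ZMod p) (RL p ((l : ℤ) • dvp hE f + C)) := by
  classical
  have hfd := hE.fin hf
  let N := Module.finrank (adjoin (ZMod p) {f}) E
  let u := Module.finBasis (adjoin (ZMod p) {f}) E
  refine ⟨∑ j, dvp hE (u j), Finset.sum_nonneg fun j _ => dvp_nonneg hE _, fun l => ?_⟩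
  set C := ∑ j, dvp hE (u j)
  have := RL_fin hE ((l : ℤ) • dvp hE f + C)
  have hmem : ∀ x : Fin N × Fin (l + 1), u x.1 * f ^ (x.2 : ℕ) ∈ RL p ((l : ℤ) • dvp hE f + C) := by
    intro x w
    have h1 : u x.1 ∈ w.M (- C w) := by
      refine w.mem_of_le (w.self_mem_M _) ?_
      have : dvp hE (u x.1) ≤ C := Finset.single_le_sum (f := fun j => dvp hE (u j)) (fun j _ => dvp_nonneg hE _) (Finset.mem_univ _)
      have := this w
      simp only [dvp_apply] at this
      have := le_max_left (- w.o (u x.1)) 0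
      omega
    have h2 : f ^ (x.2 : ℕ) ∈ w.M (- ((l : ℤ) * dvp hE f w)) := by
      refine w.mem_of_le (w.self_mem_M _) ?_
      rw [w.o_pow, dvp_apply]
      have hx : ((x.2 : ℕ) : ℤ) ≤ l := by exact_mod_cast Nat.lt_succ_iff.mp x.2.2
      have := le_max_left (- w.o f) 0
      have := le_max_right (- w.o f) 0
      have hx0 : (0:ℤ) ≤ ((x.2 : ℕ) : ℤ) := by positivity
      nlinarith
    convert w.mul_mem_M h1 h2 using 2
    simp
  have hli : LinearIndependent (ZMod p) (fun x : Fin N × Fin (l + 1) => u x.1 * f ^ (x.2 : ℕ)) := by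
    rw [Fintype.linearIndependent_iff]
    intro c hc
    let P : Fin N → Polynomial (ZMod p) := fun i => ∑ j : Fin (l + 1), Polynomial.monomial j (c (i, j))
    have hPm : ∀ Q : Polynomial (ZMod p), Polynomial.aeval f Q ∈ adjoin (ZMod p) {f} := by
      intro Q
      have h1 := (Polynomial.aeval (⟨f, mem_adjoin_simple_self _ _⟩ : adjoin (ZMod p) {f}) Q).2
      have h2 := Polynomial.aeval_algHom_apply (adjoin (ZMod p) {f}).val ⟨f, mem_adjoin_simple_self _ _⟩ Q
      exact h2 ▸ h1
    have hs : ∑ i, (⟨Polynomial.aeval f (P i), hPm _⟩ : adjoin (ZMod p) {f}) • u i = 0 := by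
      rw [← hc, Fintype.sum_prod_type]
      refine Finset.sum_congr rfl fun i _ => ?_
      rw [Algebra.smul_def]
      change Polynomial.aeval f (P i) * u i = _
      simp only [P, map_sum, Finset.sum_mul, Polynomial.aeval_monomial]
      refine Finset.sum_congr rfl fun j _ => ?_
      rw [Algebra.smul_def]; ring
    have h0 := Fintype.linearIndependent_iff.mp u.linearIndependent _ hs
    rintro ⟨i, j⟩
    have h1 : Polynomial.aeval f (P i) = 0 := congrArg Subtype.val (h0 i)
    have h2 : P i = 0 := by
      by_contra h
      exact hf ⟨P i, h, h1⟩
    have h3 := congrArg (fun Q => Polynomial.coeff Q (j : ℕ)) h2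
    simp only [P, Polynomial.finsetSum_coeff, Polynomial.coeff_monomial, Polynomial.coeff_zero] at h3
    rw [Finset.sum_eq_single j] at h3
    · simpa using h3
    · intro b _ hb
      rw [if_neg]
      exact fun h => hb (Fin.ext h)
    · simp
  have hli2 : LinearIndependent (ZMod p) (fun x : Fin N × Fin (l + 1) => (⟨_, hmem x⟩ : RL p ((l : ℤ) • dvp hE f + C))) := by
    apply LinearIndependent.of_comp (RL p ((l : ℤ) • dvp hE f + C)).subtype
    exact hli
  have := hli2.fintype_card_le_finrank
  simp only [Fintype.card_prod, Fintype.card_fin] at this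
  exact_mod_cast this

lemma finrank_le_dg (hE : IsFF p E) (w : FFPrime E) {D : Dv E} (h : 0 ≤ D) :
    (Module.finrank (ZMod p) (RL p D) : ℤ) ≤ dg p D + w.deg p := by
  have h1 : (- Finsupp.single w 1 : Dv E) ≤ D := le_trans (by
    intro w'; have := single_nonneg' w w'; simp [this]) h
  have := rr_mono hE (p := p) h1
  unfold rr at this
  rw [RL_neg hE, map_neg, dg_single] at this
  simp at this
  omega

lemma dvp_deg_le (hE : IsFF p E) {f : E} (hf : Transcendental (ZMod p) f) :
    (Module.finrank (adjoin (ZMod p) {f}) E : ℤ) ≤ dg p (dvp hE f) := by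
  obtain ⟨w⟩ := hE.nonempty
  obtain ⟨C, hC0, hC⟩ := exists_bound hE hf
  set N := (Module.finrank (adjoin (ZMod p) {f}) E : ℤ)
  by_contra hlt
  push Not at hlt
  have hC1 := dg_nonneg (p := p) hC0
  set l := (dg p C + w.deg p).toNat
  have h1 := hC l
  have h2 := finrank_le_dg hE w (D := (l : ℤ) • dvp hE f + C) (add_nonneg (zsmul_nonneg (dvp_nonneg hE f) (by positivity)) hC0)
  rw [map_add, map_zsmul, smul_eq_mul] at h2
  have h3 : (l : ℤ) = dg p C + w.deg p := Int.toNat_of_nonneg (by positivity)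
  have h4 : (0:ℤ) ≤ l := by positivity
  have h5 := dg_nonneg (p := p) (dvp_nonneg hE f)
  nlinarith

lemma dvp_inv_le (hE : IsFF p E) {f : E} (hf : Transcendental (ZMod p) f) :
    dg p (dvp hE f⁻¹) ≤ (Module.finrank (adjoin (ZMod p) {f}) E : ℤ) := by
  have := FFPrime.fund hE hf (dvp hE f⁻¹).support (by
    intro w hw
    simp at hw
    exact hw)
  refine le_trans (le_of_eq ?_) this
  rw [dg_eq]
  refine Finset.sum_congr rfl fun w hw => ?_
  simp at hw
  rw [dvp_apply, w.o_inv, neg_neg, max_eq_left hw.le]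

theorem dg_dvp (hE : IsFF p E) {f : E} (hf : Transcendental (ZMod p) f) :
    dg p (dvp hE f) = (Module.finrank (adjoin (ZMod p) {f}) E : ℤ) ∧ dg p (dvp hE f⁻¹) = dg p (dvp hE f) := by
  have hf' : Transcendental (ZMod p) f⁻¹ := fun h => hf (by simpa using h.inv)
  have h1 := dvp_deg_le hE hf
  have h2 := dvp_inv_le hE hf
  have h3 := dvp_deg_le hE hf'
  have h4 := dvp_inv_le hE hf'
  rw [inv_inv] at h4
  omega

theorem dg_dv (hE : IsFF p E) (f : E) : dg p (dv hE f) = 0 := by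
  by_cases hf : Transcendental (ZMod p) f
  · have h : dv hE f = dvp hE f⁻¹ - dvp hE f := by
      ext w
      simp
    rw [h, map_sub, (dg_dvp hE hf).2, sub_self]
  · convert map_zero (dg (E := E) p)
    ext w
    simp [w.o_alg (not_not.mp hf)]

end

end

section
open IntermediateField

section
variable {p : ℕ} [Fact p.Prime] {E : Type} [Field E] [Algebra (ZMod p) E]

lemma frob_sub_ne_zero {t : E} (ht : Transcendental (ZMod p) t) {M : ℕ} (hM : 0 < M) : t ^ (p ^ M) - t ≠ 0 := by
  intro h
  apply ht
  refine ⟨Polynomial.X ^ (p ^ M) - Polynomial.X, ?_, by simpa using h⟩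
  exact FiniteField.X_pow_card_pow_sub_X_ne_zero _ hM.ne' (Fact.out : p.Prime).one_lt

lemma o_frob_sub (w : FFPrime E) {t : E} (ht : w.o t < 0) {M : ℕ} (hM : 0 < M) :
    w.o (t ^ (p ^ M) - t) = (p ^ M : ℕ) * w.o t := by
  have ht0 : t ≠ 0 := by rintro rfl; simp at ht
  have hp : 1 < p ^ M := Nat.one_lt_pow hM.ne' (Fact.out : p.Prime).one_lt
  have := (w.o_add (x := t ^ (p ^ M)) (y := - t) (pow_ne_zero _ ht0) (by
    apply neg_mem
    rw [w.mem_M ht0, w.o_pow]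
    have : (2:ℤ) ≤ (p ^ M : ℕ) := by exact_mod_cast hp
    nlinarith)).2
  rw [← sub_eq_add_neg, w.o_pow] at this
  exact this

theorem rr_bound (hE : IsFF p E) : ∃ γ : ℤ, ∀ D : Dv E, rr p D ≤ γ := by
  obtain ⟨t, ht, -⟩ := id hE
  obtain ⟨C, hC0, hC⟩ := exists_bound hE ht
  refine ⟨dg p C - Module.finrank (adjoin (ZMod p) {t}) E, fun D => ?_⟩
  set B := dvp hE t
  have hB : ∀ l : ℕ, rr p ((l:ℤ) • B + C) ≤ dg p C - Module.finrank (adjoin (ZMod p) {t}) E := by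
    intro l
    unfold rr
    have := hC l
    rw [map_add, map_zsmul, smul_eq_mul, (dg_dvp hE ht).1]
    nlinarith
  let M := ∏ w ∈ D.support, w.deg p
  have hM : 0 < M := Finset.prod_pos fun w _ => FFPrime.deg_pos hE w
  let s := t ^ (p ^ M) - t
  have hs : s ≠ 0 := frob_sub_ne_zero ht hM
  let a : ℕ := ∑ w ∈ D.support, (D w).natAbs
  have ha : ∀ w, D w ≤ a := by
    intro w
    by_cases hw : w ∈ D.support
    · have := Finset.single_le_sum (f := fun w => (D w).natAbs) (fun _ _ => Nat.zero_le _) hw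
      have h2 : (D w).natAbs ≤ a := this
      omega
    · rw [Finsupp.notMem_support_iff.mp hw]; positivity
  let l := a * p ^ M + a
  have hle : D ≤ ((l:ℤ) • B + C) + dv hE (s ^ a) := by
    intro w
    have hCw : 0 ≤ C w := hC0 w
    have haw := ha w
    have ha0 : (0:ℤ) ≤ a := by positivity
    simp only [Finsupp.coe_add, Pi.add_apply, Finsupp.coe_smul, Pi.smul_apply, dv_apply, smul_eq_mul, B, dvp_apply, w.o_pow]
    rcases lt_or_ge (w.o t) 0 with h | h
    · rw [o_frob_sub w h hM, max_eq_left (by omega)]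
      simp only [l]
      push_cast
      nlinarith
    · rw [max_eq_right (by omega)]
      have htm : t ∈ w.M 0 := by rw [w.mem_M_iff]; exact Or.inr h
      by_cases hw : w ∈ D.support
      · have h1 : s ∈ w.M 1 := FFPrime.frob_iter hE w htm (Finset.dvd_prod_of_mem _ hw)
        rw [w.mem_M hs] at h1
        have : (a:ℤ) * 1 ≤ a * w.o s := by gcongr
        omega
      · rw [Finsupp.notMem_support_iff.mp hw]
        have h1 : s ∈ w.M 0 := sub_mem (w.pow_mem_M0 htm _) htm
        rw [w.mem_M hs] at h1
        have : (0:ℤ) ≤ a * w.o s := by positivity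
        omega
  refine (rr_mono hE hle).trans (le_trans (le_of_eq ?_) (hB l))
  unfold rr
  rw [rr_principal hE _ (pow_ne_zero _ hs), map_add, dg_dv, add_zero]

theorem exists_RR (hE : IsFF p E) : ∃ g n0 : ℤ, ∀ D : Dv E, n0 ≤ dg p D →
    (Module.finrank (ZMod p) (RL p D) : ℤ) = dg p D - g := by
  obtain ⟨γ, hγ⟩ := rr_bound hE
  obtain ⟨g, ⟨D1, hD1⟩, hg⟩ := Int.exists_greatest_of_bdd (P := fun z => ∃ D : Dv E, rr p D = z)
    ⟨γ, by rintro z ⟨D, rfl⟩; exact hγ D⟩ ⟨rr p 0, 0, rfl⟩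
  refine ⟨g, dg p D1 + g + 1, fun D hD => ?_⟩
  have h1 : (0:ℤ) < Module.finrank (ZMod p) (RL p (D - D1)) := by
    have := hg _ ⟨D - D1, rfl⟩
    unfold rr at this
    rw [map_sub] at this
    omega
  have hfin := RL_fin hE (D - D1)
  have h2 : RL p (D - D1) ≠ ⊥ := by
    intro h
    rw [h] at h1; simp at h1
  obtain ⟨z, hz, hz0⟩ := Submodule.exists_mem_ne_zero_of_ne_bot h2
  rw [mem_RL_iff hE hz0] at hz
  have h3 : D1 ≤ D + dv hE z := by
    have := add_le_add_left hz D1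
    rw [zero_add] at this
    refine this.trans (le_of_eq ?_)
    abel
  have h4 := rr_mono hE (p := p) h3
  have h5 := hg _ ⟨D, rfl⟩
  have h6 : rr p (D + dv hE z) = rr p D := by
    unfold rr; rw [rr_principal hE _ hz0, map_add, dg_dv, add_zero]
  unfold rr at *
  omega

theorem finite_deg_le (hE : IsFF p E) (m : ℕ) : {w : FFPrime E | w.deg p ≤ m}.Finite := by
  obtain ⟨t, ht, -⟩ := id hE
  have hM := Nat.factorial_pos m
  have hs := frob_sub_ne_zero ht hM
  refine (FFPrime.finite_supp hE (t ^ (p ^ m.factorial) - t)).subset fun w hw => ?_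
  have hw : w.deg p ≤ m := hw
  change w.o _ ≠ 0
  rcases lt_or_ge (w.o t) 0 with h | h
  · rw [o_frob_sub w h hM]
    have : 0 < p ^ m.factorial := pow_pos (Fact.out : p.Prime).pos _
    exact mul_ne_zero (by exact_mod_cast this.ne') h.ne
  · have htm : t ∈ w.M 0 := by rw [w.mem_M_iff]; exact Or.inr h
    have := FFPrime.frob_iter hE w htm (Nat.dvd_factorial (FFPrime.deg_pos hE w) hw)
    rw [w.mem_M hs] at this
    omega

theorem finite_eff (hE : IsFF p E) (m : ℤ) : {D : Dv E | 0 ≤ D ∧ dg p D ≤ m}.Finite := by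
  classical
  have hf := finite_deg_le hE m.toNat
  let S := hf.toFinset
  have : {D : Dv E | 0 ≤ D ∧ dg p D ≤ m} ⊆ Set.image (fun g : FFPrime E →₀ ℤ => g) (Finset.finsupp S (fun _ => Finset.Icc 0 m) : Set (FFPrime E →₀ ℤ)) := by
    rintro D ⟨h0, hD⟩
    have hle : ∀ w ∈ D.support, D w * w.deg p ≤ m := by
      intro w hw
      rw [dg_eq] at hD
      exact (Finset.single_le_sum (f := fun w => D w * (w.deg p : ℤ)) (fun w _ => mul_nonneg (h0 w) (by positivity)) hw).trans hD
    refine ⟨D, ?_, rfl⟩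
    rw [Finset.mem_coe, Finset.mem_finsupp_iff]
    constructor
    · intro w hw
      have := hle w hw
      have h1 : (1:ℤ) ≤ D w := by
        have h2 := h0 w
        have h3 := Finsupp.mem_support_iff.mp hw
        simp at h2
        omega
      simp only [S, Set.Finite.mem_toFinset]
      change w.deg p ≤ m.toNat
      have h3 : (0:ℤ) ≤ w.deg p := by positivity
      have : (w.deg p : ℤ) ≤ m := by nlinarith
      omega
    · intro w hw
      rw [Finset.mem_Icc]
      refine ⟨h0 w, ?_⟩
      by_cases hws : w ∈ D.support
      · have := hle w hws
        have h1 : (1:ℤ) ≤ w.deg p := by exact_mod_cast FFPrime.deg_pos hE w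
        have h2 := h0 w
        simp at h2
        nlinarith
      · rw [Finsupp.notMem_support_iff.mp hws]
        exact (dg_nonneg h0).trans hD
  exact ((Finset.finite_toSet _).image _).subset this

/-- principal divisors as a subgroup -/
def Pr (hE : IsFF p E) : AddSubgroup (Dv E) where
  carrier := {D | ∃ f : E, f ≠ 0 ∧ dv hE f = D}
  zero_mem' := ⟨1, one_ne_zero, dv_one hE⟩
  add_mem' := by
    rintro _ _ ⟨f, hf, rfl⟩ ⟨g, hg, rfl⟩
    exact ⟨f * g, mul_ne_zero hf hg, dv_mul hE hf hg⟩
  neg_mem' := by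
    rintro _ ⟨f, hf, rfl⟩
    exact ⟨f⁻¹, inv_ne_zero hf, dv_inv hE f⟩

variable (p E) in
/-- degree zero divisors -/
abbrev Dv0 : AddSubgroup (Dv E) := (dg (E := E) p).ker

lemma Pr_le (hE : IsFF p E) : Pr hE ≤ Dv0 p E := by
  rintro _ ⟨f, hf, rfl⟩
  exact dg_dv hE f

theorem finite_pic (hE : IsFF p E) : Finite (Dv0 p E ⧸ (Pr hE).addSubgroupOf (Dv0 p E)) := by
  obtain ⟨g, n0, hRR⟩ := exists_RR hE
  obtain ⟨w⟩ := hE.nonempty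
  have hw : (1:ℤ) ≤ w.deg p := by exact_mod_cast FFPrime.deg_pos hE w
  let m := max n0 (g + 1)
  let D0 : Dv E := Finsupp.single w (max m 0)
  have hD0 : m ≤ dg p D0 := by
    rw [dg_single]
    have := le_max_left m 0
    have := le_max_right m 0
    nlinarith
  have := (finite_eff hE (dg p D0)).to_subtype
  let X := {A : Dv E // (0 ≤ A ∧ dg p A ≤ dg p D0) ∧ dg p (A - D0) = 0}
  have hX : Finite X := Finite.of_injective (fun A : X => (⟨A.1, A.2.1⟩ : {D : Dv E | 0 ≤ D ∧ dg p D ≤ dg p D0})) (by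
    intro A B h
    have := congrArg Subtype.val h
    exact Subtype.ext this)
  refine Finite.of_surjective (fun A : X => (QuotientAddGroup.mk (⟨A.1 - D0, A.2.2⟩ : Dv0 p E) : Dv0 p E ⧸ (Pr hE).addSubgroupOf (Dv0 p E))) ?_
  intro c
  induction c using QuotientAddGroup.induction_on with
  | _ D =>
    have hdD : dg p (D : Dv E) = 0 := D.2
    have h1 := hRR (D + D0) (by rw [map_add, hdD]; have := le_max_left n0 (g+1); omega)
    rw [map_add, hdD] at h1
    have h2 : RL p ((D : Dv E) + D0) ≠ ⊥ := by
      intro h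
      rw [h] at h1
      simp at h1
      have := le_max_right n0 (g+1)
      omega
    obtain ⟨z, hz, hz0⟩ := Submodule.exists_mem_ne_zero_of_ne_bot h2
    rw [mem_RL_iff hE hz0] at hz
    have hdeg : dg p (dv hE z + ((D:Dv E) + D0)) = dg p D0 := by
      rw [map_add, map_add, dg_dv, hdD]; ring
    refine ⟨⟨dv hE z + ((D:Dv E) + D0), ⟨hz, hdeg.le⟩, by rw [map_sub, hdeg, sub_self]⟩, ?_⟩
    rw [QuotientAddGroup.eq]
    rw [AddSubgroup.mem_addSubgroupOf]
    refine ⟨z⁻¹, inv_ne_zero hz0, ?_⟩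
    rw [dv_inv]
    push_cast
    abel

end

end

section
open IntermediateField

section Zeta
open PowerSeries

/-- A `ℂˣ`-valued character separating a point from a subgroup. -/
lemma exists_char {A : Type*} [AddCommGroup A] (H : AddSubgroup A) {D : A} (hD : D ∉ H) :
    ∃ ψ : A → ℂ, ψ 0 = 1 ∧ (∀ x y, ψ (x + y) = ψ x * ψ y) ∧ (∀ x ∈ H, ψ x = 1) ∧ ψ D ≠ 1 := by
  have h1 : (QuotientAddGroup.mk D : A ⧸ H) ≠ 0 := by
    rwa [Ne, QuotientAddGroup.eq_zero_iff]
  obtain ⟨c, hc⟩ := CharacterModule.exists_character_apply_ne_zero_of_ne_zero h1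
  let r : AddCircle (1:ℚ) →+ AddCircle (1:ℝ) := QuotientAddGroup.map _ _ (Rat.castHom ℝ).toAddMonoidHom (by
    intro x hx
    obtain ⟨k, rfl⟩ := AddSubgroup.mem_zmultiples_iff.mp hx
    exact AddSubgroup.mem_zmultiples_iff.mpr ⟨k, by simp⟩)
  have hr : Function.Injective r := by
    rw [injective_iff_map_eq_zero]
    intro x hx
    induction x using QuotientAddGroup.induction_on with
    | _ x =>
      have h2 : ((x : ℝ) : AddCircle (1:ℝ)) = 0 := hx
      obtain ⟨k, hk⟩ := (AddCircle.coe_eq_zero_iff _).mp h2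
      refine (AddCircle.coe_eq_zero_iff _).mpr ⟨k, ?_⟩
      simp only [zsmul_eq_mul, mul_one] at hk ⊢
      exact_mod_cast hk
  refine ⟨fun x => (AddCircle.toCircle (r (c (QuotientAddGroup.mk x))) : ℂ), ?_, ?_, ?_, ?_⟩
  · have : (QuotientAddGroup.mk (0:A) : A ⧸ H) = 0 := rfl
    simp [this]
  · intro x y
    have : (QuotientAddGroup.mk (x + y) : A ⧸ H) = QuotientAddGroup.mk x + QuotientAddGroup.mk y := rfl
    simp [this, AddCircle.toCircle_add]
  · intro x hx
    have : (QuotientAddGroup.mk x : A ⧸ H) = 0 := by rwa [QuotientAddGroup.eq_zero_iff]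
    simp [this]
  · intro h
    apply hc
    apply hr
    rw [map_zero]
    apply AddCircle.injective_toCircle one_ne_zero
    rw [AddCircle.toCircle_zero]
    apply Subtype.ext
    exact h

/-- geometric series `∑ a^j T^{dj}` -/
def Geo {R : Type*} [CommSemiring R] (d : ℕ) (a : R) : PowerSeries R :=
  PowerSeries.mk fun k => if d ∣ k then a ^ (k / d) else 0

lemma Geo_mul {R : Type*} [CommRing R] {d : ℕ} (hd : 0 < d) (a : R) :
    Geo d a * (1 - C a * X ^ d) = 1 := by
  ext k
  rw [mul_sub, mul_one, mul_left_comm, ← mul_assoc, map_sub, coeff_mul_X_pow', coeff_C_mul, coeff_one]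
  simp only [Geo, coeff_mk]
  rcases Nat.eq_zero_or_pos k with rfl | hk
  · simp; omega
  · rw [if_neg hk.ne']
    by_cases h : d ∣ k
    · obtain ⟨j, rfl⟩ := h
      obtain ⟨j, rfl⟩ : ∃ i, j = i + 1 := ⟨j - 1, by have := Nat.pos_of_mul_pos_left hk; omega⟩
      have h2 : d * (j + 1) - d = d * j := by rw [mul_add, mul_one, Nat.add_sub_cancel]
      rw [if_pos (dvd_mul_right _ _), if_pos (Nat.le_mul_of_pos_right _ (by omega)), h2, if_pos (dvd_mul_right _ _),
        Nat.mul_div_cancel_left _ hd, Nat.mul_div_cancel_left _ hd]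
      ring
    · rw [if_neg h]
      split_ifs with h1 h2
      · exact absurd ((Nat.dvd_sub_iff_left h1 dvd_rfl).mp h2) h
      · simp
      · simp

@[to_additive]
lemma prod_periodic {R : Type*} [CommMonoid R] (f : ℕ → R) (n : ℕ) (hf : ∀ i, f (i + n) = f i) (g : ℕ) :
    ∏ i ∈ Finset.range (n * g), f i = (∏ i ∈ Finset.range n, f i) ^ g := by
  have hf' : ∀ k i, f (n * k + i) = f i := by
    intro k
    induction k with
    | zero => simp
    | succ k ih =>
      intro i
      rw [show n * (k + 1) + i = (n * k + i) + n by ring, hf, ih]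
  induction g with
  | zero => simp
  | succ g ih =>
    rw [mul_add, mul_one, Finset.prod_range_add, ih, pow_succ]
    simp [hf']

lemma prod_one_sub {R : Type*} [CommRing R] [IsDomain R] {n : ℕ} (hn : 0 < n) {η : R} (h : IsPrimitiveRoot η n) (y : R) :
    ∏ i ∈ Finset.range n, (1 - η ^ i * y) = 1 - y ^ n := by
  have := h.pow_sub_pow_eq_prod_sub_mul 1 y hn
  rw [one_pow] at this
  rw [this]
  have : NeZero n := ⟨hn.ne'⟩
  refine Finset.prod_bij (fun i _ => η ^ i) ?_ ?_ ?_ ?_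
  · intro i _
    rw [Polynomial.mem_nthRootsFinset hn, ← pow_mul, mul_comm, pow_mul, h.pow_eq_one, one_pow]
  · intro i hi j hj hij
    exact h.pow_inj (Finset.mem_range.mp hi) (Finset.mem_range.mp hj) hij
  · intro b hb
    rw [Polynomial.mem_nthRootsFinset hn] at hb
    obtain ⟨i, hi, e⟩ := h.eq_pow_of_pow_eq_one hb
    exact ⟨i, Finset.mem_range.mpr hi, e⟩
  · simp

/-- the twisted Euler factor -/
lemma prod_rescale_Geo {n d : ℕ} (hn : 0 < n) (hd : 0 < d) {ζ : ℂ} (hζ : IsPrimitiveRoot ζ n) {a : ℂ}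
    (ha : a ^ (n / d.gcd n) = 1) :
    ∏ i ∈ Finset.range n, rescale (ζ ^ i) (Geo d a) =
      PowerSeries.map (Nat.castRingHom ℂ) (Geo (d * (n / d.gcd n)) 1 ^ (d.gcd n)) := by
  set g := d.gcd n with hg
  have hg0 : 0 < g := Nat.gcd_pos_of_pos_left _ hd
  set n' := n / g with hn'
  have hgn : n' * g = n := Nat.div_mul_cancel (Nat.gcd_dvd_right _ _)
  have hn'0 : 0 < n' := by
    rcases Nat.eq_zero_or_pos n' with h | h
    · rw [h, zero_mul] at hgn; omega
    · exact h
  have hη : IsPrimitiveRoot (ζ ^ d) n' := by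
    obtain ⟨d', hd'⟩ : g ∣ d := Nat.gcd_dvd_left _ _
    have h1 : IsPrimitiveRoot (ζ ^ g) n' := hζ.pow hn (by rw [mul_comm, hgn])
    rw [hd', pow_mul]
    apply h1.pow_of_coprime
    have := Nat.coprime_div_gcd_div_gcd (m := d) (n := n) hg0
    rw [← hg, hd', Nat.mul_div_cancel_left _ hg0] at this
    exact this
  have key : ∏ i ∈ Finset.range n, rescale (ζ ^ i) (1 - C a * X ^ d : PowerSeries ℂ) = (1 - X ^ (d * n')) ^ g := by
    have h2 : ∀ i, rescale (ζ ^ i) (1 - C a * X ^ d : PowerSeries ℂ) = 1 - (C (ζ ^ d)) ^ i * (C a * X ^ d) := by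
      intro i
      rw [map_sub, map_one, map_mul, map_pow, rescale_X, mul_pow, ← map_pow, ← map_pow, ← pow_mul, ← pow_mul, mul_comm i d, show rescale (ζ ^ i) (C a) = C a by ext k; simp only [coeff_rescale, coeff_C]; split_ifs with h <;> simp [h]]
      ring
    simp_rw [h2]
    conv_lhs => rw [← hgn]
    rw [prod_periodic _ n']
    · rw [prod_one_sub hn'0 (hη.map_of_injective C_injective), mul_pow, ← map_pow, ha, map_one, one_mul, pow_mul]
    · intro i
      rw [pow_add, ← map_pow C _ n', hη.pow_eq_one, map_one, mul_one]
  have h3 : (∏ i ∈ Finset.range n, rescale (ζ ^ i) (Geo d a)) * (1 - X ^ (d * n')) ^ g = 1 := by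
    rw [← key, ← Finset.prod_mul_distrib]
    apply Finset.prod_eq_one
    intro i _
    rw [← map_mul, Geo_mul hd, map_one]
  have h4 : PowerSeries.map (Nat.castRingHom ℂ) (Geo (d * n') 1 ^ g) * (1 - X ^ (d * n')) ^ g = 1 := by
    rw [map_pow, ← mul_pow]
    have : PowerSeries.map (Nat.castRingHom ℂ) (Geo (d * n') 1) = Geo (d * n') 1 := by
      ext k; simp [Geo]
    rw [this]
    have := Geo_mul (R := ℂ) (d := d * n') (by positivity) 1
    rw [map_one, one_mul] at this
    rw [this, one_pow]
  exact mul_right_cancel₀ (right_ne_zero_of_mul_eq_one h3) (h3.trans h4.symm)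

lemma coeff_le_mul (a b : PowerSeries ℕ) (hb : coeff 0 b = 1) (m : ℕ) : coeff m a ≤ coeff m (a * b) := by
  rw [coeff_mul]
  have := Finset.single_le_sum (f := fun x : ℕ × ℕ => coeff x.1 a * coeff x.2 b) (s := Finset.HasAntidiagonal.antidiagonal m) (fun _ _ => Nat.zero_le _)
    (show (m, 0) ∈ Finset.HasAntidiagonal.antidiagonal m by simp)
  simpa [hb] using this

lemma coeff_prod_pos {Ω : Type*} (S : Finset Ω) (k g : Ω → ℕ) (hg : ∀ o, 0 < g o) {o : Ω} (ho : o ∈ S) (j : ℕ) :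
    0 < coeff (k o * j) (∏ o ∈ S, (Geo (k o) (1:ℕ)) ^ g o) := by
  classical
  have h0 : ∀ o, coeff 0 (Geo (k o) (1:ℕ)) = 1 := by intro o; simp [Geo]
  have h1 : ∀ o i, coeff 0 (Geo (k o) (1:ℕ) ^ i) = 1 := by
    intro o i
    have := h0 o
    rw [coeff_zero_eq_constantCoeff_apply] at this ⊢
    rw [map_pow, this, one_pow]
  rw [← Finset.mul_prod_erase S _ ho]
  refine lt_of_lt_of_le ?_ (coeff_le_mul _ _ ?_ _)
  · obtain ⟨i, hi⟩ : ∃ i, g o = i + 1 := ⟨g o - 1, by have := hg o; omega⟩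
    rw [hi, pow_succ']
    refine lt_of_lt_of_le ?_ (coeff_le_mul _ _ (h1 _ _) _)
    simp [Geo]
  · rw [coeff_zero_eq_constantCoeff_apply, map_prod]
    apply Finset.prod_eq_one
    intro o' _
    rw [← coeff_zero_eq_constantCoeff_apply]
    exact h1 _ _

/-- inclusion of effective divisors -/
def iota (Ω : Type*) : (Ω →₀ ℕ) →+ (Ω →₀ ℤ) := Finsupp.mapRange.addMonoidHom (Nat.castAddMonoidHom ℤ)

lemma iota_single {Ω : Type*} (o : Ω) (k : ℕ) : iota Ω (Finsupp.single o k) = Finsupp.single o (k:ℤ) := by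
  simp [iota]

section
variable {Ω : Type} (d : Ω → ℕ) (hd : ∀ o, 0 < d o) (hfin : ∀ m : ℕ, {o | d o ≤ m}.Finite)

/-- degree of an effective divisor -/
def dgN : (Ω →₀ ℕ) →+ ℕ := Finsupp.liftAddHom fun o => AddMonoidHom.mulRight (d o)

lemma dgN_apply (A : Ω →₀ ℕ) : dgN d A = ∑ o ∈ A.support, A o * d o := by
  simp [dgN, Finsupp.sum]

include hd in
lemma le_dgN (A : Ω →₀ ℕ) (o : Ω) (ho : A o ≠ 0) : d o ≤ dgN d A ∧ A o ≤ dgN d A := by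
  rw [dgN_apply]
  have := Finset.single_le_sum (f := fun o => A o * d o) (fun _ _ => Nat.zero_le _) (Finsupp.mem_support_iff.mpr ho)
  refine ⟨le_trans ?_ this, le_trans ?_ this⟩
  · exact Nat.le_mul_of_pos_left _ (by omega)
  · exact Nat.le_mul_of_pos_right _ (hd o)

include hd hfin in
lemma finite_dgN (m : ℕ) : {A : Ω →₀ ℕ | dgN d A = m}.Finite := by
  classical
  refine (Finset.finite_toSet (Finset.finsupp (hfin m).toFinset (fun _ => Finset.range (m+1)))).subset ?_
  intro A hA
  have hA : dgN d A = m := hA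
  rw [Finset.mem_coe, Finset.mem_finsupp_iff]
  constructor
  · intro o ho
    have := (le_dgN d hd A o (Finsupp.mem_support_iff.mp ho)).1
    rw [Set.Finite.mem_toFinset]
    exact this.trans hA.le
  · intro o _
    rw [Finset.mem_range]
    by_cases h : A o = 0
    · omega
    · have := (le_dgN d hd A o h).2
      omega

include hd in
lemma coeff_prod_Geo (ψ : (Ω →₀ ℤ) → ℂ) (h0 : ψ 0 = 1) (hadd : ∀ x y, ψ (x + y) = ψ x * ψ y) (S : Finset Ω) (m : ℕ)
    (hS : ∀ o, d o ≤ m → o ∈ S) :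
    coeff m (∏ o ∈ S, Geo (d o) (ψ (Finsupp.single o 1))) = ∑ A ∈ (finite_dgN d hd hfin m).toFinset, ψ (iota Ω A) := by
  classical
  rw [coeff_prod]
  symm
  let e : (Ω →₀ ℕ) → (Ω →₀ ℕ) := fun A => Finsupp.onFinset A.support (fun o => d o * A o) (by
    intro o ho; rw [Finsupp.mem_support_iff]; intro h; simp [h] at ho)
  have he : ∀ A o, e A o = d o * A o := fun A o => rfl
  have hψ : ∀ (B : Ω →₀ ℕ), ψ (iota Ω B) = ∏ o ∈ B.support, ψ (Finsupp.single o 1) ^ (B o) := by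
    let Ψ : Multiplicative (Ω →₀ ℤ) →* ℂ := ⟨⟨fun x => ψ x.toAdd, h0⟩, fun x y => hadd _ _⟩
    intro B
    have h1 : iota Ω B = ∑ o ∈ B.support, (B o) • (Finsupp.single o (1:ℤ)) := by
      conv_lhs => rw [← Finsupp.sum_single B, Finsupp.sum, map_sum]
      refine Finset.sum_congr rfl fun o _ => ?_
      rw [iota_single]; simp
    have h2 : ψ (iota Ω B) = Ψ (Multiplicative.ofAdd (iota Ω B)) := rfl
    rw [h2, h1, ofAdd_sum, map_prod]
    refine Finset.prod_congr rfl fun o _ => ?_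
    rw [ofAdd_nsmul, map_pow]
    rfl
  apply Finset.sum_of_injOn e
  · intro A _ B _ hAB
    ext o
    have := DFunLike.congr_fun hAB o
    rw [he, he] at this
    exact Nat.eq_of_mul_eq_mul_left (hd o) this
  · intro A hA
    rw [Finset.mem_coe, Set.Finite.mem_toFinset] at hA
    have hA : dgN d A = m := hA
    rw [Finset.mem_coe, Finset.mem_finsuppAntidiag]
    have hs : (A.support : Finset Ω) ⊆ S := by
      intro o ho
      exact hS o (((le_dgN d hd A o (Finsupp.mem_support_iff.mp ho)).1).trans hA.le)
    constructor
    · rw [← hA, dgN_apply]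
      symm
      rw [Finset.sum_congr rfl (fun o _ => show A o * d o = e A o by rw [he, mul_comm])]
      apply Finset.sum_subset hs
      intro o _ ho
      rw [he, Finsupp.notMem_support_iff.mp ho, mul_zero]
    · refine subset_trans ?_ hs
      intro o ho
      rw [Finsupp.mem_support_iff, he] at ho
      rw [Finsupp.mem_support_iff]
      exact right_ne_zero_of_mul ho
  · intro l hl hl2
    by_contra hne
    apply hl2
    have hne := Finset.prod_ne_zero_iff.mp hne
    rw [Finset.mem_finsuppAntidiag] at hl
    have hdvd : ∀ o, d o ∣ l o := by
      intro o
      by_cases ho : o ∈ S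
      · have := hne o ho
        simp only [Geo, coeff_mk] at this
        by_contra h
        simp [h] at this
      · have : l o = 0 := by
          by_contra h
          exact ho (hl.2 (Finsupp.mem_support_iff.mpr h))
        rw [this]; exact dvd_zero _
    let A : Ω →₀ ℕ := Finsupp.onFinset l.support (fun o => l o / d o) (by
      intro o ho; rw [Finsupp.mem_support_iff]; intro h; simp [h] at ho)
    have hA : e A = l := by
      ext o
      rw [he]
      exact Nat.mul_div_cancel' (hdvd o)
    refine ⟨A, ?_, hA⟩
    rw [Finset.mem_coe, Set.Finite.mem_toFinset]
    change dgN d A = m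
    rw [dgN_apply, ← hl.1]
    rw [Finset.sum_congr rfl (fun o _ => show A o * d o = l o by rw [← hA, he, mul_comm])]
    apply Finset.sum_subset
    · intro o ho
      apply hl.2
      rw [Finsupp.mem_support_iff] at ho ⊢
      rw [← hA, he]
      exact mul_ne_zero (hd o).ne' ho
    · intro o _ ho
      rw [← hA, he, Finsupp.notMem_support_iff.mp ho, mul_zero]
  · intro A hA
    rw [Set.Finite.mem_toFinset] at hA
    have hA : dgN d A = m := hA
    rw [hψ]
    have hs : (A.support : Finset Ω) ⊆ S := by
      intro o ho
      exact hS o (((le_dgN d hd A o (Finsupp.mem_support_iff.mp ho)).1).trans hA.le)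
    rw [Finset.prod_subset hs]
    · refine Finset.prod_congr rfl fun o _ => ?_
      rw [he, Geo, coeff_mk, if_pos (dvd_mul_right _ _), Nat.mul_div_cancel_left _ (hd o)]
    · intro o _ ho
      rw [Finsupp.notMem_support_iff.mp ho, pow_zero]

include hd hfin in
lemma charsum_zero (P : AddSubgroup (Ω →₀ ℤ)) (deg : (Ω →₀ ℤ) →+ ℤ) (hdeg : ∀ A, deg (iota Ω A) = dgN d A)
    (hP0 : ∀ D ∈ P, deg D = 0) (ψ : (Ω →₀ ℤ) → ℂ) (hadd : ∀ x y, ψ (x + y) = ψ x * ψ y)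
    (hψP : ∀ x ∈ P, ψ x = 1) (m : ℕ)
    (hcount : ∀ D D' : Ω →₀ ℤ, deg D = m → deg D' = m →
      Nat.card {A : Ω →₀ ℕ // iota Ω A - D ∈ P} = Nat.card {A : Ω →₀ ℕ // iota Ω A - D' ∈ P})
    (D0 : Ω →₀ ℤ) (hD0 : deg D0 = 0) (hψ : ψ D0 ≠ 1) :
    ∑ A ∈ (finite_dgN d hd hfin m).toFinset, ψ (iota Ω A) = 0 := by
  classical
  set X := (finite_dgN d hd hfin m).toFinset with hX
  have hmX : ∀ A, A ∈ X ↔ dgN d A = m := by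
    intro A; rw [hX, Set.Finite.mem_toFinset]; rfl
  let mk : (Ω →₀ ℕ) → (Ω →₀ ℤ) ⧸ P := fun A => QuotientAddGroup.mk (iota Ω A)
  have hout : ∀ x, ∃ t ∈ P, (QuotientAddGroup.mk x : (Ω →₀ ℤ) ⧸ P).out = x + t := by
    intro x
    obtain ⟨t, ht⟩ := QuotientAddGroup.mk_out_eq_add P x
    exact ⟨t, t.2, ht⟩
  let ψ' : (Ω →₀ ℤ) ⧸ P → ℂ := fun c => ψ c.out
  have hψ' : ∀ x : Ω →₀ ℤ, ψ' (QuotientAddGroup.mk x) = ψ x := by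
    intro x
    obtain ⟨t, ht, e⟩ := hout x
    simp only [ψ', e, hadd, hψP t ht, mul_one]
  let f : (Ω →₀ ℤ) ⧸ P → ℕ := fun c => (X.filter (fun A => mk A = c)).card
  have hf : ∀ x : Ω →₀ ℤ, deg x = m → f (QuotientAddGroup.mk x) = Nat.card {A : Ω →₀ ℕ // iota Ω A - x ∈ P} := by
    intro x hx
    simp only [f]
    rw [← Fintype.card_coe, ← Nat.card_eq_fintype_card]
    refine Nat.card_congr (Equiv.subtypeEquivRight fun A => ?_)
    rw [Finset.mem_filter, hmX]
    have h1 : mk A = QuotientAddGroup.mk x ↔ iota Ω A - x ∈ P := by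
      rw [← neg_mem_iff, neg_sub, sub_eq_neg_add]
      exact QuotientAddGroup.eq
    rw [h1]
    refine ⟨fun h => h.2, fun h => ⟨?_, h⟩⟩
    have := hP0 _ h
    rw [map_sub, hdeg, hx] at this
    omega
  have hf0 : ∀ x : Ω →₀ ℤ, deg x ≠ m → f (QuotientAddGroup.mk x) = 0 := by
    intro x hx
    rw [Finset.card_eq_zero, Finset.filter_eq_empty_iff]
    intro A hA h
    rw [hmX] at hA
    have h2 := QuotientAddGroup.eq.mp h
    have h3 := hP0 _ h2
    rw [map_add, map_neg, hdeg, hA] at h3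
    omega
  have hfD : ∀ c, f (c + QuotientAddGroup.mk D0) = f c := by
    intro c
    induction c using QuotientAddGroup.induction_on with
    | _ x =>
      rw [← QuotientAddGroup.mk_add]
      have h1 : deg (x + D0) = deg x := by rw [map_add, hD0, add_zero]
      by_cases hx : deg x = m
      · rw [hf _ hx, hf _ (h1.trans hx)]
        exact hcount _ _ (h1.trans hx) hx
      · rw [hf0 _ hx, hf0 _ (by rwa [h1])]
  have hψD : ∀ c, ψ' (c + QuotientAddGroup.mk D0) = ψ' c * ψ D0 := by
    intro c
    induction c using QuotientAddGroup.induction_on with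
    | _ x => rw [← QuotientAddGroup.mk_add, hψ', hψ', hadd]
  have h1 : ∑ A ∈ X, ψ (iota Ω A) = ∑ᶠ c, f c • ψ' c := by
    have : ∀ A, ψ (iota Ω A) = ψ' (mk A) := fun A => (hψ' _).symm
    simp_rw [this]
    rw [Finset.sum_comp, finsum_eq_sum_of_support_subset]
    intro c hc
    rw [Function.mem_support] at hc
    have : f c ≠ 0 := by
      intro h; rw [h, zero_smul] at hc; exact hc rfl
    obtain ⟨A, hA⟩ := Finset.card_ne_zero.mp this
    rw [Finset.mem_filter] at hA
    rw [Finset.mem_coe, Finset.mem_image]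
    exact ⟨A, hA.1, hA.2⟩
  have h2 : ∑ᶠ c, f c • ψ' c = (∑ᶠ c, f c • ψ' c) * ψ D0 := by
    conv_lhs => rw [← finsum_comp_equiv (Equiv.addRight (QuotientAddGroup.mk D0 : (Ω →₀ ℤ) ⧸ P))]
    rw [finsum_mul']
    · refine finsum_congr fun c => ?_
      rw [Equiv.coe_addRight, hfD, hψD, smul_mul_assoc]
    · refine (X.image mk).finite_toSet.subset ?_
      intro c hc
      rw [Function.mem_support] at hc
      have : f c ≠ 0 := by
        intro h; rw [h, zero_smul] at hc; exact hc rfl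
      obtain ⟨A, hA⟩ := Finset.card_ne_zero.mp this
      rw [Finset.mem_filter] at hA
      rw [Finset.mem_coe, Finset.mem_image]
      exact ⟨A, hA.1, hA.2⟩
  rw [h1]
  by_contra h3
  apply hψ
  have := mul_left_cancel₀ h3 ((mul_one _).trans h2)
  exact this.symm

include hd hfin in
theorem zeta_lemma [Nonempty Ω] {n : ℕ} (hn : 0 < n) (P : AddSubgroup (Ω →₀ ℤ)) (deg : (Ω →₀ ℤ) →+ ℤ)
    (hdeg : ∀ A, deg (iota Ω A) = dgN d A)
    (hP0 : ∀ D ∈ P, deg D = 0) (n0 : ℕ)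
    (hcount : ∀ m : ℕ, n0 ≤ m → ∀ D D' : Ω →₀ ℤ, deg D = m → deg D' = m →
      Nat.card {A : Ω →₀ ℕ // iota Ω A - D ∈ P} = Nat.card {A : Ω →₀ ℕ // iota Ω A - D' ∈ P})
    (H : AddSubgroup (Ω →₀ ℤ)) (hPH : P ≤ H)
    (hH : ∀ o, Finsupp.single o ((n / (d o).gcd n : ℕ):ℤ) ∈ H) (D : Ω →₀ ℤ) (hD : deg D = 0) : D ∈ H := by
  classical
  by_contra hDH
  obtain ⟨ψ, h0, hadd, hψH, hψD⟩ := exists_char H hDH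
  let a : ℕ → ℂ := fun m => ∑ A ∈ (finite_dgN d hd hfin m).toFinset, ψ (iota Ω A)
  have ha : ∀ m, n0 ≤ m → a m = 0 := fun m hm =>
    charsum_zero d hd hfin P deg hdeg hP0 ψ hadd (fun x hx => hψH x (hPH hx)) m (hcount m hm) D hD hψD
  have hmul : ∀ (o : Ω) (k : ℕ), ψ (Finsupp.single o (k:ℤ)) = ψ (Finsupp.single o 1) ^ k := by
    intro o k
    induction k with
    | zero => simp [h0]
    | succ k ih => push_cast; rw [Finsupp.single_add, hadd, ih, pow_succ]
  let Lp : Polynomial ℂ := ∑ m ∈ Finset.range n0, Polynomial.monomial m (a m)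
  have hLp : ∀ m, Lp.coeff m = a m := by
    intro m
    simp only [Lp, Polynomial.finsetSum_coeff, Polynomial.coeff_monomial, Finset.sum_ite_eq', Finset.mem_range]
    split_ifs with h
    · rfl
    · exact (ha m (by omega)).symm
  have hLdeg : Lp.natDegree ≤ n0 := by
    rw [Polynomial.natDegree_le_iff_coeff_eq_zero]
    intro m hm
    rw [hLp, ha m (by omega)]
  obtain ⟨o0⟩ := (inferInstance : Nonempty Ω)
  let ζ := Complex.exp (2 * Real.pi * Complex.I / n)
  have hζ : IsPrimitiveRoot ζ n := Complex.isPrimitiveRoot_exp n hn.ne'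
  let k : Ω → ℕ := fun o => d o * (n / (d o).gcd n)
  have hk : ∀ o, 0 < k o := fun o => Nat.mul_pos (hd o) (Nat.div_pos (Nat.le_of_dvd hn (Nat.gcd_dvd_right _ _)) (Nat.gcd_pos_of_pos_left _ (hd o)))
  let j := n * n0 + 1
  let M := k o0 * j
  have hM1 : n * n0 < M := lt_of_lt_of_le (Nat.lt_succ_self _) (Nat.le_mul_of_pos_left _ (hk o0))
  have hM2 : d o0 ≤ M := by
    calc d o0 ≤ k o0 := Nat.le_mul_of_pos_right _ (Nat.div_pos (Nat.le_of_dvd hn (Nat.gcd_dvd_right _ _)) (Nat.gcd_pos_of_pos_left _ (hd _)))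
      _ ≤ M := Nat.le_mul_of_pos_right _ (Nat.succ_pos _)
  let S := (hfin M).toFinset
  have hS : ∀ o, o ∈ S ↔ d o ≤ M := by
    intro o; rw [Set.Finite.mem_toFinset]; rfl
  let LS : PowerSeries ℂ := ∏ o ∈ S, Geo (d o) (ψ (Finsupp.single o 1))
  have hLS : ∀ m ≤ M, coeff m LS = a m := by
    intro m hm
    exact coeff_prod_Geo d hd hfin ψ h0 hadd S m (fun o ho => (hS o).mpr (ho.trans hm))
  have hcong : ∀ i, (X ^ (M + 1) : PowerSeries ℂ) ∣ rescale (ζ ^ i) LS - rescale (ζ ^ i) (Lp : PowerSeries ℂ) := by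
    intro i
    rw [X_pow_dvd_iff]
    intro m hm
    rw [map_sub, coeff_rescale, coeff_rescale, hLS m (by omega), Polynomial.coeff_coe, hLp, sub_self]
  have hcong2 : (X ^ (M + 1) : PowerSeries ℂ) ∣ ∏ i ∈ Finset.range n, rescale (ζ ^ i) LS - ∏ i ∈ Finset.range n, rescale (ζ ^ i) (Lp : PowerSeries ℂ) := by
    rw [← Ideal.mem_span_singleton, ← Ideal.Quotient.eq, map_prod, map_prod]
    refine Finset.prod_congr rfl fun i _ => ?_
    rw [Ideal.Quotient.eq, Ideal.mem_span_singleton]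
    exact hcong i
  have h1 := X_pow_dvd_iff.mp hcong2 M (Nat.lt_succ_self _)
  have hright : coeff M (∏ i ∈ Finset.range n, rescale (ζ ^ i) (Lp : PowerSeries ℂ)) = 0 := by
    have h3 : ∀ i, rescale (ζ ^ i) (Lp : PowerSeries ℂ) = ((Lp.comp (Polynomial.C (ζ ^ i) * Polynomial.X) : Polynomial ℂ) : PowerSeries ℂ) := by
      intro i
      ext m
      rw [coeff_rescale, Polynomial.coeff_coe, Polynomial.coeff_coe, Polynomial.comp_C_mul_X_coeff, mul_comm]
    have h4 : ∏ i ∈ Finset.range n, rescale (ζ ^ i) (Lp : PowerSeries ℂ) =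
        Polynomial.coeToPowerSeries.ringHom (∏ i ∈ Finset.range n, Lp.comp (Polynomial.C (ζ ^ i) * Polynomial.X)) := by
      rw [map_prod]
      exact Finset.prod_congr rfl fun i _ => h3 i
    rw [h4, Polynomial.coeToPowerSeries.ringHom_apply, Polynomial.coeff_coe]
    apply Polynomial.coeff_eq_zero_of_natDegree_lt
    refine lt_of_le_of_lt (Polynomial.natDegree_prod_le _ _) (lt_of_le_of_lt ?_ hM1)
    refine (Finset.sum_le_card_nsmul _ _ n0 ?_).trans (le_of_eq (by simp))
    intro i _
    refine Polynomial.natDegree_comp_le.trans ?_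
    calc _ ≤ n0 * 1 := Nat.mul_le_mul hLdeg ((Polynomial.natDegree_C_mul_le _ _).trans Polynomial.natDegree_X_le)
      _ = n0 := mul_one _
  have hleft : 0 < (coeff M (∏ o ∈ S, (Geo (k o) (1:ℕ)) ^ ((d o).gcd n))) :=
    coeff_prod_pos S k (fun o => (d o).gcd n) (fun o => Nat.gcd_pos_of_pos_left _ (hd o)) ((hS o0).mpr hM2) j
  have hleft2 : ∏ i ∈ Finset.range n, rescale (ζ ^ i) LS = PowerSeries.map (Nat.castRingHom ℂ) (∏ o ∈ S, (Geo (k o) (1:ℕ)) ^ ((d o).gcd n)) := by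
    simp only [LS, map_prod]
    rw [Finset.prod_comm]
    refine Finset.prod_congr rfl fun o _ => ?_
    apply prod_rescale_Geo hn (hd o) hζ
    rw [← hmul]
    exact hψH _ (hH o)
  rw [map_sub, hright, sub_zero, hleft2, coeff_map] at h1
  have h2 : ((coeff M (∏ o ∈ S, (Geo (k o) (1:ℕ)) ^ ((d o).gcd n)) : ℕ) : ℂ) = 0 := h1
  rw [Nat.cast_eq_zero] at h2
  omega

end

end Zeta

end

section
open IntermediateField

section Generic

/-- abstract Herbrand quotient argument -/
lemma herb {A : Type*} [AddCommGroup A] [Finite A] (f g : A →+ A) (hgf : ∀ x, g (f x) = 0)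
    (hfg : ∀ x, f (g x) = 0)
    (h : ∀ x, f x = 0 → ∃ y, g y = x) : ∀ x, g x = 0 → ∃ y, f y = x := by
  have e1 : f.ker = g.range := by
    ext x
    rw [AddMonoidHom.mem_ker, AddMonoidHom.mem_range]
    exact ⟨h x, by rintro ⟨y, rfl⟩; exact hfg y⟩
  have c1 : Nat.card f.ker * Nat.card f.range = Nat.card A := by
    rw [← f.ker.card_mul_index, AddSubgroup.index_ker]
  have c2 : Nat.card g.ker * Nat.card g.range = Nat.card A := by
    rw [← g.ker.card_mul_index, AddSubgroup.index_ker]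
  have hle : f.range ≤ g.ker := by
    rintro _ ⟨y, rfl⟩; exact hgf y
  have hc : Nat.card f.range = Nat.card g.ker := by
    rw [e1, ← c2, mul_comm] at c1
    exact Nat.eq_of_mul_eq_mul_right Nat.card_pos c1
  have e2 : f.range = g.ker := AddSubgroup.eq_of_le_of_card_ge hle hc.ge
  intro x hx
  have : x ∈ g.ker := hx
  rw [← e2] at this
  exact this

variable {F : Type*} [Field F]

/-- norm along a cyclic group of automorphisms -/
def Nm (σ : RingAut F) (n : ℕ) (x : F) : F := ∏ i ∈ Finset.range n, (σ ^ i) x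

lemma Nm_mul (σ : RingAut F) (n : ℕ) (x y : F) : Nm σ n (x * y) = Nm σ n x * Nm σ n y := by
  simp [Nm, Finset.prod_mul_distrib]

lemma Nm_one (σ : RingAut F) (n : ℕ) : Nm σ n 1 = 1 := by simp [Nm]

lemma Nm_inv (σ : RingAut F) (n : ℕ) (x : F) : Nm σ n x⁻¹ = (Nm σ n x)⁻¹ := by
  simp [Nm]

lemma Nm_ne_zero (σ : RingAut F) (n : ℕ) {x : F} (hx : x ≠ 0) : Nm σ n x ≠ 0 := by
  simp only [Nm, Finset.prod_ne_zero_iff]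
  intro i _
  exact (map_ne_zero_iff (σ ^ i) (σ ^ i).injective).mpr hx

@[to_additive]
lemma prod_shift {M : Type*} [CommMonoid M] (f : ℕ → M) (n : ℕ) (h : f n = f 0) :
    ∏ i ∈ Finset.range n, f (i + 1) = ∏ i ∈ Finset.range n, f i := by
  have h1 := Finset.prod_range_succ' f n
  rw [Finset.prod_range_succ] at h1
  rcases n with _ | n
  · simp
  · rw [Finset.prod_range_succ, h, Finset.prod_range_succ' f n]

lemma aut_pow_succ (σ : RingAut F) (i : ℕ) (x : F) : σ ((σ ^ i) x) = (σ ^ (i + 1)) x := by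
  rw [pow_succ']; rfl

lemma aut_pow_succ' (σ : RingAut F) (i : ℕ) (x : F) : (σ ^ i) (σ x) = (σ ^ (i + 1)) x := by
  rw [pow_succ]; rfl

lemma Nm_fixed {σ : RingAut F} {n : ℕ} (hσ : σ ^ n = 1) (x : F) : σ (Nm σ n x) = Nm σ n x := by
  simp only [Nm, map_prod, aut_pow_succ]
  exact prod_shift (fun i => (σ ^ i) x) n (by simp [hσ])

lemma Nm_aut {σ : RingAut F} {n : ℕ} (hσ : σ ^ n = 1) (x : F) : Nm σ n (σ x) = Nm σ n x := by
  simp only [Nm, aut_pow_succ']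
  exact prod_shift (fun i => (σ ^ i) x) n (by simp [hσ])

lemma hilbert90 {σ : RingAut F} {n : ℕ} (hn : 0 < n) (hσ : σ ^ n = 1) {θ : F} (hθ : ∀ i, 0 < i → i < n → (σ ^ i) θ ≠ θ)
    {x : F} (hx : Nm σ n x = 1) : ∃ y, y ≠ 0 ∧ x * σ y = y := by
  let P : ℕ → F := fun i => ∏ j ∈ Finset.range i, (σ ^ j) x
  have hinj : Function.Injective (fun i : Fin n => ((σ ^ (i:ℕ) : RingAut F) : F →* F)) := by
    have key : ∀ i j : Fin n, i < j → ((σ ^ (i:ℕ) : RingAut F) : F →* F) ≠ ((σ ^ (j:ℕ) : RingAut F) : F →* F) := by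
      intro i j hij h
      have h1 : (σ ^ (i:ℕ)) θ = (σ ^ (j:ℕ)) θ := DFunLike.congr_fun h θ
      have h2 : (j:ℕ) = i + (j - i) := by have : (i:ℕ) < j := hij; omega
      rw [h2, pow_add] at h1
      have h3 := (σ ^ (i:ℕ)).injective h1
      exact hθ (j - i) (by have : (i:ℕ) < j := hij; omega) (by omega) h3.symm
    intro i j h
    rcases lt_trichotomy i j with h1 | h1 | h1
    · exact absurd h (key i j h1)
    · exact h1
    · exact absurd h.symm (key j i h1)
  have hli := (linearIndependent_monoidHom F F).comp _ hinj
  rw [Fintype.linearIndependent_iff] at hli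
  have hx0 : x ≠ 0 := by
    rintro rfl
    rw [Nm, Finset.prod_eq_zero (Finset.mem_range.mpr hn) (by simp)] at hx
    exact zero_ne_one hx
  have hex : ∃ t, ∑ i ∈ Finset.range n, P i * (σ ^ i) t ≠ 0 := by
    by_contra hcon
    push Not at hcon
    have := hli (fun i => P i) (by
      ext t
      have h1 := hcon t
      rw [Finset.sum_range] at h1
      simpa using h1) ⟨0, hn⟩
    simp [P] at this
  obtain ⟨t, ht⟩ := hex
  refine ⟨_, ht, ?_⟩
  rw [map_sum, Finset.mul_sum]
  have h1 : ∀ i, x * σ (P i * (σ ^ i) t) = P (i + 1) * (σ ^ (i + 1)) t := by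
    intro i
    rw [map_mul, aut_pow_succ, ← mul_assoc]
    congr 1
    simp only [P, map_prod, aut_pow_succ]
    rw [Finset.prod_range_succ' _ i]
    simp [mul_comm]
  simp_rw [h1]
  refine sum_shift (fun i => P i * (σ ^ i) t) n ?_
  have h2 : P n = 1 := hx
  have h3 : P 0 = 1 := Finset.prod_range_zero _
  simp only [h2, h3, hσ, pow_zero]

end Generic

section
variable {E : Type} [Field E]

instance : MulAction (RingAut E) (FFPrime E) where
  smul τ W :=
    { ord := fun x => W.ord (τ⁻¹ x)
      ord_zero := by rw [map_zero]; exact W.ord_zero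
      ord_ne_top := fun x hx => W.ord_ne_top _ (by simpa using hx)
      ord_one := by rw [map_one]; exact W.ord_one
      ord_mul := fun x y => by rw [map_mul]; exact W.ord_mul _ _
      ord_add := fun x y => by rw [map_add]; exact W.ord_add _ _
      ord_surj := fun n => by
        obtain ⟨x, hx⟩ := W.ord_surj n
        exact ⟨τ x, by rw [← hx]; congr 1; exact τ.symm_apply_apply x⟩ }
  one_smul W := rfl
  mul_smul τ τ' W := by
    apply FFPrime.ext_o
    intro x _
    change W.o ((τ * τ')⁻¹ x) = W.o (τ'⁻¹ (τ⁻¹ x))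
    rw [mul_inv_rev]; rfl

lemma FFPrime.smul_o (τ : RingAut E) (W : FFPrime E) (x : E) : (τ • W).o x = W.o (τ⁻¹ x) := rfl

lemma FFPrime.smul_o' (τ : RingAut E) (W : FFPrime E) (x : E) : (τ • W).o (τ x) = W.o x := by
  rw [FFPrime.smul_o]; congr 1; exact τ.symm_apply_apply x

lemma FFPrime.smul_M (τ : RingAut E) (W : FFPrime E) (x : E) (k : ℤ) : τ x ∈ (τ • W).M k ↔ x ∈ W.M k := by
  by_cases hx : x = 0
  · subst hx; simp
  · rw [FFPrime.mem_M _ hx, FFPrime.mem_M _ (by simpa using hx), FFPrime.smul_o']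

variable {p : ℕ} [Fact p.Prime] [Algebra (ZMod p) E]

lemma FFPrime.smul_deg (hE : IsFF p E) (τ : RingAut E) (W : FFPrime E) : (τ • W).deg p = W.deg p := by
  classical
  have h1 := FFPrime.finite_κ hE W
  have h2 : (τ • W).HasResidueCard (Nat.card W.κ) := by
    obtain ⟨s, hs, ha, hb, hc⟩ := W.hasResidueCard_card
    refine ⟨s.image τ, ?_, ?_, ?_, ?_⟩
    · rw [Finset.card_image_of_injective _ τ.injective, hs]
    · intro x hx
      obtain ⟨y, hy, rfl⟩ := Finset.mem_image.mp hx
      have := ha y hy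
      change 0 ≤ W.ord (τ.symm (τ y))
      rwa [RingEquiv.symm_apply_apply]
    · intro x hx x' hx' hne
      obtain ⟨y, hy, rfl⟩ := Finset.mem_image.mp hx
      obtain ⟨y', hy', rfl⟩ := Finset.mem_image.mp hx'
      change ¬ 0 < W.ord (τ.symm (τ y - τ y'))
      rw [← map_sub, RingEquiv.symm_apply_apply]
      exact hb y hy y' hy' (fun h => hne (by rw [h]))
    · intro z hz
      obtain ⟨x, hx, hx2⟩ := hc (τ.symm z) hz
      refine ⟨τ x, Finset.mem_image_of_mem _ hx, ?_⟩
      change 0 < W.ord (τ.symm (z - τ x))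
      rw [map_sub, RingEquiv.symm_apply_apply]
      exact hx2
  have h3 := FFPrime.card_of_hasResidueCard _ h2
  rw [FFPrime.card_κ hE, FFPrime.card_κ hE] at h3
  exact Nat.pow_right_injective (Fact.out : p.Prime).two_le h3

/-- action on divisors -/
def Sd (τ : RingAut E) : Dv E →+ Dv E := Finsupp.mapDomain.addMonoidHom (τ • ·)

lemma Sd_single (τ : RingAut E) (W : FFPrime E) (k : ℤ) : Sd τ (Finsupp.single W k) = Finsupp.single (τ • W) k := by
  simp [Sd]

lemma Sd_apply (τ : RingAut E) (D : Dv E) (W : FFPrime E) : Sd τ D W = D (τ⁻¹ • W) := by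
  have := Finsupp.mapDomain_apply (MulAction.injective τ) D (τ⁻¹ • W)
  rw [smul_inv_smul] at this
  exact this

lemma Sd_mul (τ τ' : RingAut E) (D : Dv E) : Sd (τ * τ') D = Sd τ (Sd τ' D) := by
  ext W
  rw [Sd_apply, Sd_apply, Sd_apply, mul_inv_rev, mul_smul]

lemma Sd_one (D : Dv E) : Sd 1 D = D := by
  ext W; rw [Sd_apply]; simp

lemma dv_aut (hE : IsFF p E) (τ : RingAut E) (x : E) : dv hE (τ x) = Sd τ (dv hE x) := by
  ext W
  rw [Sd_apply, dv_apply, dv_apply, FFPrime.smul_o, inv_inv]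

lemma dg_Sd (hE : IsFF p E) (τ : RingAut E) (D : Dv E) : dg p (Sd τ D) = dg p D := by
  have : (dg p).comp (Sd τ) = dg (E := E) p := by
    ext W
    simp [Sd_single, FFPrime.smul_deg hE]
  exact DFunLike.congr_fun this D

/-- norm on divisors -/
def Nd (σ : RingAut E) (n : ℕ) : Dv E →+ Dv E := ∑ i ∈ Finset.range n, Sd (σ ^ i)

lemma Nd_apply (σ : RingAut E) (n : ℕ) (D : Dv E) : Nd σ n D = ∑ i ∈ Finset.range n, Sd (σ ^ i) D := by
  simp [Nd]

lemma Sd_Nd {σ : RingAut E} {n : ℕ} (hσ : σ ^ n = 1) (D : Dv E) : Sd σ (Nd σ n D) = Nd σ n D := by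
  simp only [Nd_apply, map_sum, ← Sd_mul, ← pow_succ']
  exact sum_shift (fun i => Sd (σ ^ i) D) n (by simp [hσ])

lemma Nd_Sd {σ : RingAut E} {n : ℕ} (hσ : σ ^ n = 1) (D : Dv E) : Nd σ n (Sd σ D) = Nd σ n D := by
  simp only [Nd_apply, ← Sd_mul, ← pow_succ]
  exact sum_shift (fun i => Sd (σ ^ i) D) n (by simp [hσ])

lemma Sd_pow_of_fixed {σ : RingAut E} {D : Dv E} (h : Sd σ D = D) (i : ℕ) : Sd (σ ^ i) D = D := by
  induction i with
  | zero => simp [Sd_one]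
  | succ i ih => rw [pow_succ, Sd_mul, h, ih]

lemma Nd_of_fixed {σ : RingAut E} {n : ℕ} {D : Dv E} (h : Sd σ D = D) : Nd σ n D = n • D := by
  rw [Nd_apply, Finset.sum_congr rfl (fun i _ => Sd_pow_of_fixed h i)]
  simp

lemma dg_Nd (hE : IsFF p E) (σ : RingAut E) (n : ℕ) (D : Dv E) : dg p (Nd σ n D) = n * dg p D := by
  rw [Nd_apply, map_sum, Finset.sum_congr rfl (fun i _ => dg_Sd hE _ D)]
  simp

lemma dv_Nm (hE : IsFF p E) (σ : RingAut E) (n : ℕ) {x : E} (hx : x ≠ 0) : dv hE (Nm σ n x) = Nd σ n (dv hE x) := by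
  induction n with
  | zero => simp [Nm, Nd, dv_one]
  | succ n ih =>
    have h1 : Nm σ (n + 1) x = Nm σ n x * (σ ^ n) x := by simp [Nm, Finset.prod_range_succ]
    rw [h1, dv_mul hE (Nm_ne_zero _ _ hx) ((map_ne_zero_iff (σ ^ n) (σ ^ n).injective).mpr hx), ih, dv_aut, Nd_apply, Nd_apply, Finset.sum_range_succ]

end

end

section
open IntermediateField

section
variable {p : ℕ} [Fact p.Prime] {E : Type} [Field E] [Algebra (ZMod p) E]

variable (p) in
/-- degree of the constant `θ` -/
def degθ (θ : E) : ℕ := Module.finrank (ZMod p) (adjoin (ZMod p) {θ})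

lemma degθ_pos {θ : E} (hθ : IsAlgebraic (ZMod p) θ) : 0 < degθ p θ := by
  have := adjoin.finiteDimensional hθ.isIntegral
  exact Module.finrank_pos

lemma degθ_pow {θ : E} (hθ : IsAlgebraic (ZMod p) θ) {m : ℕ} (hm : degθ p θ ∣ m) : θ ^ (p ^ m) = θ := by
  have hfd := adjoin.finiteDimensional hθ.isIntegral
  have hfin : Finite (adjoin (ZMod p) {θ}) := Module.finite_of_finite (ZMod p)
  have := Fintype.ofFinite (adjoin (ZMod p) {θ})
  obtain ⟨k, rfl⟩ := hm
  have h1 : Fintype.card (adjoin (ZMod p) {θ}) = p ^ degθ p θ := by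
    rw [Module.card_eq_pow_finrank (K := ZMod p), ZMod.card]; rfl
  have h2 := FiniteField.pow_card_pow k (AdjoinSimple.gen (ZMod p) θ)
  rw [h1, ← pow_mul] at h2
  have h3 := congrArg (algebraMap _ E) h2
  rwa [map_pow, AdjoinSimple.algebraMap_gen] at h3

lemma mem_M0_of_alg (w : FFPrime E) {x : E} (hx : IsAlgebraic (ZMod p) x) : x ∈ w.M 0 := by
  rw [w.mem_M_iff]; right; rw [w.o_alg hx]

lemma degθ_dvd (hE : IsFF p E) {θ : E} (hθ : IsAlgebraic (ZMod p) θ) (w : FFPrime E) : degθ p θ ∣ w.deg p := by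
  have hfd := adjoin.finiteDimensional hθ.isIntegral
  let φ : adjoin (ZMod p) {θ} →+* w.O :=
    (algebraMap (adjoin (ZMod p) {θ}) E).codRestrict w.O (fun x => by
      rw [FFPrime.mem_O]
      apply mem_M0_of_alg (p := p)
      exact (Algebra.IsAlgebraic.isAlgebraic (R := ZMod p) x).algebraMap)
  let _ : Algebra (adjoin (ZMod p) {θ}) w.κ := (w.res.comp φ).toAlgebra
  have : IsScalarTower (ZMod p) (adjoin (ZMod p) {θ}) w.κ := IsScalarTower.of_algebraMap_eq' (RingHom.ext_zmod _ _)
  exact ⟨_, (Module.finrank_mul_finrank (ZMod p) (adjoin (ZMod p) {θ}) w.κ).symm⟩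

/-- stabilizers act on residue fields as powers of Frobenius -/
lemma stab_frob (hE : IsFF p E) {τ : RingAut E} {w : FFPrime E} (h : τ • w = w) :
    ∃ s : ℕ, (∀ x ∈ w.M 0, ∀ f : ℕ, (τ ^ f) x - x ^ (p ^ (s * f)) ∈ w.M 1) ∧ ∀ f, τ ^ f = 1 → w.deg p ∣ s * f := by
  have hfin := FFPrime.finite_κ hE w
  have hM : ∀ k x, τ x ∈ w.M k ↔ x ∈ w.M k := by
    intro k x
    have := FFPrime.smul_M τ w x k
    rwa [h] at this
  let φ : w.O →+* w.O := ((τ : E →+* E).comp w.O.subtype).codRestrict w.O (fun x => by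
    rw [FFPrime.mem_O]
    exact (hM 0 x).mpr (FFPrime.mem_O.mp x.2))
  have hφ : ∀ x : w.O, (φ x : E) = τ x := fun x => rfl
  let ψ : w.κ →+* w.κ := w.res.liftOfSurjective w.res_surj ⟨w.res.comp φ, by
    intro x hx
    rw [RingHom.mem_ker] at hx ⊢
    rw [RingHom.comp_apply, FFPrime.res_eq_zero, hφ, hM]
    exact (FFPrime.res_eq_zero _).mp hx⟩
  have hψ : ∀ x, ψ (w.res x) = w.res (φ x) := fun x => RingHom.liftOfRightInverse_comp_apply _ _ _ _ x
  let ψa : w.κ →ₐ[ZMod p] w.κ := { ψ with commutes' := fun a => RingHom.congr_fun (RingHom.ext_zmod (ψ.comp (algebraMap (ZMod p) w.κ)) (algebraMap (ZMod p) w.κ)) a }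
  have hbij : Function.Bijective ψa := Finite.injective_iff_bijective.mp ψ.injective
  let ψe : w.κ ≃ₐ[ZMod p] w.κ := AlgEquiv.ofBijective ψa hbij
  obtain ⟨s, hs⟩ := (FiniteField.bijective_frobeniusAlgEquivOfAlgebraic_pow (ZMod p) w.κ).2 ψe
  have hs : FiniteField.frobeniusAlgEquivOfAlgebraic (ZMod p) w.κ ^ (s:ℕ) = ψe := hs
  have hpow : ∀ f (x : w.O), (ψe ^ f) (w.res x) = w.res ((φ ^ f) x) := by
    intro f
    induction f with
    | zero => intro x; rfl
    | succ f ih =>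
      intro x
      rw [pow_succ', pow_succ']
      change ψ ((ψe ^ f) (w.res x)) = _
      rw [ih, hψ]
      rfl
  have hφpow : ∀ f (x : w.O), ((φ ^ f) x : E) = (τ ^ f) x := by
    intro f
    induction f with
    | zero => intro x; rfl
    | succ f ih =>
      intro x
      rw [pow_succ', pow_succ']
      change τ ((φ ^ f) x : E) = τ ((τ ^ f) (x:E))
      rw [ih]
  refine ⟨s, ?_, ?_⟩
  · intro x hx f
    have h1 := hpow f ⟨x, FFPrime.mem_O.mpr hx⟩
    rw [← hs, ← pow_mul, AlgEquiv.coe_pow, FiniteField.coe_frobeniusAlgEquivOfAlgebraic_iterate, ZMod.card] at h1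
    simp only [← map_pow] at h1
    have h2 := (FFPrime.res_eq _).mp h1
    rw [hφpow] at h2
    rw [← neg_mem_iff, neg_sub]
    exact h2
  · intro f hf
    have h1 : ψe ^ f = 1 := by
      ext y
      obtain ⟨x, rfl⟩ := w.res_surj y
      rw [hpow]
      change w.res ((φ ^ f) x) = w.res x
      congr 1
      apply Subtype.ext
      rw [hφpow, hf]; rfl
    rw [← hs, ← pow_mul, ← orderOf_dvd_iff_pow_eq_one, FiniteField.orderOf_frobeniusAlgEquivOfAlgebraic] at h1
    exact h1

/-- the crucial coprimality -/
lemma gcd_period (hE : IsFF p E) {σ : RingAut E} {n : ℕ} (hn : 0 < n) (hσ : σ ^ n = 1) {θ : E}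
    (hθa : IsAlgebraic (ZMod p) θ) (hθ : ∀ i, 0 < i → i < n → (σ ^ i) θ ≠ θ) (w : FFPrime E) {r : ℕ} (hr : r ∣ n)
    (hrw : σ ^ r • w = w) : (r * (w.deg p / degθ p θ)).gcd n = r := by
  obtain ⟨f, rfl⟩ := hr
  rw [Nat.gcd_mul_left]
  suffices h : (w.deg p / degθ p θ).gcd f = 1 by rw [h, mul_one]
  by_contra hne
  obtain ⟨l, hl, hdvd⟩ := Nat.exists_prime_and_dvd hne
  obtain ⟨f', rfl⟩ := hdvd.trans (Nat.gcd_dvd_right _ _)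
  have hl1 := hdvd.trans (Nat.gcd_dvd_left _ _)
  obtain ⟨s, hs1, hs2⟩ := stab_frob hE hrw
  have h1 := hs2 (l * f') (by rw [← pow_mul, hσ])
  have h2 : degθ p θ * l ∣ w.deg p := by
    rw [← Nat.mul_div_cancel' (degθ_dvd hE hθa w)]
    exact mul_dvd_mul_left _ hl1
  have h3 : degθ p θ ∣ s * f' := by
    have := h2.trans h1
    rw [mul_left_comm, mul_comm] at this
    exact (Nat.mul_dvd_mul_iff_left hl.pos).mp this
  have h4 := hs1 θ (mem_M0_of_alg w hθa) f'
  rw [degθ_pow hθa h3, ← pow_mul] at h4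
  have hf' : 0 < f' := by
    rcases Nat.eq_zero_or_pos f' with rfl | h
    · simp at hn
    · exact h
  have hr0 : 0 < r := by
    rcases Nat.eq_zero_or_pos r with rfl | h
    · simp at hn
    · exact h
  have h5 : IsAlgebraic (ZMod p) ((σ ^ (r * f')) θ - θ) := by
    refine IsAlgebraic.sub ?_ hθa
    let a : E →ₐ[ZMod p] E := { ((σ ^ (r * f') : RingAut E) : E →+* E) with commutes' := fun a => RingHom.congr_fun (RingHom.ext_zmod (((σ ^ (r * f') : RingAut E) : E →+* E).comp (algebraMap (ZMod p) E)) (algebraMap (ZMod p) E)) a }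
    exact hθa.algHom a
  have h6 : (σ ^ (r * f')) θ - θ ≠ 0 := by
    rw [sub_ne_zero]
    apply hθ _ (by positivity)
    have := hl.two_le
    have h7 : 0 < r * f' := by positivity
    nlinarith
  rw [w.mem_M h6, w.o_alg h5] at h4
  omega

end

end

section
open IntermediateField

section
variable {p : ℕ} [Fact p.Prime] {E : Type} [Field E] [Algebra (ZMod p) E]

lemma alg_aut (τ : RingAut E) {x : E} (hx : IsAlgebraic (ZMod p) x) : IsAlgebraic (ZMod p) (τ x) := by
  let a : E →ₐ[ZMod p] E := { (τ : E →+* E) with commutes' := fun a => RingHom.congr_fun (RingHom.ext_zmod ((τ : E →+* E).comp (algebraMap (ZMod p) E)) (algebraMap (ZMod p) E)) a }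
  exact hx.algHom a

lemma conj_inj {F : Type*} [Field F] {σ : RingAut F} {n : ℕ} {θ : F} (hθ : ∀ i, 0 < i → i < n → (σ ^ i) θ ≠ θ) :
    Function.Injective (fun i : Fin n => (σ ^ (i:ℕ)) θ) := by
  have key : ∀ i j : Fin n, i < j → (σ ^ (i:ℕ)) θ ≠ (σ ^ (j:ℕ)) θ := by
    intro i j hij h1
    have h2 : (j:ℕ) = i + (j - i) := by have : (i:ℕ) < j := hij; omega
    rw [h2, pow_add] at h1
    have h3 := (σ ^ (i:ℕ)).injective h1
    exact hθ (j - i) (by have : (i:ℕ) < j := hij; omega) (by omega) h3.symm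
  intro i j h
  rcases lt_trichotomy i j with h1 | h1 | h1
  · exact absurd h (key i j h1)
  · exact h1
  · exact absurd h.symm (key j i h1)

/-- Galois descent for constant field extensions, cardinality version -/
lemma card_descent {σ : RingAut E} {n : ℕ} (hn : 0 < n) (hσ : σ ^ n = 1) {θ : E}
    (hθa : IsAlgebraic (ZMod p) θ) (hθ : ∀ i, 0 < i → i < n → (σ ^ i) θ ≠ θ)
    (V : AddSubgroup E) (hVσ : ∀ x ∈ V, σ x ∈ V) (hVk : ∀ a x, IsAlgebraic (ZMod p) a → x ∈ V → a * x ∈ V) :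
    Nat.card V = Nat.card {x : E // x ∈ V ∧ σ x = x} ^ n := by
  classical
  have hfix : ∀ i x, σ x = x → (σ ^ i) x = x := by
    intro i x hx
    induction i with
    | zero => rfl
    | succ i ih => rw [← aut_pow_succ, ih, hx]
  have hVσi : ∀ i, ∀ x ∈ V, (σ ^ i) x ∈ V := by
    intro i x hx
    induction i with
    | zero => exact hx
    | succ i ih => rw [← aut_pow_succ]; exact hVσ _ ih
  let k := algebraicClosure (ZMod p) E
  let t : Fin n → k := fun i => ⟨(σ ^ (i:ℕ)) θ, mem_algebraicClosure_iff.mpr (alg_aut _ hθa)⟩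
  let M : Matrix (Fin n) (Fin n) k := Matrix.vandermonde t
  have hM : M.det ≠ 0 := Matrix.det_vandermonde_ne_zero_iff.mpr (by
    intro i j h
    exact conj_inj hθ (congrArg Subtype.val h))
  let ME : Matrix (Fin n) (Fin n) E := M.map (algebraMap k E)
  let BE : Matrix (Fin n) (Fin n) E := (M⁻¹).map (algebraMap k E)
  have hMB : ME * BE = 1 := by
    rw [← Matrix.map_mul, Matrix.mul_nonsing_inv _ hM.isUnit, Matrix.map_one _ (map_zero _) (map_one _)]
  have hBM : BE * ME = 1 := by
    rw [← Matrix.map_mul, Matrix.nonsing_inv_mul _ hM.isUnit, Matrix.map_one _ (map_zero _) (map_one _)]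
  have hME : ∀ i j, ME i j = ((σ ^ (i:ℕ)) θ) ^ (j:ℕ) := fun i j => by
    simp [ME, M, Matrix.vandermonde, t]
  have hinj : ∀ v v' : Fin n → E, ME.mulVec v = ME.mulVec v' → v = v' := by
    intro v v' h
    have := congrArg BE.mulVec h
    rwa [Matrix.mulVec_mulVec, Matrix.mulVec_mulVec, hBM, Matrix.one_mulVec, Matrix.one_mulVec] at this
  have hMv : ∀ v i, ME.mulVec v i = ∑ j : Fin n, ((σ ^ (i:ℕ)) θ) ^ (j:ℕ) * v j := by
    intro v i
    simp only [Matrix.mulVec, dotProduct, hME]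
  let Φ : (Fin n → {x : E // x ∈ V ∧ σ x = x}) → V := fun v =>
    ⟨∑ j : Fin n, θ ^ (j:ℕ) * (v j : E), sum_mem fun j _ => hVk _ _ (hθa.pow _) (v j).2.1⟩
  have hΦ : Function.Bijective Φ := by
    constructor
    · intro v v' h
      have h := congrArg Subtype.val h
      have h : ∑ j : Fin n, θ ^ (j:ℕ) * (v j : E) = ∑ j : Fin n, θ ^ (j:ℕ) * (v' j : E) := h
      have := hinj (fun j => v j) (fun j => v' j) (by
        ext i
        rw [hMv, hMv]
        have h1 := congrArg (σ ^ (i:ℕ)) h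
        rw [map_sum, map_sum] at h1
        simpa only [map_mul, map_pow, hfix i _ (v _).2.2, hfix i _ (v' _).2.2] using h1)
      ext j
      exact congrFun this j
    · rintro ⟨u, hu⟩
      let w : Fin n → E := fun i => (σ ^ (i:ℕ)) u
      let v := BE.mulVec w
      have hv : ME.mulVec v = w := by
        simp only [v]
        rw [Matrix.mulVec_mulVec, hMB, Matrix.one_mulVec]
      have hv' : ∀ i : ℕ, i < n → ∑ j : Fin n, ((σ ^ i) θ) ^ (j:ℕ) * v j = (σ ^ i) u := by
        intro i hi
        have := congrFun hv ⟨i, hi⟩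
        rw [hMv] at this
        exact this
      have hσv : (fun j => σ (v j)) = v := by
        apply hinj
        rw [hv]
        ext i
        rw [hMv]
        obtain ⟨i', hi', hi2⟩ : ∃ i' < n, σ ^ (i' + 1) = σ ^ (i:ℕ) := by
          by_cases h0 : (i:ℕ) = 0
          · exact ⟨n - 1, by omega, by rw [Nat.sub_add_cancel hn, hσ, h0, pow_zero]⟩
          · exact ⟨i - 1, by omega, by rw [Nat.sub_add_cancel (by omega)]⟩
        have h1 := congrArg σ (hv' i' hi')
        rw [map_sum, aut_pow_succ, hi2] at h1
        simp only [map_mul, map_pow, aut_pow_succ, hi2] at h1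
        exact h1
      have hvV : ∀ j, v j ∈ V := by
        intro j
        simp only [v, Matrix.mulVec, dotProduct]
        refine sum_mem fun i _ => hVk _ _ ?_ (hVσi _ _ hu)
        exact mem_algebraicClosure_iff.mp (M⁻¹ j i).2
      refine ⟨fun j => ⟨v j, hvV j, congrFun hσv j⟩, ?_⟩
      apply Subtype.ext
      have := hv' 0 hn
      simpa using this
  rw [← Nat.card_congr (Equiv.ofBijective Φ hΦ), Nat.card_fun, Nat.card_eq_fintype_card (α := Fin n), Fintype.card_fin]

end

end

section
open IntermediateField

section
variable {E : Type} [Field E]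

/-- orbits of places under a finite cyclic group -/
def orb (σ : RingAut E) (n : ℕ) (hn : 0 < n) (hσ : σ ^ n = 1) : Setoid (FFPrime E) where
  r W W' := ∃ i : ℕ, σ ^ i • W = W'
  iseqv := by
    refine ⟨fun W => ⟨0, by simp⟩, ?_, ?_⟩
    · rintro W _ ⟨i, rfl⟩
      refine ⟨n * i - i, ?_⟩
      rw [← mul_smul, ← pow_add, Nat.sub_add_cancel (Nat.le_mul_of_pos_left _ hn), pow_mul, hσ]
      simp
    · rintro W _ _ ⟨i, rfl⟩ ⟨j, rfl⟩
      exact ⟨j + i, by rw [pow_add, mul_smul]⟩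

/-- orbit length -/
def per (σ : RingAut E) (W : FFPrime E) : ℕ := Function.minimalPeriod (σ • ·) W

lemma iter_smul (σ : RingAut E) (W : FFPrime E) (i : ℕ) : (fun W : FFPrime E => σ • W)^[i] W = σ ^ i • W := by
  rw [smul_iterate]

variable {σ : RingAut E} {n : ℕ} (hn : 0 < n) (hσ : σ ^ n = 1)

include hσ in
lemma per_dvd (W : FFPrime E) : per σ W ∣ n := by
  apply Function.IsPeriodicPt.minimalPeriod_dvd
  change _ ^[n] W = W
  rw [iter_smul, hσ, one_smul]

include hn hσ in
lemma per_pos (W : FFPrime E) : 0 < per σ W := Nat.pos_of_dvd_of_pos (per_dvd hσ W) hn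

lemma per_smul (W : FFPrime E) : σ ^ per σ W • W = W := by
  rw [← iter_smul]
  exact Function.iterate_minimalPeriod

/-- the orbit type -/
abbrev Om := Quotient (orb σ n hn hσ)

/-- the divisor of an orbit -/
def jz (o : Om hn hσ) : Dv E := ∑ i ∈ Finset.range (per σ o.out), Finsupp.single (σ ^ i • o.out) 1

open Classical in
lemma jz_apply (o : Om hn hσ) (W : FFPrime E) : jz hn hσ o W = if (Quotient.mk _ W : Om hn hσ) = o then 1 else 0 := by
  rw [jz, Finsupp.finsetSum_apply]
  split_ifs with h
  · have h1 : (orb σ n hn hσ).r o.out W := Quotient.exact (s := orb σ n hn hσ) (by rw [Quotient.out_eq, h])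
    obtain ⟨k, hk⟩ := h1
    have hr := per_pos hn hσ o.out
    have hk2 : σ ^ (k % per σ o.out) • o.out = W := by
      rw [← iter_smul, per, Function.iterate_mod_minimalPeriod_eq, iter_smul, hk]
    rw [Finset.sum_eq_single (k % per σ o.out)]
    · rw [hk2, Finsupp.single_eq_same]
    · intro i hi hne
      rw [Finsupp.single_apply, if_neg]
      intro h2
      apply hne
      apply Function.iterate_injOn_Iio_minimalPeriod (f := (σ • ·)) (x := o.out)
      · exact Finset.mem_range.mp hi
      · exact Nat.mod_lt _ hr
      · simp only [iter_smul]
        rw [h2, hk2]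
    · intro h2
      exact absurd (Finset.mem_range.mpr (Nat.mod_lt _ hr)) h2
  · apply Finset.sum_eq_zero
    intro i _
    rw [Finsupp.single_apply, if_neg]
    intro h2
    apply h
    rw [← Quotient.out_eq o]
    apply Quotient.sound
    exact (orb σ n hn hσ).symm ⟨i, h2⟩

/-- pullback of divisors from the quotient -/
def jj : (Om hn hσ →₀ ℤ) →+ Dv E := Finsupp.liftAddHom fun o => zmultiplesHom _ (jz hn hσ o)

lemma jj_single (o : Om hn hσ) (k : ℤ) : jj hn hσ (Finsupp.single o k) = k • jz hn hσ o := by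
  simp [jj]

lemma jj_apply (D : Om hn hσ →₀ ℤ) (W : FFPrime E) : jj hn hσ D W = D (Quotient.mk _ W) := by
  classical
  have : (Finsupp.applyAddHom W).comp (jj hn hσ) = Finsupp.applyAddHom (Quotient.mk _ W) := by
    apply Finsupp.addHom_ext
    intro o k
    rw [AddMonoidHom.comp_apply, jj_single]
    simp only [Finsupp.applyAddHom_apply, Finsupp.smul_apply, jz_apply, Finsupp.single_apply, eq_comm (a := o)]
    split_ifs <;> simp
  exact DFunLike.congr_fun this D

lemma jj_inj : Function.Injective (jj hn hσ) := by
  intro D D' h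
  ext o
  induction o using Quotient.inductionOn with
  | _ W => rw [← jj_apply, ← jj_apply, h]

lemma Sd_jj (D : Om hn hσ →₀ ℤ) : Sd σ (jj hn hσ D) = jj hn hσ D := by
  ext W
  rw [Sd_apply, jj_apply, jj_apply]
  congr 1
  apply Quotient.sound
  exact ⟨1, by simp⟩

lemma jj_surj {D : Dv E} (h : Sd σ D = D) : ∃ B, jj hn hσ B = D ∧ ∀ o : Om hn hσ, B o = D o.out := by
  refine ⟨D.comapDomain Quotient.out (Quotient.out_injective.injOn), ?_, fun o => rfl⟩
  ext W
  rw [jj_apply, Finsupp.comapDomain_apply]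
  obtain ⟨i, hi⟩ := (orb σ n hn hσ).symm (Quotient.mk_out (s := orb σ n hn hσ) W)
  rw [← hi]
  conv_lhs => rw [← Sd_pow_of_fixed h i]
  rw [Sd_apply, inv_smul_smul]

lemma Nd_single (W : FFPrime E) : Nd σ n (Finsupp.single W 1) = ∑ i ∈ Finset.range n, Finsupp.single (σ ^ i • W) (1:ℤ) := by
  rw [Nd_apply]
  exact Finset.sum_congr rfl fun i _ => Sd_single _ _ _

include hσ in
lemma Nd_out' (W : FFPrime E) : Nd σ n (Finsupp.single W 1) = (n / per σ W) • ∑ i ∈ Finset.range (per σ W), Finsupp.single (σ ^ i • W) (1:ℤ) := by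
  rw [Nd_single]
  conv_lhs => rw [← Nat.mul_div_cancel' (per_dvd hσ W)]
  rw [sum_periodic _ (per σ W)]
  intro i
  rw [pow_add, mul_smul, per_smul]

lemma Nd_out (o : Om hn hσ) : Nd σ n (Finsupp.single o.out 1) = (n / per σ o.out) • jz hn hσ o := by
  exact Nd_out' hσ o.out

variable {p : ℕ} [Fact p.Prime] [Algebra (ZMod p) E]

/-- degree of an orbit -/
def dO (p : ℕ) [Fact p.Prime] [Algebra (ZMod p) E] (θ : E) (o : Om hn hσ) : ℕ :=
  per σ o.out * (o.out.deg p / degθ p θ)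

/-- divisors of fixed functions -/
def PrL (hE : IsFF p E) (σ : RingAut E) : AddSubgroup (Dv E) where
  carrier := {D | ∃ f : E, f ≠ 0 ∧ σ f = f ∧ dv hE f = D}
  zero_mem' := ⟨1, one_ne_zero, map_one _, dv_one hE⟩
  add_mem' := by
    rintro _ _ ⟨f, hf, hf2, rfl⟩ ⟨g, hg, hg2, rfl⟩
    exact ⟨f * g, mul_ne_zero hf hg, by rw [map_mul, hf2, hg2], dv_mul hE hf hg⟩
  neg_mem' := by
    rintro _ ⟨f, hf, hf2, rfl⟩
    exact ⟨f⁻¹, inv_ne_zero hf, by rw [map_inv₀, hf2], dv_inv hE f⟩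

lemma alg_of_dv_zero (hE : IsFF p E) {x : E} (h : dv hE x = 0) : IsAlgebraic (ZMod p) x := by
  apply isAlgebraic_of_o_nonneg hE
  intro w
  rw [← dv_apply hE, h]; simp

lemma dv_alg (hE : IsFF p E) {x : E} (h : IsAlgebraic (ZMod p) x) : dv hE x = 0 := by
  ext w
  rw [dv_apply, w.o_alg h]; rfl

/-- constants fixed by `σ` -/
def UL (p : ℕ) [Fact p.Prime] [Algebra (ZMod p) E] (σ : RingAut E) : Type := {u : E // u ≠ 0 ∧ IsAlgebraic (ZMod p) u ∧ σ u = u}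

lemma UL_finite (hE : IsFF p E) : Finite (UL p σ) := by
  have h1 := RL_fin hE (0 : Dv E)
  have h2 : Finite (RL p (0 : Dv E)) := Module.finite_of_finite (ZMod p)
  refine Finite.of_injective (fun u : UL p σ => (⟨u.1, by
    rw [mem_RL]; intro w; simpa using mem_M0_of_alg w u.2.2.1⟩ : RL p (0 : Dv E))) ?_
  intro u u' h
  exact Subtype.ext (congrArg (fun z : RL p (0 : Dv E) => (z : E)) h)

instance : Nonempty (UL p σ) := ⟨⟨1, one_ne_zero, isAlgebraic_one, map_one _⟩⟩

lemma card_eff (hE : IsFF p E) (D : Om hn hσ →₀ ℤ) :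
    Nat.card {A : Om hn hσ →₀ ℕ // iota _ A - D ∈ (PrL hE σ).comap (jj hn hσ)} * Nat.card (UL p σ) =
    Nat.card {x : E // x ∈ (RL p (jj hn hσ D)).toAddSubgroup ∧ σ x = x} - 1 := by
  classical
  set Y := {A : Om hn hσ →₀ ℕ // iota _ A - D ∈ (PrL hE σ).comap (jj hn hσ)}
  set S : Set E := {x : E | x ∈ (RL p (jj hn hσ D)).toAddSubgroup ∧ σ x = x} with hS
  have hmem : ∀ x, x ∈ S ↔ x ∈ RL p (jj hn hσ D) ∧ σ x = x := fun x => Iff.rfl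
  have h0S : (0:E) ∈ S := (hmem 0).mpr ⟨zero_mem _, map_zero _⟩
  change _ = Nat.card S - 1
  rw [Nat.card_coe_set_eq S, ← Set.ncard_sdiff_singleton_of_mem h0S, ← Nat.card_coe_set_eq, ← Nat.card_prod]
  have hY : ∀ A : Y, ∃ f : E, f ≠ 0 ∧ σ f = f ∧ dv hE f = jj hn hσ (iota _ A.1 - D) := fun A => A.2
  choose F hF0 hFσ hF using hY
  have hnn : ∀ A : Om hn hσ →₀ ℕ, 0 ≤ jj hn hσ (iota _ A) := by
    intro A W
    rw [jj_apply]
    simp [iota]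
  let Φ : Y × UL p σ → (S \ {0} : Set E) := fun y => ⟨y.2.1 * F y.1, by
    refine ⟨(hmem _).mpr ⟨?_, by rw [map_mul, hFσ, y.2.2.2.2]⟩, mul_ne_zero y.2.2.1 (hF0 _)⟩
    rw [mem_RL_iff hE (mul_ne_zero y.2.2.1 (hF0 _)), dv_mul hE y.2.2.1 (hF0 _), hF, dv_alg hE y.2.2.2.1, map_sub]
    simpa using hnn y.1.1⟩
  refine Nat.card_congr (Equiv.ofBijective Φ ⟨?_, ?_⟩)
  · rintro ⟨A, u⟩ ⟨A', u'⟩ h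
    have h : u.1 * F A = u'.1 * F A' := congrArg Subtype.val h
    have h1 := congrArg (dv hE) h
    rw [dv_mul hE u.2.1 (hF0 _), dv_mul hE u'.2.1 (hF0 _), dv_alg hE u.2.2.1, dv_alg hE u'.2.2.1, hF, hF, zero_add, zero_add] at h1
    have h2 := jj_inj hn hσ h1
    rw [sub_left_inj] at h2
    have h3 : A = A' := by
      apply Subtype.ext
      ext o
      have := DFunLike.congr_fun h2 o
      simpa [iota] using this
    subst h3
    have h4 : u = u' := Subtype.ext (mul_right_cancel₀ (hF0 A) h)
    rw [h4]
  · rintro ⟨x, ⟨hx, hxσ⟩, hx0⟩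
    have hx0 : x ≠ 0 := hx0
    have hx : x ∈ RL p (jj hn hσ D) := hx
    rw [mem_RL_iff hE hx0] at hx
    obtain ⟨B, hB1, hB2⟩ := jj_surj hn hσ (D := dv hE x + jj hn hσ D) (by rw [map_add, ← dv_aut, hxσ, Sd_jj])
    let A : Om hn hσ →₀ ℕ := B.mapRange Int.toNat rfl
    have hA : iota _ A = B := by
      ext o
      simp only [iota, A, Finsupp.mapRange.addMonoidHom_apply, Finsupp.mapRange_apply]
      have : 0 ≤ B o := by rw [hB2]; exact hx _
      simpa using this
    have hAY : iota _ A - D ∈ (PrL hE σ).comap (jj hn hσ) := by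
      refine ⟨x, hx0, hxσ, ?_⟩
      rw [hA, map_sub, hB1, add_sub_cancel_right]
    let A' : Y := ⟨A, hAY⟩
    have hd : dv hE (x * (F A')⁻¹) = 0 := by
      rw [dv_mul hE hx0 (inv_ne_zero (hF0 _)), dv_inv, hF]
      simp only [A']
      rw [hA, map_sub, hB1]; abel
    refine ⟨(A', ⟨x * (F A')⁻¹, mul_ne_zero hx0 (inv_ne_zero (hF0 _)), alg_of_dv_zero hE hd, by rw [map_mul, map_inv₀, hxσ, hFσ]⟩), ?_⟩
    apply Subtype.ext
    change x * (F A')⁻¹ * F A' = x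
    rw [inv_mul_cancel_right₀ (hF0 _)]

include hn hσ in
theorem F2 (hE : IsFF p E) {θ : E}
    (hθa : IsAlgebraic (ZMod p) θ) (hθ : ∀ i, 0 < i → i < n → (σ ^ i) θ ≠ θ) {D : Dv E} (hD : Sd σ D = D) (hD0 : dg p D = 0) :
    ∃ (f : E) (B : Dv E), f ≠ 0 ∧ σ f = f ∧ dg p B = 0 ∧ D = dv hE f + Nd σ n B := by
  classical
  have hθ0 := degθ_pos hθa
  let d := dO hn hσ p θ
  have hdW : ∀ W : FFPrime E, degθ p θ * (W.deg p / degθ p θ) = W.deg p := fun W => Nat.mul_div_cancel' (degθ_dvd hE hθa W)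
  have hq0 : ∀ W : FFPrime E, 0 < W.deg p / degθ p θ := fun W => by
    rcases Nat.eq_zero_or_pos (W.deg p / degθ p θ) with h | h
    · have h1 := hdW W
      rw [h, mul_zero] at h1
      have := FFPrime.deg_pos hE W
      omega
    · exact h
  have hd0 : ∀ o, 0 < d o := fun o => Nat.mul_pos (per_pos hn hσ _) (hq0 _)
  have hfin : ∀ m : ℕ, {o | d o ≤ m}.Finite := by
    intro m
    refine ((finite_deg_le hE (degθ p θ * m)).preimage (f := (Quotient.out : Om hn hσ → FFPrime E)) Quotient.out_injective.injOn).subset ?_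
    intro o ho
    have ho : d o ≤ m := ho
    change (Quotient.out o).deg p ≤ _
    rw [← hdW]
    refine Nat.mul_le_mul_left _ (le_trans ?_ ho)
    exact Nat.le_mul_of_pos_left _ (per_pos hn hσ _)
  let deg : (Om hn hσ →₀ ℤ) →+ ℤ := Finsupp.liftAddHom fun o => zmultiplesHom ℤ (d o : ℤ)
  have hdeg : ∀ A, deg (iota _ A) = dgN d A := by
    have : deg.comp (iota (Om hn hσ)) = (Nat.castAddMonoidHom ℤ).comp (dgN d) := by
      apply Finsupp.addHom_ext
      intro o k
      simp [deg, iota, dgN]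
    exact fun A => DFunLike.congr_fun this A
  have hdgj : ∀ D, dg p (jj hn hσ D) = degθ p θ * deg D := by
    have : (dg p).comp (jj hn hσ) = (AddMonoidHom.mulLeft (degθ p θ : ℤ)).comp deg := by
      apply Finsupp.addHom_ext
      intro o k
      rw [AddMonoidHom.comp_apply, jj_single, map_zsmul, jz, map_sum]
      have : ∀ i, dg p (Finsupp.single (σ ^ i • o.out) 1) = (o.out.deg p : ℤ) := by
        intro i; rw [dg_single, FFPrime.smul_deg hE, one_mul]
      simp only [this, Finset.sum_const, Finset.card_range]
      simp only [deg, d, dO, AddMonoidHom.comp_apply, Finsupp.liftAddHom_apply_single, zmultiplesHom_apply, AddMonoidHom.coe_mulLeft, smul_eq_mul, nsmul_eq_mul]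
      have h9 : (o.out.deg p : ℤ) = (degθ p θ : ℤ) * ((o.out.deg p / degθ p θ : ℕ) : ℤ) := by exact_mod_cast (hdW o.out).symm
      rw [h9, Nat.cast_mul]
      ring
    exact fun D => DFunLike.congr_fun this D
  obtain ⟨g, n0, hRR⟩ := exists_RR hE
  have hne : Nonempty (Om hn hσ) := hE.nonempty.map (Quotient.mk _)
  let P := (PrL hE σ).comap (jj hn hσ)
  have hP0 : ∀ D ∈ P, deg D = 0 := by
    rintro D ⟨f, hf, hfσ, e⟩
    have h1 := hdgj D
    rw [← e, dg_dv] at h1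
    have h2 : (degθ p θ : ℤ) ≠ 0 := by exact_mod_cast hθ0.ne'
    exact (mul_eq_zero.mp h1.symm).resolve_left h2
  obtain ⟨D', hD', -⟩ := jj_surj hn hσ hD
  have hD'0 : deg D' = 0 := by
    have h1 := hdgj D'
    rw [hD', hD0] at h1
    have h2 : (degθ p θ : ℤ) ≠ 0 := by exact_mod_cast hθ0.ne'
    exact (mul_eq_zero.mp h1.symm).resolve_left h2
  have hmain := zeta_lemma d hd0 hfin hn P deg hdeg hP0 n0.toNat ?_
    ((PrL hE σ ⊔ (Nd σ n).range).comap (jj hn hσ)) (AddSubgroup.comap_mono le_sup_left) ?_ D' hD'0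
  · rw [AddSubgroup.mem_comap, hD', AddSubgroup.mem_sup] at hmain
    obtain ⟨_, ⟨f, hf, hfσ, rfl⟩, _, ⟨B, rfl⟩, e⟩ := hmain
    refine ⟨f, B, hf, hfσ, ?_, e.symm⟩
    have h1 := congrArg (dg p) e
    rw [map_add, dg_dv, hD0, dg_Nd hE, zero_add] at h1
    exact (mul_eq_zero.mp h1).resolve_left (by exact_mod_cast hn.ne')
  · intro m hm D1 D2 h1 h2
    have hc : ∀ D1, deg D1 = m → (Nat.card {x : E // x ∈ (RL p (jj hn hσ D1)).toAddSubgroup ∧ σ x = x} ^ n : ℕ) = p ^ ((degθ p θ : ℤ) * m - g).toNat := by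
      intro D1 h1
      rw [← card_descent hn hσ hθa hθ]
      · have h3 := hRR (jj hn hσ D1) (by
          rw [hdgj, h1]
          have h4 : (1:ℤ) ≤ degθ p θ := by exact_mod_cast hθ0
          have h5 : n0 ≤ m := by omega
          have h6 : (0:ℤ) ≤ m := by positivity
          nlinarith)
        rw [hdgj, h1] at h3
        have h7 := RL_fin hE (jj hn hσ D1)
        have h8 := Module.natCard_eq_pow_finrank (K := ZMod p) (V := RL p (jj hn hσ D1))
        rw [Nat.card_zmod] at h8
        rw [← h3, Int.toNat_natCast]
        exact h8
      · intro x hx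
        have hx : x ∈ RL p _ := hx
        change σ x ∈ RL p _
        rw [mem_RL] at hx ⊢
        intro w
        have h3 := (FFPrime.smul_M σ (σ⁻¹ • w) x (-(jj hn hσ D1 (σ⁻¹ • w)))).mpr (hx _)
        rw [smul_inv_smul, ← Sd_apply, Sd_jj] at h3
        exact h3
      · intro a x ha hx
        have hx : x ∈ RL p _ := hx
        change a * x ∈ RL p _
        rw [mem_RL] at hx ⊢
        intro w
        exact w.mul_mem_M_left (mem_M0_of_alg w ha) (hx w)
    have h3 := (hc D1 h1).trans (hc D2 h2).symm
    have h4 := Nat.pow_left_injective hn.ne' h3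
    have e1 := card_eff hn hσ hE D1
    have e2 := card_eff hn hσ hE D2
    have h4' : Nat.card {x : E // x ∈ (RL p (jj hn hσ D1)).toAddSubgroup ∧ σ x = x} = Nat.card {x : E // x ∈ (RL p (jj hn hσ D2)).toAddSubgroup ∧ σ x = x} := h4
    rw [h4', ← e2] at e1
    have := UL_finite (σ := σ) hE
    exact Nat.eq_of_mul_eq_mul_right Nat.card_pos e1
  · intro o
    rw [AddSubgroup.mem_comap]
    apply AddSubgroup.mem_sup_right
    refine ⟨Finsupp.single o.out 1, ?_⟩
    rw [Nd_out hn hσ, jj_single]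
    have := gcd_period hE hn hσ hθa hθ o.out (per_dvd hσ o.out) (per_smul o.out)
    simp only [d, dO]
    rw [this, natCast_zsmul]

end

end

section
open IntermediateField

section
lemma herb' {G : Type*} [AddCommGroup G] (P : AddSubgroup G) [Finite (G ⧸ P)] (f g : G →+ G) (hf : ∀ x ∈ P, f x ∈ P) (hg : ∀ x ∈ P, g x ∈ P)
    (hgf : ∀ x, g (f x) = 0) (hfg : ∀ x, f (g x) = 0)
    (h : ∀ x, f x ∈ P → ∃ y, g y - x ∈ P) : ∀ x, g x ∈ P → ∃ y, f y - x ∈ P := by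
  have hf : P ≤ P.comap f := hf
  have hg : P ≤ P.comap g := hg
  have hq : ∀ x y : G, (QuotientAddGroup.mk x : G ⧸ P) = QuotientAddGroup.mk y ↔ x - y ∈ P := by
    intro x y
    rw [eq_comm, QuotientAddGroup.eq, sub_eq_neg_add]
  have hq0 : ∀ x : G, (QuotientAddGroup.mk x : G ⧸ P) = 0 ↔ x ∈ P := fun x => QuotientAddGroup.eq_zero_iff x
  have hm := herb (QuotientAddGroup.map P P f hf) (QuotientAddGroup.map P P g hg) ?_ ?_ ?_
  · intro x hx
    obtain ⟨y, hy⟩ := hm (QuotientAddGroup.mk x) (by rw [QuotientAddGroup.map_mk, hq0]; exact hx)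
    induction y using QuotientAddGroup.induction_on with
    | H y => exact ⟨y, by rw [← hq]; exact hy⟩
  · intro x
    induction x using QuotientAddGroup.induction_on with
    | H y => rw [QuotientAddGroup.map_mk, QuotientAddGroup.map_mk, hgf]; rfl
  · intro x
    induction x using QuotientAddGroup.induction_on with
    | H y => rw [QuotientAddGroup.map_mk, QuotientAddGroup.map_mk, hfg]; rfl
  · intro x hx
    induction x using QuotientAddGroup.induction_on with
    | H x =>
      rw [QuotientAddGroup.map_mk, hq0] at hx
      obtain ⟨y, hy⟩ := h x hx
      exact ⟨QuotientAddGroup.mk y, by rw [QuotientAddGroup.map_mk, hq]; exact hy⟩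

lemma norm_surj_fin {F : Type*} [Field F] [Finite F] {σ : RingAut F} {n : ℕ} (hn : 0 < n) (hσ : σ ^ n = 1) {θ : F} (hθ : ∀ i, 0 < i → i < n → (σ ^ i) θ ≠ θ)
    {c : F} (hc : c ≠ 0) (hcσ : σ c = c) : ∃ g, g ≠ 0 ∧ Nm σ n g = c := by
  let N : Fˣ →* Fˣ :=
    { toFun := fun u => Units.mk0 (Nm σ n u) (Nm_ne_zero _ _ u.ne_zero)
      map_one' := by ext; simp [Nm_one]
      map_mul' := fun u v => by ext; simp [Nm_mul] }
  let D : Fˣ →* Fˣ :=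
    { toFun := fun u => Units.mk0 (σ u / u) (div_ne_zero ((map_ne_zero_iff σ σ.injective).mpr u.ne_zero) u.ne_zero)
      map_one' := by ext; simp
      map_mul' := fun u v => by
        ext
        simp only [Units.val_mul, map_mul, Units.val_mk0]
        field_simp }
  have hN : ∀ u, (N u : F) = Nm σ n u := fun u => rfl
  have hD : ∀ u, (D u : F) = σ u / u := fun u => rfl
  have hm := herb (MonoidHom.toAdditive N) (MonoidHom.toAdditive D) ?_ ?_ ?_ (Additive.ofMul (Units.mk0 c hc)) ?_
  · obtain ⟨y, hy⟩ := hm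
    refine ⟨(Additive.toMul y : Fˣ), Units.ne_zero _, ?_⟩
    have : N (Additive.toMul y) = Units.mk0 c hc := hy
    rw [← hN, this]; rfl
  · intro x
    change D (N (Additive.toMul x)) = 1
    ext
    rw [hD, hN, Nm_fixed hσ, div_self (Nm_ne_zero _ _ (Units.ne_zero _))]; rfl
  · intro x
    change N (D (Additive.toMul x)) = 1
    ext
    rw [hN, hD, div_eq_mul_inv, Nm_mul, Nm_inv, Nm_aut hσ, mul_inv_cancel₀ (Nm_ne_zero _ _ (Units.ne_zero _))]; rfl
  · intro x hx
    have hx : N (Additive.toMul x) = 1 := hx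
    have hx2 : Nm σ n ((Additive.toMul x : Fˣ) : F) = 1 := by rw [← hN, hx]; rfl
    obtain ⟨y, hy0, hy⟩ := hilbert90 hn hσ hθ hx2
    refine ⟨Additive.ofMul (Units.mk0 y hy0)⁻¹, ?_⟩
    change D _ = Additive.toMul x
    ext
    rw [hD]
    have : σ y ≠ 0 := (map_ne_zero_iff σ σ.injective).mpr hy0
    change σ ((Units.mk0 y hy0)⁻¹ : Fˣ) / ((Units.mk0 y hy0)⁻¹ : Fˣ) = _
    simp only [Units.val_inv_eq_inv_val, Units.val_mk0, map_inv₀]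
    field_simp
    rw [mul_comm]; exact hy.symm
  · change D _ = 1
    ext
    rw [hD]
    change σ c / c = 1
    rw [hcσ, div_self hc]

variable {E : Type} [Field E] {p : ℕ} [Fact p.Prime] [Algebra (ZMod p) E]

lemma finite_const (hE : IsFF p E) : Finite (algebraicClosure (ZMod p) E) := by
  have h1 := RL_fin hE (0 : Dv E)
  have h2 : Finite (RL p (0 : Dv E)) := Module.finite_of_finite (ZMod p)
  refine Finite.of_injective (fun u : algebraicClosure (ZMod p) E => (⟨u.1, by
    rw [mem_RL]; intro w; simpa using mem_M0_of_alg w (mem_algebraicClosure_iff.mp u.2)⟩ : RL p (0 : Dv E))) ?_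
  intro u u' h
  exact Subtype.ext (congrArg (fun z : RL p (0 : Dv E) => (z : E)) h)

lemma const_norm (hE : IsFF p E) {σ : RingAut E} {n : ℕ} (hn : 0 < n) (hσ : σ ^ n = 1) {θ : E}
    (hθa : IsAlgebraic (ZMod p) θ) (hθ : ∀ i, 0 < i → i < n → (σ ^ i) θ ≠ θ) {c : E} (hc : c ≠ 0)
    (hca : IsAlgebraic (ZMod p) c) (hcσ : σ c = c) : ∃ g, g ≠ 0 ∧ IsAlgebraic (ZMod p) g ∧ Nm σ n g = c := by
  let k := algebraicClosure (ZMod p) E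
  have hfin : Finite k := finite_const hE
  let τ : RingAut k :=
    { toFun := fun x => ⟨σ x.1, mem_algebraicClosure_iff.mpr (alg_aut _ (mem_algebraicClosure_iff.mp x.2))⟩
      invFun := fun x => ⟨σ⁻¹ x.1, mem_algebraicClosure_iff.mpr (alg_aut _ (mem_algebraicClosure_iff.mp x.2))⟩
      left_inv := fun x => Subtype.ext (σ.symm_apply_apply x.1)
      right_inv := fun x => Subtype.ext (σ.apply_symm_apply x.1)
      map_mul' := fun x y => Subtype.ext (map_mul σ x.1 y.1)
      map_add' := fun x y => Subtype.ext (map_add σ x.1 y.1) }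
  have hτ : ∀ (i : ℕ) (x : k), (((τ ^ i) x : k) : E) = (σ ^ i) (x : E) := by
    intro i
    induction i with
    | zero => intro x; rfl
    | succ i ih => intro x; rw [← aut_pow_succ, ← aut_pow_succ, ← ih]; rfl
  have hNm : ∀ x : k, ((Nm τ n x : k) : E) = Nm σ n (x : E) := by
    intro x
    rw [Nm, Nm]
    have := map_prod (algebraMap k E) (fun i => (τ ^ i) x) (Finset.range n)
    rw [show algebraMap k E = (k.val : k →+* E) from rfl] at this
    refine this.trans (Finset.prod_congr rfl fun i _ => hτ i x)
  obtain ⟨g, hg0, hg⟩ := norm_surj_fin (F := k) (σ := τ) hn (by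
    apply RingEquiv.ext; intro x; apply Subtype.ext; rw [hτ, hσ]; rfl) (θ := ⟨θ, mem_algebraicClosure_iff.mpr hθa⟩)
    (fun i h1 h2 h3 => hθ i h1 h2 (by rw [← hτ i ⟨θ, mem_algebraicClosure_iff.mpr hθa⟩, h3]))
    (c := ⟨c, mem_algebraicClosure_iff.mpr hca⟩) (fun h => hc (congrArg Subtype.val h)) (Subtype.ext hcσ)
  refine ⟨g, fun h => hg0 (Subtype.ext h), mem_algebraicClosure_iff.mp g.2, ?_⟩
  rw [← hNm, hg]

theorem lang (hE : IsFF p E) {σ : RingAut E} {n : ℕ} (hn : 0 < n) (hσ : σ ^ n = 1) {θ : E}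
    (hθa : IsAlgebraic (ZMod p) θ) (hθ : ∀ i, 0 < i → i < n → (σ ^ i) θ ≠ θ) {c : E} (hc : c ≠ 0)
    (hcσ : σ c = c) (hdiv : ∀ W : FFPrime E, (n : ℤ) ∣ W.o c) : ∃ g, g ≠ 0 ∧ Nm σ n g = c := by
  have hfin := finite_pic hE
  let f : Dv0 p E →+ Dv0 p E := ((Sd σ - AddMonoidHom.id _).comp (Dv0 p E).subtype).codRestrict (Dv0 p E) (fun x => by
    change dg p (Sd σ (x : Dv E) - (x : Dv E)) = 0
    rw [map_sub, dg_Sd hE, sub_self])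
  let g : Dv0 p E →+ Dv0 p E := ((Nd σ n).comp (Dv0 p E).subtype).codRestrict (Dv0 p E) (fun x => by
    change dg p (Nd σ n x) = 0
    rw [dg_Nd hE, show dg p (x : Dv E) = 0 from x.2, mul_zero])
  have hf : ∀ x, (f x : Dv E) = Sd σ (x : Dv E) - (x : Dv E) := fun x => rfl
  have hg : ∀ x, (g x : Dv E) = Nd σ n x := fun x => rfl
  have hPm : ∀ x : Dv0 p E, x ∈ (Pr hE).addSubgroupOf (Dv0 p E) ↔ ∃ y : E, y ≠ 0 ∧ dv hE y = x := fun x => Iff.rfl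
  -- the divisor of c divided by n
  let D : Dv E := (dv hE c).mapRange (fun z => z / (n:ℤ)) (by simp)
  have hnZ : (n : ℤ) ≠ 0 := by exact_mod_cast hn.ne'
  have hDapp : ∀ W, D W = W.o c / n := fun W => by simp [D]
  have hnD : n • D = dv hE c := by
    ext W
    rw [Finsupp.smul_apply, hDapp, nsmul_eq_mul, dv_apply, Int.mul_ediv_cancel' (hdiv W)]
  have hDσ : Sd σ D = D := by
    ext W
    rw [Sd_apply, hDapp, hDapp, FFPrime.smul_o, inv_inv, hcσ]
  have hD0 : dg p D = 0 := by
    have h1 := congrArg (dg p) hnD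
    rw [dg_dv, map_nsmul, nsmul_eq_mul] at h1
    exact (mul_eq_zero.mp h1).resolve_left hnZ
  have key := herb' ((Pr hE).addSubgroupOf (Dv0 p E)) f g ?_ ?_ ?_ ?_ ?_ ⟨D, hD0⟩ ?_
  · obtain ⟨B, hB⟩ := key
    obtain ⟨y, hy0, hy⟩ := (hPm _).mp hB
    have hy : dv hE y = Sd σ B - B - D := hy
    have h1 := dv_Nm hE σ n hy0
    rw [hy, map_sub, map_sub, Nd_Sd hσ, sub_self, zero_sub, Nd_of_fixed hDσ, hnD] at h1
    have h2 : dv hE (c * Nm σ n y) = 0 := by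
      rw [dv_mul hE hc (Nm_ne_zero _ _ hy0), h1, add_neg_cancel]
    obtain ⟨κ, hκ0, -, hκ⟩ := const_norm hE hn hσ hθa hθ (mul_ne_zero hc (Nm_ne_zero σ n hy0)) (alg_of_dv_zero hE h2)
      (by rw [map_mul, hcσ, Nm_fixed hσ])
    refine ⟨κ * y⁻¹, mul_ne_zero hκ0 (inv_ne_zero hy0), ?_⟩
    rw [Nm_mul, Nm_inv, hκ, mul_inv_cancel_right₀ (Nm_ne_zero σ n hy0)]
  · rintro x hx
    obtain ⟨y, hy0, hy⟩ := (hPm _).mp hx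
    have h1 : σ y ≠ 0 := (map_ne_zero_iff σ σ.injective).mpr hy0
    refine (hPm _).mpr ⟨σ y * y⁻¹, mul_ne_zero h1 (inv_ne_zero hy0), ?_⟩
    rw [dv_mul hE h1 (inv_ne_zero hy0), dv_inv, dv_aut, hf, hy, sub_eq_add_neg]
  · rintro x hx
    obtain ⟨y, hy0, hy⟩ := (hPm _).mp hx
    exact (hPm _).mpr ⟨Nm σ n y, Nm_ne_zero _ _ hy0, by rw [dv_Nm hE σ n hy0, hg, hy]⟩
  · intro x
    apply Subtype.ext
    rw [hg, hf, map_sub, Nd_Sd hσ, sub_self]; rfl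
  · intro x
    apply Subtype.ext
    rw [hf, hg, Sd_Nd hσ, sub_self]; rfl
  · intro x hx
    obtain ⟨y, hy0, hy⟩ := (hPm _).mp hx
    rw [hf] at hy
    have h1 := dv_Nm hE σ n hy0
    rw [hy, map_sub, Nd_Sd hσ, sub_self] at h1
    obtain ⟨κ, hκ0, hκa, hκ⟩ := const_norm hE hn hσ hθa hθ (Nm_ne_zero σ n hy0) (alg_of_dv_zero hE h1) (Nm_fixed hσ y)
    obtain ⟨z, hz0, hz⟩ := hilbert90 (x := y * κ⁻¹) hn hσ hθ (by rw [Nm_mul, Nm_inv, hκ, mul_inv_cancel₀ (Nm_ne_zero σ n hy0)])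
    have hz1 : σ z ≠ 0 := (map_ne_zero_iff σ σ.injective).mpr hz0
    have h2 := congrArg (dv hE) hz
    rw [dv_mul hE (mul_ne_zero hy0 (inv_ne_zero hκ0)) hz1, dv_mul hE hy0 (inv_ne_zero hκ0), dv_inv, dv_alg hE hκa, neg_zero, add_zero, hy, dv_aut] at h2
    obtain ⟨t, B, ht0, htσ, hB0, e⟩ := F2 hn hσ hE hθa hθ (D := x + dv hE z) (by
      rw [map_add, ← sub_eq_zero, ← sub_eq_zero.mpr h2]; abel) (by rw [map_add, dg_dv, add_zero]; exact x.2)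
    refine ⟨⟨B, hB0⟩, (hPm _).mpr ⟨z * t⁻¹, mul_ne_zero hz0 (inv_ne_zero ht0), ?_⟩⟩
    rw [dv_mul hE hz0 (inv_ne_zero ht0), dv_inv]
    change _ = Nd σ n B - x
    rw [eq_sub_iff_add_eq, ← sub_eq_iff_eq_add'.mpr e]; abel
  · exact (hPm _).mpr ⟨c, hc, by rw [hg]; change _ = Nd σ n D; rw [Nd_of_fixed hDσ, hnD]⟩

end

end

section
open IntermediateField

section
variable (p : ℕ) [Fact p.Prime] (R : ℕ)

/-- the finite field of degree `R` -/
abbrev kR := GaloisField p R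

lemma exists_gen : ∃ θ : kR p R, ∀ x : kR p R, x = 0 ∨ ∃ i : ℕ, x = θ ^ i := by
  obtain ⟨u, hu⟩ := IsCyclic.exists_generator (α := (kR p R)ˣ)
  refine ⟨u, fun x => ?_⟩
  by_cases hx : x = 0
  · exact Or.inl hx
  · right
    have h1 := hu (Units.mk0 x hx)
    rw [← mem_powers_iff_mem_zpowers] at h1
    obtain ⟨i, hi⟩ := h1
    exact ⟨i, by rw [← Units.val_pow_eq_pow_val]; exact (congrArg Units.val hi).symm⟩

/-- a generator of the finite field -/
def tR : kR p R := (exists_gen p R).choose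

lemma tR_gen (x : kR p R) : x = 0 ∨ ∃ i : ℕ, x = tR p R ^ i := (exists_gen p R).choose_spec x

variable {R} (hR : R ≠ 0)

include hR in
lemma tR_pow : tR p R ^ (p ^ R) = tR p R := by
  have hf : Fintype (kR p R) := Fintype.ofFinite _
  have := FiniteField.pow_card (tR p R)
  rwa [← Nat.card_eq_fintype_card, GaloisField.card p R hR] at this

include hR in
lemma tR_inj {i j : ℕ} (hi : i < R) (hj : j < R) (h : tR p R ^ (p ^ i) = tR p R ^ (p ^ j)) : i = j := by
  have hp := (Fact.out : p.Prime).one_lt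
  have key : ∀ i j : ℕ, i < j → j < R → tR p R ^ (p ^ i) ≠ tR p R ^ (p ^ j) := by
    intro i j hij hj h
    -- all elements satisfy x^(p^(j-i)) = x
    have h1 : tR p R ^ (p ^ (j - i)) = tR p R := by
      have h2 : (tR p R ^ (p ^ (j - i))) ^ (p ^ i) = tR p R ^ (p ^ i) := by
        rw [← pow_mul, ← pow_add, Nat.sub_add_cancel hij.le, h]
      have h3 := iterateFrobenius_inj (kR p R) p i
      exact h3 (by simpa [iterateFrobenius_def] using h2)
    have h2 : ∀ x : kR p R, x ^ (p ^ (j - i)) = x := by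
      intro x
      rcases tR_gen p R x with rfl | ⟨l, rfl⟩
      · rw [zero_pow (pow_ne_zero _ (by omega))]
      · rw [← pow_mul, mul_comm, pow_mul, h1]
    have h3 : Nat.card (kR p R) ≤ p ^ (j - i) := by
      classical
      have hf : Fintype (kR p R) := Fintype.ofFinite _
      have hne := FiniteField.X_pow_card_sub_X_ne_zero (kR p R) (p := p ^ (j - i)) (Nat.one_lt_pow (by omega) hp)
      have hd := FiniteField.X_pow_card_sub_X_natDegree_eq (kR p R) (p := p ^ (j - i)) (Nat.one_lt_pow (by omega) hp)
      rw [← hd, Nat.card_eq_fintype_card, ← Finset.card_univ]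
      apply Polynomial.card_le_degree_of_subset_roots
      intro x _
      rw [Polynomial.mem_roots hne]
      simp [h2 x]
    rw [GaloisField.card p R hR] at h3
    have := (Nat.pow_le_pow_iff_right hp).mp h3
    omega
  rcases lt_trichotomy i j with h1 | h1 | h1
  · exact absurd h (key i j h1 hj)
  · exact h1
  · exact absurd h.symm (key j i h1 hi)

/-- the product of conjugate linear forms -/
def lf {A : Type*} [CommRing A] (p : ℕ) {R : ℕ} (t : A) (z : Fin R → A) (i : ℕ) : A := ∑ j : Fin R, z j * t ^ (p ^ i * (j:ℕ))

include hR in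
theorem exists_nf : ∃ nf : MvPolynomial (Fin R) (ZMod p), ∀ (A : Type) [CommRing A] [Algebra (ZMod p) A] (ι : kR p R →+* A) (z : Fin R → A),
    MvPolynomial.aeval z nf = ∏ i ∈ Finset.range R, lf p (ι (tR p R)) z i := by
  let NF : MvPolynomial (Fin R) (kR p R) := ∏ i ∈ Finset.range R, lf p (MvPolynomial.C (tR p R)) MvPolynomial.X i
  have hfr : MvPolynomial.map (frobenius (kR p R) p) NF = NF := by
    simp only [NF, map_prod]
    refine (Finset.prod_congr rfl (fun i _ => ?_)).trans (prod_shift (fun i => lf p (MvPolynomial.C (tR p R)) (MvPolynomial.X : Fin R → MvPolynomial (Fin R) (kR p R)) i) R (by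
        simp only [lf, pow_mul, ← map_pow, tR_pow p hR, pow_zero, pow_one]))
    simp only [lf, map_sum, map_mul, map_pow, MvPolynomial.map_X, MvPolynomial.map_C, frobenius_def]
    refine Finset.sum_congr rfl fun j _ => ?_
    rw [← pow_mul, ← mul_assoc, ← pow_succ']
  have hmem : NF ∈ Set.range (MvPolynomial.map (σ := Fin R) (algebraMap (ZMod p) (kR p R))) := by
    rw [MvPolynomial.mem_range_map_iff_coeffs_subset]
    intro c hc
    obtain ⟨m, -, rfl⟩ := MvPolynomial.mem_coeffs_iff.mp hc
    have h1 := congrArg (MvPolynomial.coeff m) hfr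
    rw [MvPolynomial.coeff_map, frobenius_def] at h1
    have h2 := (Subfield.mem_bot_iff_pow_eq_self (F := kR p R) (p := p)).mpr h1
    have h3 : (⊥ : Subfield (kR p R)) ≤ (algebraMap (ZMod p) (kR p R)).fieldRange := bot_le
    exact h3 h2
  obtain ⟨nf, hnf⟩ := hmem
  refine ⟨nf, fun A _ _ ι z => ?_⟩
  have h1 : MvPolynomial.eval₂ ι z NF = ∏ i ∈ Finset.range R, lf p (ι (tR p R)) z i := by
    have : ∀ q, MvPolynomial.eval₂ ι z q = MvPolynomial.eval₂Hom ι z q := fun _ => rfl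
    rw [this]
    simp only [NF, map_prod, lf, map_sum, map_mul, map_pow, MvPolynomial.eval₂Hom_X', MvPolynomial.eval₂Hom_C]
  rw [← h1, ← hnf, MvPolynomial.eval₂_map, MvPolynomial.aeval_def]
  congr 1
  exact RingHom.ext_zmod _ _

/-- the norm form -/
def nf (hR : R ≠ 0) : MvPolynomial (Fin R) (ZMod p) := (exists_nf p hR).choose

lemma nf_eval {A : Type} [CommRing A] [Algebra (ZMod p) A] (ι : kR p R →+* A) (z : Fin R → A) :
    MvPolynomial.aeval z (nf p hR) = ∏ i ∈ Finset.range R, lf p (ι (tR p R)) z i := (exists_nf p hR).choose_spec A ι z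

lemma exists_ext (F : Type) [Field F] [Algebra (ZMod p) F] : ∃ (E : Type) (_ : Field E) (_ : Algebra F E) (ι : kR p R →+* E),
    FiniteDimensional F E ∧ F⟮ι (tR p R)⟯ = ⊤ := by
  let Ω := AlgebraicClosure F
  have : IsScalarTower (ZMod p) F Ω := zmod_tower p F Ω
  let ι0 : kR p R →ₐ[ZMod p] Ω := IsAlgClosed.lift
  let E := F⟮ι0 (tR p R)⟯
  have hmem : ∀ x, ι0 x ∈ E := by
    intro x
    rcases tR_gen p R x with rfl | ⟨i, rfl⟩
    · rw [map_zero]; exact zero_mem _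
    · rw [map_pow]; exact pow_mem (mem_adjoin_simple_self F _) _
  refine ⟨E, inferInstance, inferInstance, (ι0 : kR p R →+* Ω).codRestrict E hmem, ?_, ?_⟩
  · apply IntermediateField.adjoin.finiteDimensional
    have h1 : IsIntegral (ZMod p) (ι0 (tR p R)) := (Algebra.IsIntegral.isIntegral (R := ZMod p) (tR p R)).map ι0
    exact h1.tower_top
  · apply IntermediateField.map_injective E.val
    rw [IntermediateField.adjoin_map, Set.image_singleton, ← AlgHom.fieldRange_eq_map, E.fieldRange_val]
    rfl

end

end

section
open IntermediateField

section
lemma norm_to_lf {E : Type*} [Field E] {p R : ℕ} (hR : R ≠ 0) {σ : RingAut E} {n : ℕ} (hn : 0 < n) (hσ : σ ^ n = 1) {θ : E}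
    (hθR : θ ^ (p ^ R) = θ) (hinj : ∀ i j : ℕ, i < R → j < R → θ ^ (p ^ i) = θ ^ (p ^ j) → i = j)
    (hθ : ∀ i, 0 < i → i < n → (σ ^ i) θ ≠ θ) {s : ℕ} (hs : σ θ = θ ^ (p ^ s)) (g : E) :
    ∃ z : Fin R → E, (∀ j, σ (z j) = z j) ∧ ∏ i ∈ Finset.range R, lf p θ z i = Nm σ n g := by
  classical
  -- nodes
  have hper : ∀ i, θ ^ (p ^ (i + R)) = θ ^ (p ^ i) := by
    intro i
    rw [pow_add, mul_comm, pow_mul, hθR]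
  have hmod : ∀ i, θ ^ (p ^ (i % R)) = θ ^ (p ^ i) := by
    intro i
    induction i using Nat.strong_induction_on with
    | _ i ih =>
      by_cases h : i < R
      · rw [Nat.mod_eq_of_lt h]
      · have h1 := ih (i - R) (by omega)
        rw [← Nat.mod_eq_sub_mod (by omega)] at h1
        rw [h1, ← hper, Nat.sub_add_cancel (by omega)]
  have hσs : ∀ i : ℕ, ∃ s, (σ ^ i) θ = θ ^ (p ^ s) := by
    intro i
    induction i with
    | zero => exact ⟨0, by simp⟩
    | succ i ih =>
      obtain ⟨s', hs'⟩ := ih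
      refine ⟨s + s', ?_⟩
      rw [← aut_pow_succ, hs', map_pow, hs, ← pow_mul, pow_add]
  let y : E → E := fun t => if h : ∃ j, j < n ∧ (σ ^ j) θ = t then (σ ^ h.choose) g else 1
  have hσn : ∀ (j : ℕ) (x : E), (σ ^ (j % n)) x = (σ ^ j) x := by
    intro j x
    conv_rhs => rw [← Nat.mod_add_div j n, pow_add, pow_mul, hσ, one_pow, mul_one]
  have hci : ∀ i j, i < n → j < n → (σ ^ i) θ = (σ ^ j) θ → i = j := by
    intro i j hi hj h
    have := conj_inj hθ (a₁ := ⟨i, hi⟩) (a₂ := ⟨j, hj⟩) h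
    simpa using this
  have hy1 : ∀ j, y ((σ ^ j) θ) = (σ ^ j) g := by
    intro j
    have h : ∃ j', j' < n ∧ (σ ^ j') θ = (σ ^ j) θ := ⟨j % n, Nat.mod_lt _ hn, hσn j θ⟩
    simp only [y]
    rw [dif_pos h]
    have h1 := h.choose_spec
    have h2 : h.choose = j % n := hci _ _ h1.1 (Nat.mod_lt _ hn) (h1.2.trans (hσn j θ).symm)
    rw [h2, hσn]
  have hy2 : ∀ t, (¬ ∃ j, (σ ^ j) θ = t) → y t = 1 := by
    intro t h
    simp only [y]
    rw [dif_neg]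
    rintro ⟨j, -, hj⟩
    exact h ⟨j, hj⟩
  have hyσ : ∀ t, y (σ t) = σ (y t) := by
    intro t
    by_cases h : ∃ j, (σ ^ j) θ = t
    · obtain ⟨j, rfl⟩ := h
      rw [aut_pow_succ, hy1, hy1, aut_pow_succ]
    · rw [hy2 t h, map_one, hy2]
      rintro ⟨j, hj⟩
      apply h
      refine ⟨j + (n - 1), ?_⟩
      apply σ.injective
      rw [aut_pow_succ, show j + (n - 1) + 1 = n + j by omega, pow_add, hσ, one_mul, hj]
  let v : Fin R → E := fun i => θ ^ (p ^ (i : ℕ))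
  have hv : Set.InjOn v (Finset.univ : Finset (Fin R)) := fun i _ j _ h => Fin.ext (hinj i j i.2 j.2 h)
  let P := Lagrange.interpolate Finset.univ v (fun i => y (v i))
  have hPd : P.degree < (Finset.univ : Finset (Fin R)).card := Lagrange.degree_interpolate_lt _ hv
  have hPe : ∀ i, P.eval (v i) = y (v i) := fun i => Lagrange.eval_interpolate_at_node (fun i => y (v i)) hv (Finset.mem_univ i)
  have hvσ : ∀ i, ∃ i', v i = σ (v i') := by
    intro i
    have hs1 : ∃ s', (σ ^ (n - 1)) θ = θ ^ (p ^ s') := hσs _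
    obtain ⟨s', hs'⟩ := hs1
    have h1 : θ = σ (θ ^ (p ^ s')) := by
      rw [← hs', aut_pow_succ, Nat.sub_add_cancel hn, hσ]; rfl
    refine ⟨⟨(s' + i) % R, Nat.mod_lt _ (Nat.pos_of_ne_zero hR)⟩, ?_⟩
    simp only [v]
    rw [hmod, pow_add, pow_mul, map_pow, ← h1]
  have hPσ : P.map (σ : E →+* E) = P := by
    refine Polynomial.eq_of_degrees_lt_of_eval_index_eq Finset.univ hv (lt_of_le_of_lt Polynomial.degree_map_le hPd) hPd ?_
    intro i _
    obtain ⟨i', hi'⟩ := hvσ i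
    rw [hPe, hi', hyσ, ← hPe i']
    exact Polynomial.eval_map_apply (σ : E →+* E) _
  refine ⟨fun j => P.coeff j, fun j => ?_, ?_⟩
  · have := congrArg (fun Q => Q.coeff (j:ℕ)) hPσ
    simpa [Polynomial.coeff_map] using this
  · have hlf : ∀ i : Fin R, lf p θ (fun j : Fin R => P.coeff j) i = y (v i) := by
      intro i
      rw [← hPe i]
      have hnd : P.natDegree < R := by
        by_cases hP0 : P = 0
        · rw [hP0]; simpa using Nat.pos_of_ne_zero hR
        · rw [Polynomial.natDegree_lt_iff_degree_lt hP0]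
          simpa using hPd
      rw [Polynomial.eval_eq_sum_range' hnd, ← Fin.sum_univ_eq_sum_range (fun j => P.coeff j * v i ^ j)]
      refine Finset.sum_congr rfl fun j _ => ?_
      rw [pow_mul]
    rw [← Fin.prod_univ_eq_prod_range, Finset.prod_congr rfl (fun i _ => hlf i)]
    have h1 : ∏ i : Fin R, y (v i) = ∏ t ∈ Finset.univ.image v, y t := by
      rw [Finset.prod_image]
      exact fun i hi j hj h => hv hi hj h
    have h2 : Nm σ n g = ∏ t ∈ (Finset.range n).image (fun j => (σ ^ j) θ), y t := by
      rw [Finset.prod_image, Nm]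
      · exact Finset.prod_congr rfl fun j _ => (hy1 j).symm
      · intro i hi j hj h
        exact hci i j (by simpa using hi) (by simpa using hj) h
    rw [h1, h2]
    symm
    apply Finset.prod_subset
    · intro t ht
      obtain ⟨j, -, rfl⟩ := Finset.mem_image.mp ht
      obtain ⟨s', hs'⟩ := hσs j
      refine Finset.mem_image.mpr ⟨⟨s' % R, Nat.mod_lt _ (Nat.pos_of_ne_zero hR)⟩, Finset.mem_univ _, ?_⟩
      simp only [v]
      rw [hmod, hs']
    · intro t _ ht
      apply hy2
      rintro ⟨j, hj⟩
      exact ht (Finset.mem_image.mpr ⟨j % n, Finset.mem_range.mpr (Nat.mod_lt _ hn), by rw [hσn, hj]⟩)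

variable {p : ℕ} [Fact p.Prime] {R : ℕ} (hR : R ≠ 0)

/-- existence of the cyclic constant field extension -/
lemma exists_cyclic (L : Type) [Field L] [Algebra (ZMod p) L] (hR : R ≠ 0) : ∃ (E : Type) (_ : Field E) (_ : Algebra L E) (ι : kR p R →+* E)
    (σ : E ≃ₐ[L] E) (n s : ℕ), FiniteDimensional L E ∧ 0 < n ∧ n ∣ R ∧ σ ^ n = 1 ∧ (∀ i, 0 < i → i < n → (σ ^ i) (ι (tR p R)) ≠ ι (tR p R)) ∧
      σ (ι (tR p R)) = ι (tR p R) ^ (p ^ s) ∧ ∀ x, σ x = x → ∃ y, algebraMap L E y = x := by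
  classical
  obtain ⟨E, iE, iA, ι, hfd, htop⟩ := exists_ext p (R := R) L
  let _ : Algebra (ZMod p) E := ((algebraMap L E).comp (algebraMap (ZMod p) L)).toAlgebra
  have hT1 : IsScalarTower (ZMod p) L E := zmod_tower p L E
  let _ : Algebra (kR p R) E := ι.toAlgebra
  have hT2 : IsScalarTower (ZMod p) (kR p R) E := zmod_tower p (kR p R) E
  have hk : Fintype (kR p R) := Fintype.ofFinite _
  let Q0 := minpoly (ZMod p) (tR p R)
  let Q : Polynomial L := Q0.map (algebraMap (ZMod p) L)
  have hintg : IsIntegral (ZMod p) (tR p R) := Algebra.IsIntegral.isIntegral _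
  have hQs : Q.Separable := (PerfectField.separable_of_irreducible (minpoly.irreducible hintg)).map
  have hQE : Q.map (algebraMap L E) = (Q0.map (algebraMap (ZMod p) (kR p R))).map ι := by
    rw [Polynomial.map_map, Polynomial.map_map]
    congr 1
    exact RingHom.ext_zmod _ _
  have htop2 : Algebra.adjoin L {ι (tR p R)} = ⊤ := by
    rw [← IntermediateField.adjoin_simple_toSubalgebra_of_isAlgebraic (Algebra.IsAlgebraic.isAlgebraic _), htop]; rfl
  have hspl : Polynomial.IsSplittingField L E Q := by
    refine ⟨?_, ?_⟩
    · rw [hQE]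
      exact (Normal.splits inferInstance (tR p R)).map ι
    · rw [eq_top_iff, ← htop2]
      apply Algebra.adjoin_mono
      rw [Set.singleton_subset_iff, Polynomial.mem_rootSet]
      refine ⟨hQs.ne_zero, ?_⟩
      rw [Polynomial.aeval_def, Polynomial.eval₂_eq_eval_map, hQE, Polynomial.eval_map_apply, Polynomial.eval_map_algebraMap, minpoly.aeval, map_zero]
  have hgal : IsGalois L E := IsGalois.of_separable_splitting_field hQs
  let Ψ : Gal(E/L) →* Gal(kR p R/ZMod p) := (AlgEquiv.restrictNormalHom (kR p R)).comp (AlgEquiv.restrictScalarsHom (ZMod p))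
  have hΨ : ∀ (τ : Gal(E/L)) (x : kR p R), ι (Ψ τ x) = τ (ι x) := by
    intro τ x
    exact AlgEquiv.restrictNormal_commutes (AlgEquiv.restrictScalars (ZMod p) τ) (kR p R) x
  have hfix : ∀ τ : Gal(E/L), τ (ι (tR p R)) = ι (tR p R) → τ = 1 := by
    intro τ h
    have h1 : (τ : E →ₐ[L] E) = AlgHom.id L E := by
      apply AlgHom.ext_of_adjoin_eq_top htop2
      intro x hx
      rw [Set.mem_singleton_iff.mp hx]
      exact h
    ext x
    exact DFunLike.congr_fun h1 x
  have hΨi : Function.Injective Ψ := by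
    rw [injective_iff_map_eq_one]
    intro τ h
    apply hfix
    rw [← hΨ, h]; rfl
  have hcyc : IsCyclic (Gal(E/L)) := isCyclic_of_injective Ψ hΨi
  obtain ⟨σ, hσ⟩ := IsCyclic.exists_generator (α := Gal(E/L))
  obtain ⟨s, hs⟩ := (FiniteField.bijective_frobeniusAlgEquivOfAlgebraic_pow (ZMod p) (kR p R)).2 (Ψ σ)
  refine ⟨E, iE, iA, ι, σ, orderOf σ, s, hfd, orderOf_pos σ, ?_, pow_orderOf_eq_one σ, ?_, ?_, ?_⟩
  · have h1 := orderOf_dvd_natCard (Ψ σ)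
    rw [orderOf_injective Ψ hΨi, IsGalois.card_aut_eq_finrank, GaloisField.finrank p hR] at h1
    exact h1
  · intro i hi hin h
    exact pow_ne_one_of_lt_orderOf hi.ne' hin (hfix _ h)
  · rw [← hΨ, ← hs, ← map_pow]
    congr 1
    have : ∀ i : ℕ, (FiniteField.frobeniusAlgEquivOfAlgebraic (ZMod p) (kR p R) ^ i) (tR p R) = tR p R ^ (p ^ i) := by
      intro i
      induction i with
      | zero => simp
      | succ i ih => rw [pow_succ', AlgEquiv.mul_apply, ih, FiniteField.frobeniusAlgEquivOfAlgebraic_apply, ZMod.card, ← pow_mul, pow_succ]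
    exact this s
  · intro x hx
    refine (IsGalois.mem_range_algebraMap_iff_fixed (F := L) x).mpr ?_
    intro f
    have h1 := hσ f
    rw [← mem_powers_iff_mem_zpowers] at h1
    obtain ⟨i, rfl⟩ := h1
    simp only
    induction i with
    | zero => rfl
    | succ i ih => rw [pow_succ, AlgEquiv.mul_apply, hx, ih]
end

end

section
open IntermediateField

section
variable {p : ℕ} [Fact p.Prime] {R : ℕ}

theorem pos_field {L : Type} [Field L] [Algebra (ZMod p) L] (hL : IsFF p L) (hR : R ≠ 0) {c : L} (hc : c ≠ 0)
    (hdiv : ∀ W : FFPrime L, (R : ℤ) ∣ W.o c) : ∃ z : Fin R → L, MvPolynomial.aeval z (nf p hR) = c := by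
  obtain ⟨E, iE, iA, ι, σ0, n, s, hfd, hn, hnR, hσ0, hθ0, hs0, hfix⟩ := exists_cyclic (p := p) (R := R) L hR
  let _ : Algebra (ZMod p) E := ((algebraMap L E).comp (algebraMap (ZMod p) L)).toAlgebra
  have hT1 : IsScalarTower (ZMod p) L E := zmod_tower p L E
  have hE : IsFF p E := IsFF.ext hL
  let σ : RingAut E := (σ0 : E ≃+* E)
  have hpow : ∀ (i : ℕ) (x : E), (σ ^ i) x = (σ0 ^ i) x := by
    intro i
    induction i with
    | zero => intro x; rfl
    | succ i ih => intro x; rw [← aut_pow_succ, ih, pow_succ']; rfl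
  have hσ : σ ^ n = 1 := by
    apply RingEquiv.ext
    intro x
    rw [hpow, hσ0]; rfl
  let θ := ι (tR p R)
  have hθ : ∀ i, 0 < i → i < n → (σ ^ i) θ ≠ θ := fun i h1 h2 => by rw [hpow]; exact hθ0 i h1 h2
  have hθa : IsAlgebraic (ZMod p) θ := by
    have h1 : IsAlgebraic (ZMod p) (tR p R) := Algebra.IsAlgebraic.isAlgebraic _
    let ι' : kR p R →ₐ[ZMod p] E := { ι with commutes' := fun a => RingHom.congr_fun (RingHom.ext_zmod (ι.comp (algebraMap (ZMod p) _)) (algebraMap (ZMod p) E)) a }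
    exact h1.algHom ι'
  have hc' : algebraMap L E c ≠ 0 := (map_ne_zero_iff _ (algebraMap L E).injective).mpr hc
  obtain ⟨g, hg0, hg⟩ := lang hE hn hσ hθa hθ hc' (σ0.commutes c) (by
    intro W
    obtain ⟨u, e, he⟩ := exists_below (K := L) W
    rw [he.o]
    exact Dvd.dvd.mul_left ((Int.natCast_dvd_natCast.mpr hnR).trans (hdiv u)) _)
  obtain ⟨z, hz1, hz2⟩ := norm_to_lf (p := p) hR hn hσ (θ := θ) (by
    rw [← map_pow, tR_pow p hR]) (fun i j hi hj h => tR_inj p hR hi hj (ι.injective (by rw [map_pow, map_pow]; exact h))) hθ hs0 g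
  have hz3 : ∀ j, ∃ y, algebraMap L E y = z j := fun j => hfix _ (hz1 j)
  choose y hy using hz3
  refine ⟨y, ?_⟩
  apply (algebraMap L E).injective
  rw [← hg, ← hz2, ← nf_eval p hR ι z, ← MvPolynomial.aeval_algebraMap_apply]
  congr 1
  rw [show (algebraMap L E ∘ y) = z from funext hy]

lemma dvd_aeval_sub {S A ι : Type*} [CommRing S] [CommRing A] [Algebra S A] (P : MvPolynomial ι S) {d : A} {z z' : ι → A}
    (h : ∀ j, d ∣ z j - z' j) : d ∣ MvPolynomial.aeval z P - MvPolynomial.aeval z' P := by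
  rw [← Ideal.mem_span_singleton, ← Ideal.Quotient.eq_zero_iff_mem, map_sub, sub_eq_zero]
  let m : A →ₐ[S] A ⧸ Ideal.span {d} := Ideal.Quotient.mkₐ S _
  change m _ = m _
  rw [← AlgHom.comp_apply, ← AlgHom.comp_apply, MvPolynomial.comp_aeval, MvPolynomial.comp_aeval]
  have : (fun i => m (z i)) = fun i => m (z' i) := by
    funext j
    rw [← sub_eq_zero, ← map_sub]
    exact Ideal.Quotient.eq_zero_iff_mem.mpr (Ideal.mem_span_singleton.mpr (h j))
  rw [this]

theorem pos_poly {F : Type} [Field F] [Algebra (ZMod p) F] (hF : IsFF p F) (hR : R ≠ 0) (hpR : ¬ p ∣ R) {b x : F} (hb : b ≠ 0)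
    (hc : 1 + b * x ^ R ≠ 0) (hpos : ∀ w : FFPrime F, w.o b ≠ 0 → b * x ^ R ∈ w.M 0) :
    ∃ z : Fin R → Polynomial F, (Polynomial.C (1 + b * x ^ R) * Polynomial.X ^ R - Polynomial.C b) ∣
      MvPolynomial.aeval z (nf p hR) - Polynomial.C (1 + b * x ^ R) := by
  classical
  set c := 1 + b * x ^ R with hcd
  set f : Polynomial F := Polynomial.C c * Polynomial.X ^ R - Polynomial.C b with hf
  have hchar : CharP F p := charP_of_injective_algebraMap (algebraMap (ZMod p) F).injective p
  have hfs : f.Separable := by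
    have h1 := Polynomial.separable_X_pow_sub_C' p R (b / c) hpR (div_ne_zero hb hc)
    have h2 : f = Polynomial.C c * (Polynomial.X ^ R - Polynomial.C (b / c)) := by
      rw [hf, mul_sub, ← Polynomial.C_mul, mul_div_cancel₀ _ hc]
    refine h1.of_dvd ⟨Polynomial.C c⁻¹, ?_⟩
    rw [h2, mul_comm, ← mul_assoc, ← Polynomial.C_mul, inv_mul_cancel₀ hc, Polynomial.C_1, one_mul]
  suffices H : ∀ g : Polynomial F, g ∣ f → ∃ z : Fin R → Polynomial F, g ∣ MvPolynomial.aeval z (nf p hR) - Polynomial.C c from H f dvd_rfl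
  intro g
  induction g using WfDvdMonoid.induction_on_irreducible with
  | zero =>
    intro h
    exact absurd (zero_dvd_iff.mp h) hfs.ne_zero
  | unit u hu => exact fun _ => ⟨fun _ => 0, hu.dvd⟩
  | mul a i ha hi ih =>
    intro hdvd
    obtain ⟨z2, hz2⟩ := ih ((dvd_mul_left _ _).trans hdvd)
    obtain ⟨u, v, huv⟩ := (hfs.of_dvd hdvd).isCoprime
    have hif : i ∣ f := (dvd_mul_right _ _).trans hdvd
    obtain ⟨z1, hz1⟩ : ∃ z1 : Fin R → Polynomial F, i ∣ MvPolynomial.aeval z1 (nf p hR) - Polynomial.C c := by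
      have hfact : Fact (Irreducible i) := ⟨hi⟩
      let L := AdjoinRoot i
      have hfd : FiniteDimensional F L := (AdjoinRoot.powerBasis hi.ne_zero).finite
      have hL : IsFF p L := IsFF.ext hF
      let γ : L := AdjoinRoot.root i
      have hγ : algebraMap F L c * γ ^ R = algebraMap F L b := by
        have h1 : AdjoinRoot.mk i f = 0 := AdjoinRoot.mk_eq_zero.mpr hif
        rw [hf, map_sub, map_mul, map_pow, AdjoinRoot.mk_C, AdjoinRoot.mk_C, AdjoinRoot.mk_X, sub_eq_zero] at h1
        exact h1
      have hinj := (algebraMap F L).injective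
      have hb' : algebraMap F L b ≠ 0 := (map_ne_zero_iff _ hinj).mpr hb
      have hc' : algebraMap F L c ≠ 0 := (map_ne_zero_iff _ hinj).mpr hc
      have hγ0 : γ ≠ 0 := by
        intro h
        rw [h, zero_pow hR, mul_zero] at hγ
        exact hb' hγ.symm
      obtain ⟨z, hz⟩ := pos_field hL hR hc' (by
        intro W
        obtain ⟨w, e, he⟩ := exists_below (K := F) W
        rcases lt_trichotomy (w.o c) 0 with h | h | h
        · -- pole of c
          have h1 : b * x ^ R ∉ w.M 0 := by
            intro h2
            have h3 : c ∈ w.M 0 := (w.M 0).add_mem (x := 1) (y := b * x ^ R) w.one_mem_M h2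
            rw [w.mem_M hc] at h3
            omega
          have h2 : w.o b = 0 := by
            by_contra h3
            exact h1 (hpos w h3)
          have hx0 : x ≠ 0 := by
            rintro rfl
            rw [zero_pow hR, mul_zero] at h1
            exact h1 (w.M 0).zero_mem
          have h3 : w.o (c + -1) = w.o c := (w.o_add hc (by
            refine (w.M _).neg_mem ?_
            rw [w.mem_M one_ne_zero, w.o_one]; omega)).2
          rw [show c + -1 = b * x ^ R by rw [hcd]; ring, w.o_mul hb (pow_ne_zero _ hx0), w.o_pow, h2, zero_add] at h3
          rw [he.o, ← h3]
          exact Dvd.dvd.mul_left (dvd_mul_right _ _) _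
        · rw [he.o, h, mul_zero]; exact dvd_zero _
        · have h3 : w.o (-1 + c) = w.o (-1) := (w.o_add (neg_ne_zero.mpr one_ne_zero) (by
            rw [w.mem_M hc, w.o_neg, w.o_one]; omega)).2
          have hx0 : x ≠ 0 := by
            rintro rfl
            rw [hcd, zero_pow hR, mul_zero, add_zero, w.o_one] at h
            omega
          rw [show -1 + c = b * x ^ R by rw [hcd]; ring, w.o_mul hb (pow_ne_zero _ hx0), w.o_pow, w.o_neg, w.o_one] at h3
          have h4 := congrArg W.o hγ
          rw [W.o_mul hc' (pow_ne_zero _ hγ0), W.o_pow, he.o b] at h4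
          have h5 : w.o b = R * (- w.o x) := by linarith
          rw [h5] at h4
          refine ⟨e * (- w.o x) - W.o γ, ?_⟩
          linear_combination h4)
      have hsurj : ∀ j, ∃ q, AdjoinRoot.mk i q = z j := fun j => AdjoinRoot.mk_surjective (z j)
      choose q hq using hsurj
      refine ⟨q, ?_⟩
      rw [← AdjoinRoot.mk_eq_zero, map_sub, sub_eq_zero]
      let m : Polynomial F →ₐ[ZMod p] L := { AdjoinRoot.mk i with commutes' := fun a => RingHom.congr_fun (RingHom.ext_zmod ((AdjoinRoot.mk i).comp (algebraMap (ZMod p) _)) (algebraMap (ZMod p) L)) a }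
      change m _ = _
      rw [← AlgHom.comp_apply, MvPolynomial.comp_aeval]
      have : (fun j => m (q j)) = z := funext hq
      rw [AdjoinRoot.mk_C]
      rw [this]
      exact hz
    refine ⟨fun j => z1 j * (v * a) + z2 j * (u * i), ?_⟩
    refine IsCoprime.mul_dvd ⟨u, v, huv⟩ ?_ ?_
    · have h1 := dvd_aeval_sub (nf p hR) (d := i) (z := fun j => z1 j * (v * a) + z2 j * (u * i)) (z' := z1) (fun j => by
        refine ⟨u * (z2 j - z1 j), ?_⟩
        linear_combination z1 j * huv)
      have h2 := dvd_add h1 hz1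
      rwa [sub_add_sub_cancel] at h2
    · have h1 := dvd_aeval_sub (nf p hR) (d := a) (z := fun j => z1 j * (v * a) + z2 j * (u * i)) (z' := z2) (fun j => by
        refine ⟨v * (z1 j - z2 j), ?_⟩
        linear_combination z2 j * huv)
      have h2 := dvd_add h1 hz2
      rwa [sub_add_sub_cancel] at h2

end

end

section
open IntermediateField

section
variable {p : ℕ} [Fact p.Prime] {R : ℕ}

lemma lf_frob {E : Type} [Field E] [CharP E p] (t : E) (z : Fin R → E) (i k : ℕ) :
    lf p t z i ^ (p ^ k) = lf p t (fun j => z j ^ (p ^ k)) (i + k) := by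
  unfold lf
  rw [sum_pow_char_pow]
  refine Finset.sum_congr rfl fun j _ => ?_
  rw [mul_pow, ← pow_mul]
  congr 2
  rw [pow_add]; ring

lemma lf_period {E : Type} [Field E] {t : E} (ht : t ^ (p ^ R) = t) (z : Fin R → E) (i k : ℕ) :
    lf p t z (i + R * k) = lf p t z i := by
  have h : ∀ k, t ^ (p ^ (R * k)) = t := by
    intro k
    induction k with
    | zero => simp
    | succ k ih => rw [Nat.mul_succ, pow_add, pow_mul, ih, ht]
  unfold lf
  refine Finset.sum_congr rfl fun j _ => ?_
  congr 1
  rw [show p ^ (i + R * k) * (j : ℕ) = p ^ (R * k) * (p ^ i * j) by rw [pow_add]; ring, pow_mul, h]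

lemma lf_sub {E : Type} [Field E] (t : E) (z z' : Fin R → E) (i : ℕ) :
    lf p t (fun j => z j - z' j) i = lf p t z i - lf p t z' i := by
  unfold lf
  rw [← Finset.sum_sub_distrib]
  exact Finset.sum_congr rfl fun j _ => by ring

lemma lf_smul {E : Type} [Field E] (t a : E) (z : Fin R → E) (i : ℕ) :
    lf p t (fun j => a * z j) i = a * lf p t z i := by
  unfold lf
  rw [Finset.mul_sum]
  exact Finset.sum_congr rfl fun j _ => by ring

lemma lf_mem {E : Type} [Field E] (W : FFPrime E) {t : E} (ht : t ∈ W.M 0) {z : Fin R → E} {k : ℤ} (hz : ∀ j, z j ∈ W.M k) (i : ℕ) :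
    lf p t z i ∈ W.M k := by
  unfold lf
  refine (W.M k).sum_mem fun j _ => ?_
  have := W.mul_mem_M (hz j) (W.pow_mem_M0 ht (p ^ i * j))
  rwa [add_zero] at this

theorem lf_ord {F E : Type} [Field F] [Field E] [Algebra (ZMod p) F] [Algebra F E] [CharP E p] (hF : IsFF p F)
    (hR : R ≠ 0) {w : FFPrime F} {W : FFPrime E} {e : ℕ} (he : W.LiesOverWith w (algebraMap F E) e)
    {t : E} (ht : t ^ (p ^ R) = t) (ht0 : t ∈ W.M 0) (n : ℕ) :
    ∀ (z : Fin R → F), (∀ j, z j ∈ w.M 0) → ∀ i, lf p t (fun j => algebraMap F E (z j)) i ≠ 0 →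
      W.o (lf p t (fun j => algebraMap F E (z j)) i) = n →
      e ∣ n ∧ lf p t (fun j => algebraMap F E (z j)) (i + w.deg p) ≠ 0 ∧
        W.o (lf p t (fun j => algebraMap F E (z j)) (i + w.deg p)) = n := by
  have he0 := he.1
  have hp := (Fact.out : p.Prime).one_lt
  have hd := FFPrime.deg_pos hF w
  set d := w.deg p with hdd
  induction n using Nat.strong_induction_on with
  | _ n ih =>
  intro z hz i hne hn
  set Z : Fin R → E := fun j => algebraMap F E (z j) with hZ
  -- congruence
  have hcong : lf p t Z (i + d) - lf p t Z i ^ (p ^ d) ∈ W.M e := by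
    rw [lf_frob, ← lf_sub]
    refine lf_mem W ht0 (fun j => ?_) _
    have h1 := (w.M 1).neg_mem (FFPrime.frob hF w (hz j))
    rw [neg_sub] at h1
    have h2 := (he.mem 1).mpr h1
    rw [mul_one, map_sub, map_pow] at h2
    exact h2
  have hcong1 := W.mem_of_le hcong (show (1 : ℤ) ≤ e by omega)
  rcases Nat.eq_zero_or_pos n with hn0 | hn0
  · subst hn0
    have h1 := W.o_of_sub (x := lf p t Z i ^ (p ^ d)) (y := lf p t Z (i + d)) (pow_ne_zero _ hne) (by
      rw [W.o_pow, hn]; simpa using hcong1)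
    refine ⟨dvd_zero _, h1.1, ?_⟩
    rw [h1.2, W.o_pow, hn]; simp
  · obtain ⟨π, hπ0, hπ⟩ := w.exists_o 1
    have hπE : algebraMap F E π ≠ 0 := (map_ne_zero_iff _ (algebraMap F E).injective).mpr hπ0
    have hπo : W.o (algebraMap F E π) = e := by rw [he.o, hπ, mul_one]
    set Q := p ^ (R * d) with hQ
    have hQ2 : 2 ≤ Q := by
      calc 2 ≤ p := hp
        _ = p ^ 1 := (pow_one p).symm
        _ ≤ Q := Nat.pow_le_pow_right (by omega) (Nat.mul_pos (Nat.pos_of_ne_zero hR) hd)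
    let z' : Fin R → F := fun j => π⁻¹ * (z j - z j ^ Q)
    have hz' : ∀ j, z' j ∈ w.M 0 := by
      intro j
      have h1 := (w.M 1).neg_mem (FFPrime.frob_iter hF w (hz j) (m := R * d) (dvd_mul_left _ _))
      rw [neg_sub] at h1
      have h2 := w.mul_mem_M (w.self_mem_M π⁻¹) h1
      rw [w.o_inv, hπ] at h2
      simpa using h2
    have hlf : ∀ i, algebraMap F E π * lf p t (fun j => algebraMap F E (z' j)) i = lf p t Z i - lf p t Z i ^ Q := by
      intro i
      rw [hQ, lf_frob, lf_period ht, ← lf_sub, ← lf_smul]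
      congr 1
      funext j
      simp only [z', map_mul, map_sub, map_inv₀, map_pow]
      rw [mul_inv_cancel_left₀ hπE]
    have hord : ∀ y : E, y ≠ 0 → y ∈ W.M 1 → y - y ^ Q ≠ 0 ∧ W.o (y - y ^ Q) = W.o y := by
      intro y hy0 hy1
      refine W.o_of_sub hy0 ?_
      rw [sub_sub_cancel_left]
      refine (W.M _).neg_mem ?_
      rw [W.mem_M hy0] at hy1
      rw [W.mem_M (pow_ne_zero _ hy0), W.o_pow]
      have : (2 : ℤ) ≤ Q := by exact_mod_cast hQ2
      nlinarith
    have h1 := hord _ hne (by rw [W.mem_M hne]; omega)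
    rw [← hlf] at h1
    have hne' : lf p t (fun j => algebraMap F E (z' j)) i ≠ 0 := fun h => h1.1 (by rw [h, mul_zero])
    have ho := h1.2
    rw [W.o_mul hπE hne', hπo, hn] at ho
    have hnn := lf_mem (p := p) W ht0 (fun j => he.mem0.mpr (hz' j)) i
    rw [W.mem_M hne'] at hnn
    have hle : e ≤ n := by omega
    obtain ⟨i1, i2, i3⟩ := ih (n - e) (by omega) z' hz' i hne' (by omega)
    have hmem : lf p t Z (i + d) ∈ W.M 1 := by
      have h2 : lf p t Z i ^ (p ^ d) ∈ W.M 1 := by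
        rw [W.mem_M (pow_ne_zero _ hne), W.o_pow, hn]
        have : 0 < p ^ d := by positivity
        have : 0 < p ^ d * n := Nat.mul_pos this hn0
        exact_mod_cast this
      have := (W.M 1).add_mem hcong1 h2
      rwa [sub_add_cancel] at this
    have h4 := hlf (i + d)
    have hne4 : lf p t Z (i + d) ≠ 0 := by
      intro h
      rw [h, zero_pow (by omega), sub_zero] at h4
      exact (mul_ne_zero hπE i2) h4
    refine ⟨?_, hne4, ?_⟩
    · have := Nat.dvd_add i1 (dvd_refl e)
      rwa [Nat.sub_add_cancel hle] at this
    · rw [← (hord _ hne4 hmem).2, ← h4, W.o_mul hπE i2, hπo, i3]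
      omega

lemma sum_periodic' (g : ℕ → ℤ) {G : ℕ} (hG : ∀ i, g (i + G) = g i) (T : ℕ) :
    ∑ i ∈ Finset.range (G * T), g i = T * ∑ i ∈ Finset.range G, g i := by
  have h : ∀ k i, g (G * k + i) = g i := by
    intro k
    induction k with
    | zero => simp
    | succ k ih => intro i; rw [show G * (k + 1) + i = (G * k + i) + G by ring, hG, ih]
  induction T with
  | zero => simp
  | succ T ih =>
    rw [Nat.mul_succ, Finset.sum_range_add, ih]
    simp only [h]
    push_cast; ring

lemma gcd_periodic (g : ℕ → ℤ) {d r : ℕ} (hr : 0 < r) (h1 : ∀ i, g (i + d) = g i) (h2 : ∀ i, g (i + r) = g i) (i : ℕ) :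
    g (i + d.gcd r) = g i := by
  have h1' : ∀ k i, g (i + d * k) = g i := by
    intro k
    induction k with
    | zero => simp
    | succ k ih => intro i; rw [Nat.mul_succ, ← add_assoc, h1, ih]
  have h2' : ∀ k i, g (i + r * k) = g i := by
    intro k
    induction k with
    | zero => simp
    | succ k ih => intro i; rw [Nat.mul_succ, ← add_assoc, h2, ih]
  rcases (Nat.gcd_le_right d hr).lt_or_eq with h | h
  · obtain ⟨m, -, hm⟩ := Nat.exists_mul_mod_eq_gcd h
    rw [← h2' (d * m / r), add_assoc, ← hm, Nat.mod_add_div, h1']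
  · rw [h, h2]

theorem neg_local {F : Type} [Field F] [Algebra (ZMod p) F] (hF : IsFF p F) (w : FFPrime F) {q a m : ℕ} (hq : q.Prime)
    (hRq : R = q ^ (a + m)) (hR : R ≠ 0) (hdeg : padicValNat q (w.deg p) ≤ a) (Z : Fin R → F)
    (hne : MvPolynomial.aeval Z (nf p hR) ≠ 0) : ((q ^ m : ℕ) : ℤ) ∣ w.o (MvPolynomial.aeval Z (nf p hR)) := by
  have hqf : Fact q.Prime := ⟨hq⟩
  obtain ⟨E, iE, iA, ι, hfd, -⟩ := exists_ext p (R := R) F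
  let _ : Algebra (ZMod p) E := ((algebraMap F E).comp (algebraMap (ZMod p) F)).toAlgebra
  have hT1 : IsScalarTower (ZMod p) F E := zmod_tower p F E
  have hE : IsFF p E := IsFF.ext hF
  have hchar : CharP E p := charP_of_injective_algebraMap (algebraMap (ZMod p) E).injective p
  obtain ⟨W, e, he⟩ := exists_extend hE w
  have he0 := he.1
  set θ := ι (tR p R) with hθ
  have hθ1 : θ ^ (p ^ R) = θ := by rw [hθ, ← map_pow, tR_pow p hR]
  have hθ0 : θ ∈ W.M 0 := by
    have h1 : IsAlgebraic (ZMod p) (tR p R) := Algebra.IsAlgebraic.isAlgebraic _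
    let ι' : kR p R →ₐ[ZMod p] E := { ι with commutes' := fun a => RingHom.congr_fun (RingHom.ext_zmod (ι.comp (algebraMap (ZMod p) _)) (algebraMap (ZMod p) E)) a }
    have h2 : IsAlgebraic (ZMod p) θ := h1.algHom ι'
    have := W.self_mem_M θ
    rwa [W.o_alg h2] at this
  have hev : ∀ z : Fin R → F, algebraMap F E (MvPolynomial.aeval z (nf p hR)) = ∏ i ∈ Finset.range R, lf p θ (fun j => algebraMap F E (z j)) i := by
    intro z
    rw [← nf_eval p hR ι, ← MvPolynomial.aeval_algebraMap_apply]
    rfl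
  have hdR : ((q ^ m : ℕ) : ℤ) ∣ R := by
    rw [hRq]; exact_mod_cast pow_dvd_pow q (Nat.le_add_left m a)
  -- integral case
  have main : ∀ z : Fin R → F, (∀ j, z j ∈ w.M 0) → MvPolynomial.aeval z (nf p hR) ≠ 0 →
      ((q ^ m : ℕ) : ℤ) ∣ w.o (MvPolynomial.aeval z (nf p hR)) := by
    intro z hz hne
    have hneE := (map_ne_zero_iff _ (algebraMap F E).injective).mpr hne
    rw [hev] at hneE
    have hne0 : ∀ i, lf p θ (fun j => algebraMap F E (z j)) i ≠ 0 := by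
      intro i
      rw [← Nat.mod_add_div i R, lf_period hθ1]
      exact Finset.prod_ne_zero_iff.mp hneE _ (Finset.mem_range.mpr (Nat.mod_lt _ (Nat.pos_of_ne_zero hR)))
    set g : ℕ → ℤ := fun i => W.o (lf p θ (fun j => algebraMap F E (z j)) i) with hg
    have hgn : ∀ i, 0 ≤ g i := fun i => by
      have := lf_mem (p := p) W hθ0 (fun j => he.mem0.mpr (hz j)) i
      rwa [W.mem_M (hne0 i)] at this
    have key := fun i => lf_ord hF hR he hθ1 hθ0 (g i).toNat z hz i (hne0 i) (Int.toNat_of_nonneg (hgn i)).symm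
    have hge : ∀ i, (e : ℤ) ∣ g i := fun i => by
      have := Int.natCast_dvd_natCast.mpr (key i).1
      rwa [Int.toNat_of_nonneg (hgn i)] at this
    have hgd : ∀ i, g (i + w.deg p) = g i := fun i => by
      have := (key i).2.2
      rwa [Int.toNat_of_nonneg (hgn i)] at this
    have hgR : ∀ i, g (i + R) = g i := fun i => by
      have := lf_period (p := p) hθ1 (fun j => algebraMap F E (z j)) i 1
      rw [mul_one] at this
      simp only [hg, this]
    have hsum : (e : ℤ) * w.o (MvPolynomial.aeval z (nf p hR)) = ∑ i ∈ Finset.range R, g i := by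
      rw [← he.o, hev]
      have : ∀ s : Finset ℕ, W.o (∏ i ∈ s, lf p θ (fun j => algebraMap F E (z j)) i) = ∑ i ∈ s, g i := by
        classical
        intro s
        induction s using Finset.induction_on with
        | empty => simp
        | insert i s hi ih =>
          rw [Finset.prod_insert hi, Finset.sum_insert hi, W.o_mul (hne0 i) (Finset.prod_ne_zero_iff.mpr fun i _ => hne0 i), ih]
      exact this _
    -- the period
    set G := (w.deg p).gcd R with hGdef
    have hG := gcd_periodic g (Nat.pos_of_ne_zero hR) hgd hgR
    obtain ⟨s, hs, hGs⟩ := (Nat.dvd_prime_pow hq).mp (hRq ▸ Nat.gcd_dvd_right (w.deg p) R : G ∣ q ^ (a + m))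
    have hsa : s ≤ a := by
      refine le_trans ?_ hdeg
      rw [← padicValNat_dvd_iff_le (FFPrime.deg_pos hF w).ne']
      rw [← hGs]
      exact Nat.gcd_dvd_left _ _
    have hRG : R = G * (q ^ m * q ^ (a - s)) := by
      rw [hRq, hGs, ← pow_add, ← pow_add]; congr 1; omega
    have h5 := sum_periodic' g hG (q ^ m * q ^ (a - s))
    rw [← hRG, ← hsum] at h5
    obtain ⟨y, hy⟩ : (e : ℤ) ∣ ∑ i ∈ Finset.range G, g i := Finset.dvd_sum fun i _ => hge i
    rw [hy] at h5
    refine ⟨q ^ (a - s) * y, ?_⟩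
    have he' : (e : ℤ) ≠ 0 := by exact_mod_cast he0.ne'
    apply mul_left_cancel₀ he'
    rw [h5]; push_cast; ring
  -- general case
  obtain ⟨π, hπ0, hπ⟩ := w.exists_o 1
  obtain ⟨k, hk⟩ : ∃ k : ℕ, ∀ j, π ^ k * Z j ∈ w.M 0 := by
    refine ⟨∑ j, (w.o (Z j)).natAbs, fun j => ?_⟩
    have h1 := w.mul_mem_M (w.self_mem_M (π ^ (∑ j, (w.o (Z j)).natAbs))) (w.self_mem_M (Z j))
    refine w.mem_of_le h1 ?_
    rw [w.o_pow, hπ]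
    have := Finset.single_le_sum (f := fun j => (w.o (Z j)).natAbs) (fun _ _ => Nat.zero_le _) (Finset.mem_univ j)
    omega
  have hsc : MvPolynomial.aeval (fun j => π ^ k * Z j) (nf p hR) = π ^ (k * R) * MvPolynomial.aeval Z (nf p hR) := by
    apply (algebraMap F E).injective
    rw [map_mul, hev, hev]
    simp only [map_mul, lf_smul]
    rw [Finset.prod_mul_distrib, Finset.prod_const, Finset.card_range, ← map_pow, ← pow_mul]
  have h6 := main _ hk (by rw [hsc]; exact mul_ne_zero (pow_ne_zero _ hπ0) hne)
  rw [hsc, w.o_mul (pow_ne_zero _ hπ0) hne, w.o_pow, hπ, mul_one] at h6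
  refine (dvd_add_right ?_).mp h6
  push_cast
  exact Dvd.dvd.mul_left (by simpa using hdR) _

lemma eval_bound {F : Type} [Field F] (w : FFPrime F) (t : ℤ) (H : Polynomial F) :
    ∃ B : ℤ, ∀ γ ∈ w.M t, H.eval γ ∈ w.M B := by
  induction H using Polynomial.induction_on' with
  | add f g hf hg =>
    obtain ⟨B1, h1⟩ := hf
    obtain ⟨B2, h2⟩ := hg
    refine ⟨min B1 B2, fun γ hγ => ?_⟩
    rw [Polynomial.eval_add]
    exact (w.M _).add_mem (w.mem_of_le (h1 γ hγ) (min_le_left _ _)) (w.mem_of_le (h2 γ hγ) (min_le_right _ _))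
  | monomial n a =>
    refine ⟨w.o a + n * t, fun γ hγ => ?_⟩
    rw [Polynomial.eval_monomial]
    exact w.mul_mem_M (w.self_mem_M a) (w.pow_mem_M hγ n)

theorem neg_poly {F : Type} [Field F] [Algebra (ZMod p) F] (hF : IsFF p F) (w : FFPrime F) {q a m : ℕ} (hq : q.Prime)
    (hRq : R = q ^ (a + m)) (hR : R ≠ 0) (hpR : ¬ p ∣ R) (hdeg : padicValNat q (w.deg p) ≤ a) {b x : F} (hb : b ≠ 0)
    (z : Fin R → Polynomial F)
    (hz : (Polynomial.C (1 + b * x ^ R) * Polynomial.X ^ R - Polynomial.C b) ∣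
      MvPolynomial.aeval z (nf p hR) - Polynomial.C (1 + b * x ^ R))
    (hx : b * x ^ R ∉ w.M 0) : ((q ^ m : ℕ) : ℤ) ∣ w.o b := by
  have hp := (Fact.out : p.Prime)
  have hchar : CharP F p := charP_of_injective_algebraMap (algebraMap (ZMod p) F).injective p
  have hx0 : x ≠ 0 := by
    rintro rfl
    rw [zero_pow hR, mul_zero] at hx
    exact hx (w.M 0).zero_mem
  have hbx : b * x ^ R ≠ 0 := mul_ne_zero hb (pow_ne_zero _ hx0)
  have hxo := w.o_lt_of_not_mem hx
  obtain ⟨hc, hco⟩ := w.o_add (y := 1) hbx (by rw [w.mem_M one_ne_zero, w.o_one]; omega)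
  rw [add_comm] at hc hco
  set c := 1 + b * x ^ R with hcd
  obtain ⟨H, hH⟩ := hz
  obtain ⟨B, hB⟩ := eval_bound w (- w.o x) H
  set s := b * x ^ R / c with hs
  have hs0 : s ≠ 0 := div_ne_zero hbx hc
  have hso : w.o s = 0 := by rw [hs, w.o_div hbx hc, hco, sub_self]
  have hs1 : s - 1 ∈ w.M 1 := by
    have h1 : s - 1 = - c⁻¹ := by
      rw [hs, show b * x ^ R = c - 1 by rw [hcd]; ring, sub_div, div_self hc, one_div]
      ring
    rw [h1]
    refine (w.M 1).neg_mem ?_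
    rw [w.mem_M (inv_ne_zero hc), w.o_inv, hco]
    omega
  -- choose the precision
  obtain ⟨j, hj⟩ : ∃ j : ℕ, w.o c + 1 - B - w.o b ≤ (p ^ j : ℕ) := by
    refine ⟨(w.o c + 1 - B - w.o b).toNat, ?_⟩
    have := Nat.lt_pow_self (n := (w.o c + 1 - B - w.o b).toNat) hp.one_lt
    omega
  have hcop : Nat.Coprime R (p ^ j) := ((Nat.Prime.coprime_iff_not_dvd hp).mpr hpR).symm.pow_right j
  obtain ⟨R', l, hRl⟩ : ∃ R' l : ℕ, R' * R = 1 + p ^ j * l := by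
    rcases Nat.eq_zero_or_pos j with h | h
    · subst h
      exact ⟨1, R - 1, by rw [pow_zero, one_mul, one_mul]; omega⟩
    · obtain ⟨R', hR', h1⟩ := Nat.exists_mul_mod_eq_one_of_coprime hcop (Nat.one_lt_pow h.ne' hp.one_lt)
      refine ⟨R', R * R' / p ^ j, ?_⟩
      have := Nat.mod_add_div (R * R') (p ^ j)
      rw [h1] at this
      rw [this, mul_comm]
  set γ := s ^ R' / x with hγ
  have hγo : w.o γ = - w.o x := by
    rw [hγ, w.o_div (pow_ne_zero _ hs0) hx0, w.o_pow, hso]; ring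
  have hγm : γ ∈ w.M (- w.o x) := by
    have := w.self_mem_M γ
    rwa [hγo] at this
  have hf : c * γ ^ R - b = b * (s ^ l - 1) ^ (p ^ j) := by
    rw [sub_pow_char_pow, one_pow, hγ, div_pow, ← pow_mul, hRl, pow_add, pow_one, ← pow_mul, mul_comm l]
    generalize s ^ (p ^ j * l) = S
    rw [hs]
    field_simp
  have hsl : s ^ l - 1 ∈ w.M 1 := by
    have hs00 : s ∈ w.M 0 := by have := w.self_mem_M s; rwa [hso] at this
    clear hRl hf
    induction l with
    | zero => simp
    | succ l ih =>
      rw [show s ^ (l + 1) - 1 = s * (s ^ l - 1) + (s - 1) by ring]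
      refine (w.M 1).add_mem ?_ hs1
      have := w.mul_mem_M hs00 ih
      rwa [zero_add] at this
  have hfm : c * γ ^ R - b ∈ w.M (w.o b + (p ^ j : ℕ)) := by
    rw [hf]
    refine w.mul_mem_M (w.self_mem_M b) ?_
    have := w.pow_mem_M hsl (p ^ j)
    rwa [mul_one] at this
  have heval := congrArg (Polynomial.eval γ) hH
  rw [Polynomial.eval_sub, Polynomial.eval_mul, Polynomial.eval_C] at heval
  have he1 : (Polynomial.C c * Polynomial.X ^ R - Polynomial.C b).eval γ = c * γ ^ R - b := by simp
  rw [he1] at heval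
  let ev : Polynomial F →ₐ[ZMod p] F := (Polynomial.aeval (R := F) γ).restrictScalars (ZMod p)
  have he2 : Polynomial.eval γ (MvPolynomial.aeval z (nf p hR)) = MvPolynomial.aeval (fun i => (z i).eval γ) (nf p hR) := by
    have h1 : ∀ P : Polynomial F, P.eval γ = ev P := fun P => by
      simp [ev, Polynomial.aeval_def, Polynomial.eval₂_eq_eval_map]
    simp only [h1]
    rw [← AlgHom.comp_apply, MvPolynomial.comp_aeval]
  rw [he2] at heval
  obtain ⟨hn, ho⟩ := w.o_of_sub (y := MvPolynomial.aeval (fun i => (z i).eval γ) (nf p hR)) hc (by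
    rw [heval]
    exact w.mem_of_le (w.mul_mem_M hfm (hB γ hγm)) (by omega))
  have hfin := neg_local hF w hq hRq hR hdeg _ hn
  rw [ho, hco, w.o_mul hb (pow_ne_zero _ hx0), w.o_pow] at hfin
  refine (dvd_add_left ?_).mp hfin
  refine Dvd.dvd.mul_right ?_ _
  rw [hRq]
  exact_mod_cast pow_dvd_pow q (Nat.le_add_left m a)

end

end

section
open IntermediateField

section
variable {L : Type} [Field L] [FirstOrder.Ring.CompatibleRing L]

lemma def_zero {ι : Type} (S : Finset (MvPolynomial ι L)) :
    (Set.univ : Set L).Definable FirstOrder.Language.ring {v : ι → L | ∀ P ∈ S, MvPolynomial.eval v P = 0} := by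
  have h := (FirstOrder.Ring.mvPolynomial_zeroLocus_definable S).mono (Set.subset_univ _)
  convert h using 1
  rw [MvPolynomial.zeroLocus_span]
  ext v
  simp [MvPolynomial.aeval_eq_eval]

lemma def_one {ι : Type} {S : Set L} (h : (Set.univ : Set L).Definable₁ FirstOrder.Language.ring S) (i : ι) :
    (Set.univ : Set L).Definable FirstOrder.Language.ring {v : ι → L | v i ∈ S} := by
  have := Set.Definable.preimage_comp (fun _ : Fin 1 => i) h
  exact this

lemma def_proj {ι : Type} [Finite ι] {T : Set (ι → L)} (h : (Set.univ : Set L).Definable FirstOrder.Language.ring T) (i : ι) :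
    (Set.univ : Set L).Definable₁ FirstOrder.Language.ring {x : L | ∃ v ∈ T, v i = x} := by
  have := Set.Definable.image_comp h (fun _ : Fin 1 => i)
  unfold Set.Definable₁
  convert this using 1
  ext u
  constructor
  · rintro ⟨v, hv, hvx⟩
    refine ⟨v, hv, ?_⟩
    funext k
    rw [Subsingleton.elim k 0]
    exact hvx
  · rintro ⟨v, hv, rfl⟩
    exact ⟨v, hv, rfl⟩

lemma def_add {S1 S2 : Set L} (h1 : (Set.univ : Set L).Definable₁ FirstOrder.Language.ring S1)
    (h2 : (Set.univ : Set L).Definable₁ FirstOrder.Language.ring S2) :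
    (Set.univ : Set L).Definable₁ FirstOrder.Language.ring {x | ∃ x1 ∈ S1, ∃ x2 ∈ S2, x1 + x2 = x} := by
  have h := def_proj (((def_one h1 (1 : Fin 3)).inter (def_one h2 (2 : Fin 3))).inter
    (def_zero {MvPolynomial.X 1 + MvPolynomial.X 2 - MvPolynomial.X 0})) (0 : Fin 3)
  convert h using 1
  ext x
  constructor
  · rintro ⟨x1, h1, x2, h2, h⟩
    refine ⟨![x, x1, x2], ⟨⟨h1, h2⟩, ?_⟩, rfl⟩
    intro P hP
    rw [Finset.mem_singleton.mp hP]
    simp [h]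
  · rintro ⟨v, ⟨⟨h1, h2⟩, h3⟩, rfl⟩
    refine ⟨v 1, h1, v 2, h2, ?_⟩
    have := h3 _ (Finset.mem_singleton_self _)
    simpa [sub_eq_zero] using this

lemma def_mult {I : Set L} (h1 : (Set.univ : Set L).Definable₁ FirstOrder.Language.ring I) :
    (Set.univ : Set L).Definable₁ FirstOrder.Language.ring {r | ∀ y ∈ I, r * y ∈ I} := by
  have h := def_proj (((def_one h1 (1 : Fin 3)).inter (def_one h1 (2 : Fin 3)).compl).inter
    (def_zero {MvPolynomial.X 0 * MvPolynomial.X 1 - MvPolynomial.X 2})) (0 : Fin 3)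
  have h' := Set.Definable.compl h
  unfold Set.Definable₁
  convert h' using 1
  ext u
  rw [Set.mem_compl_iff]
  constructor
  · rintro hr ⟨v, ⟨⟨h1, h2⟩, h3⟩, h4⟩
    have h5 := h3 _ (Finset.mem_singleton_self _)
    simp only [map_sub, map_mul, MvPolynomial.eval_X, sub_eq_zero] at h5
    apply h2
    change v 2 ∈ I
    rw [← h5, h4]
    exact hr _ h1
  · intro hr y hy
    by_contra hcon
    refine hr ⟨![u 0, y, u 0 * y], ⟨⟨hy, hcon⟩, ?_⟩, rfl⟩
    intro P hP
    rw [Finset.mem_singleton.mp hP]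
    simp

variable {p : ℕ} [Fact p.Prime] {R : ℕ} [Algebra (ZMod p) L]

/-- the basic diophantine set -/
def SS (p : ℕ) [Fact p.Prime] {R : ℕ} (hR : R ≠ 0) {L : Type} [Field L] [Algebra (ZMod p) L] (b : L) : Set L :=
  {x | ∃ z : Fin R → Polynomial L, (Polynomial.C (1 + b * x ^ R) * Polynomial.X ^ R - Polynomial.C b) ∣
      MvPolynomial.aeval z (nf p hR) - Polynomial.C (1 + b * x ^ R)}

/-- generic polynomial with coefficients -/
def gp {A : Type} [CommRing A] {n : ℕ} (c : Fin n → A) : Polynomial A := ∑ k : Fin n, Polynomial.C (c k) * Polynomial.X ^ (k : ℕ)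

lemma gp_map {A B : Type} [CommRing A] [CommRing B] (φ : A →+* B) {n : ℕ} (c : Fin n → A) :
    (gp c).map φ = gp (fun k => φ (c k)) := by
  simp [gp, Polynomial.map_sum]

lemma gp_of {A : Type} [CommRing A] {n : ℕ} (P : Polynomial A) (h : P.natDegree < n) : P = gp (fun k : Fin n => P.coeff k) := by
  unfold gp
  rw [Fin.sum_univ_eq_sum_range (fun k => Polynomial.C (P.coeff k) * Polynomial.X ^ k) n]
  exact P.as_sum_range_C_mul_X_pow' h

lemma aeval_map {A B : Type} [CommRing A] [CommRing B] [Algebra (ZMod p) A] [Algebra (ZMod p) B] (φ : A →+* B) (hR : R ≠ 0)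
    (z : Fin R → Polynomial A) :
    (MvPolynomial.aeval z (nf p hR)).map φ = MvPolynomial.aeval (fun j => (z j).map φ) (nf p hR) := by
  let m : Polynomial A →ₐ[ZMod p] Polynomial B := { Polynomial.mapRingHom φ with commutes' := fun a => RingHom.congr_fun (RingHom.ext_zmod ((Polynomial.mapRingHom φ).comp (algebraMap (ZMod p) _)) (algebraMap (ZMod p) _)) a }
  change m _ = MvPolynomial.aeval (fun j => m (z j)) _
  rw [← AlgHom.comp_apply, MvPolynomial.comp_aeval]

theorem SS_def (hR : R ≠ 0) {b : L} (hb : b ≠ 0) :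
    (Set.univ : Set L).Definable₁ FirstOrder.Language.ring (SS p hR b) := by
  classical
  -- degree bound
  obtain ⟨D, hD⟩ : ∃ D : ℕ, ∀ z : Fin R → Polynomial L, (∀ j, (z j).natDegree < R) → (MvPolynomial.aeval z (nf p hR)).natDegree ≤ D := by
    let G : Polynomial (MvPolynomial (Fin R × Fin R) L) :=
      MvPolynomial.aeval (fun j => gp fun k => MvPolynomial.X (j, k)) (nf p hR)
    refine ⟨G.natDegree, fun z hz => ?_⟩
    have h : G.map (MvPolynomial.eval fun jk : Fin R × Fin R => (z jk.1).coeff jk.2) = MvPolynomial.aeval z (nf p hR) := by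
      rw [aeval_map]
      congr 2
      funext j
      rw [gp_map]
      simp only [MvPolynomial.eval_X]
      exact (gp_of _ (hz j)).symm
    rw [← h]
    exact Polynomial.natDegree_map_le
  let σ := (Unit ⊕ Fin R × Fin R) ⊕ Fin (D + 1)
  let xx : MvPolynomial σ L := MvPolynomial.X (Sum.inl (Sum.inl ()))
  let cc : MvPolynomial σ L := 1 + MvPolynomial.C b * xx ^ R
  let G : Polynomial (MvPolynomial σ L) :=
    MvPolynomial.aeval (fun j => gp fun k => MvPolynomial.X (Sum.inl (Sum.inr (j, k)))) (nf p hR) - Polynomial.C cc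
      - (Polynomial.C cc * Polynomial.X ^ R - Polynomial.C (MvPolynomial.C b)) * gp fun k => MvPolynomial.X (Sum.inr k)
  have hG : ∀ v : σ → L, G.map (MvPolynomial.eval v) =
      MvPolynomial.aeval (fun j => gp fun k => v (Sum.inl (Sum.inr (j, k)))) (nf p hR) - Polynomial.C (1 + b * v (Sum.inl (Sum.inl ())) ^ R)
      - (Polynomial.C (1 + b * v (Sum.inl (Sum.inl ())) ^ R) * Polynomial.X ^ R - Polynomial.C b) * gp fun k => v (Sum.inr k) := by
    intro v
    simp only [G, Polynomial.map_sub, Polynomial.map_add, Polynomial.map_one, Polynomial.map_mul, Polynomial.map_C, Polynomial.map_pow, Polynomial.map_X, gp_map, aeval_map,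
      MvPolynomial.eval_X, MvPolynomial.eval_C, cc, xx, map_add, map_one, map_mul, map_pow]
  have h := def_proj (def_zero ((Finset.range (G.natDegree + 1)).image G.coeff)) (Sum.inl (Sum.inl ()) : σ)
  convert h using 1
  ext x
  have hzero : ∀ v : σ → L, (∀ P ∈ (Finset.range (G.natDegree + 1)).image G.coeff, MvPolynomial.eval v P = 0) ↔ G.map (MvPolynomial.eval v) = 0 := by
    intro v
    constructor
    · intro h
      ext n
      rw [Polynomial.coeff_map, Polynomial.coeff_zero]
      by_cases hn : n ≤ G.natDegree
      · exact h _ (Finset.mem_image_of_mem _ (Finset.mem_range.mpr (by omega)))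
      · rw [Polynomial.coeff_eq_zero_of_natDegree_lt (by omega), map_zero]
    · intro h P hP
      obtain ⟨n, -, rfl⟩ := Finset.mem_image.mp hP
      rw [← Polynomial.coeff_map, h, Polynomial.coeff_zero]
  constructor
  · rintro ⟨z, hz⟩
    set c := 1 + b * x ^ R with hc
    set f : Polynomial L := Polynomial.C c * Polynomial.X ^ R - Polynomial.C b with hf
    have hf0 : f ≠ 0 := by
      intro h
      have := congrArg (fun P => Polynomial.coeff P 0) h
      simp [hf, Ne.symm hR, hb, Polynomial.coeff_X_pow] at this
    have hfd : f.natDegree ≤ R := by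
      rw [hf]; compute_degree
    obtain ⟨z', hz'd, hz'⟩ : ∃ z' : Fin R → Polynomial L, (∀ j, (z' j).natDegree < R) ∧ f ∣ MvPolynomial.aeval z' (nf p hR) - Polynomial.C c := by
      refine ⟨fun j => z j % f, fun j => ?_, ?_⟩
      · change (z j % f).natDegree < R
        by_cases h0 : z j % f = 0
        · rw [h0, Polynomial.natDegree_zero]; omega
        · refine lt_of_lt_of_le ?_ hfd
          exact Polynomial.natDegree_lt_natDegree h0 (EuclideanDomain.mod_lt _ hf0)
      · have h1 := dvd_aeval_sub (nf p hR) (d := f) (z := fun j => z j % f) (z' := z) (fun j => by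
          refine ⟨-(z j / f), ?_⟩
          have := EuclideanDomain.div_add_mod (z j) f
          linear_combination this)
        have h2 := dvd_add h1 hz
        rwa [sub_add_sub_cancel] at h2
    obtain ⟨g, hg⟩ := hz'
    have hgd : g.natDegree < D + 1 := by
      by_cases hg0 : g = 0
      · rw [hg0]; simp
      · have h1 := congrArg Polynomial.natDegree hg
        rw [Polynomial.natDegree_mul hf0 hg0] at h1
        have h2 := Polynomial.natDegree_sub_C (p := MvPolynomial.aeval z' (nf p hR)) (a := c)
        have h3 := hD z' hz'd
        omega
    refine ⟨Sum.elim (Sum.elim (fun _ => x) (fun jk => (z' jk.1).coeff jk.2)) (fun k => g.coeff k), ?_, rfl⟩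
    refine (hzero _).mpr ?_
    rw [hG]
    simp only [Sum.elim_inl, Sum.elim_inr]
    rw [← gp_of g hgd]
    have : (fun j => gp fun k : Fin R => (z' j).coeff k) = z' := funext fun j => (gp_of _ (hz'd j)).symm
    rw [this, ← hc, hg, ← hf, sub_self]
  · rintro ⟨v, hv, rfl⟩
    have h1 := (hzero v).mp hv
    rw [hG, sub_eq_zero] at h1
    exact ⟨_, _, h1⟩

end

end

section
open IntermediateField

section
variable {p : ℕ} [Fact p.Prime] {R : ℕ}

lemma SS_map {F L : Type} [Field F] [Field L] [Algebra (ZMod p) F] [Algebra (ZMod p) L] (φ : F →+* L) (hR : R ≠ 0) {b x : F}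
    (hx : x ∈ SS p hR b) : φ x ∈ SS p hR (φ b) := by
  obtain ⟨z, hz⟩ := hx
  refine ⟨fun j => (z j).map φ, ?_⟩
  have h := map_dvd (Polynomial.mapRingHom φ) hz
  simp only [Polynomial.coe_mapRingHom, Polynomial.map_sub, Polynomial.map_mul, Polynomial.map_pow, Polynomial.map_X,
    aeval_map] at h
  rw [Polynomial.map_C, Polynomial.map_C, map_add, map_one, map_mul, map_pow] at h
  exact h

lemma lift_poly {F L : Type} [Field F] [Field L] (φ : F →+* L) (P : Polynomial L) (h : ∀ t ∈ P.coeffs, ∃ y, φ y = t) :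
    ∃ Q : Polynomial F, Q.map φ = P := by
  have : P ∈ Polynomial.lifts φ := by
    rw [Polynomial.lifts_iff_coeff_lifts]
    intro n
    by_cases h0 : P.coeff n = 0
    · exact ⟨0, by rw [h0, map_zero]⟩
    · exact h _ (Polynomial.coeff_mem_coeffs h0)
  obtain ⟨Q, hQ⟩ := (Polynomial.mem_lifts P).mp this
  exact ⟨Q, hQ⟩

lemma SS_down {L : Type} [Field L] [Algebra (ZMod p) L] (hR : R ≠ 0) {b x : L} (hx : x ∈ SS p hR b) :
    ∃ T : Finset L, ∀ (F : Type) [Field F] [Algebra (ZMod p) F] (φ : F →+* L) (b' x' : F), φ b' = b → φ x' = x →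
      (∀ t ∈ T, ∃ y, φ y = t) → x' ∈ SS p hR b' := by
  classical
  obtain ⟨z, H, hH⟩ := hx
  refine ⟨(Finset.univ.biUnion fun j => (z j).coeffs) ∪ H.coeffs, ?_⟩
  intro F _ _ φ b' x' hb hx hT
  obtain ⟨H', hH'⟩ := lift_poly φ H (fun t ht => hT t (Finset.mem_union_right _ ht))
  have hz : ∀ j, ∃ Q : Polynomial F, Q.map φ = z j := fun j => lift_poly φ (z j) (fun t ht =>
    hT t (Finset.mem_union_left _ (Finset.mem_biUnion.mpr ⟨j, Finset.mem_univ _, ht⟩)))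
  choose z' hz' using hz
  refine ⟨z', H', ?_⟩
  apply Polynomial.map_injective φ φ.injective
  simp only [Polynomial.map_sub, Polynomial.map_mul, Polynomial.map_pow, Polynomial.map_X, aeval_map]
  rw [Polynomial.map_C, Polynomial.map_C, map_add, map_one, map_mul, map_pow, hb, hx, hH']
  simp only [hz']
  exact hH

lemma add_I {F : Type} [Field F] (w : FFPrime F) {b y y' : F} (hy : b * y ^ R ∈ w.M 0) (hy' : b * y' ^ R ∈ w.M 0) (hR : R ≠ 0) :
    b * (y + y') ^ R ∈ w.M 0 := by
  by_cases hb : b = 0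
  · rw [hb, zero_mul]; exact (w.M 0).zero_mem
  by_cases h1 : y = 0
  · rwa [h1, zero_add]
  by_cases h2 : y' = 0
  · rwa [h2, add_zero]
  rw [w.mem_M (mul_ne_zero hb (pow_ne_zero _ h1)), w.o_mul hb (pow_ne_zero _ h1), w.o_pow] at hy
  rw [w.mem_M (mul_ne_zero hb (pow_ne_zero _ h2)), w.o_mul hb (pow_ne_zero _ h2), w.o_pow] at hy'
  have h3 : y + y' ∈ w.M (min (w.o y) (w.o y')) :=
    (w.M _).add_mem (w.mem_of_le (w.self_mem_M y) (min_le_left _ _)) (w.mem_of_le (w.self_mem_M y') (min_le_right _ _))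
  refine w.mem_of_le (w.mul_mem_M (w.self_mem_M b) (w.pow_mem_M h3 R)) ?_
  rcases min_choice (w.o y) (w.o y') with h | h <;> rw [h] <;> assumption

variable {K : Type} [Field K] [Algebra (ZMod p) K]

theorem neg_F {F : Type} [Field F] [Algebra (ZMod p) F] [Algebra K F] (hK : IsFF p K) (hF : IsFF p F) {v : FFPrime K} {w : FFPrime F} {e : ℕ}
    (he : w.LiesOverWith v (algebraMap K F) e) {q C1 C2 : ℕ} (hq : q.Prime) (h1 : padicValNat q e ≤ C1) (h2 : padicValNat q (w.resDeg v) ≤ C2)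
    (hRq : R = q ^ (padicValNat q (v.deg p) + C2 + (C1 + 1))) (hR : R ≠ 0) (hpR : ¬ p ∣ R) {b : K} (hb : v.o b = 1) {x : F}
    (hx : x ∈ SS p hR (algebraMap K F b)) : algebraMap K F b * x ^ R ∈ w.M 0 := by
  have hqf : Fact q.Prime := ⟨hq⟩
  by_contra hcon
  obtain ⟨z, hz⟩ := hx
  have hb0 : b ≠ 0 := by rintro rfl; simp at hb
  obtain ⟨hd, hr⟩ := resDeg_spec hK hF ⟨e, he⟩
  have h3 := neg_poly hF w hq hRq hR hpR (by
    rw [hd, padicValNat.mul (FFPrime.deg_pos hK v).ne' hr.ne']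
    omega) ((map_ne_zero_iff _ (algebraMap K F).injective).mpr hb0) z hz hcon
  rw [he.o, hb, mul_one, Int.natCast_dvd_natCast, padicValNat_dvd_iff_le he.1.ne'] at h3
  omega

lemma SS_of {F : Type} [Field F] [Algebra (ZMod p) F] (hF : IsFF p F) (hR : R ≠ 0) (hpR : ¬ p ∣ R) {b x : F} (hb : b ≠ 0)
    (hpos : ∀ w : FFPrime F, w.o b ≠ 0 → b * x ^ R ∈ w.M 0) : x ∈ SS p hR b := by
  by_cases hc : 1 + b * x ^ R = 0
  · refine ⟨fun _ => 0, ?_⟩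
    rw [hc, map_zero, zero_mul, zero_sub]
    refine IsUnit.dvd ?_
    exact (Polynomial.isUnit_C.mpr hb.isUnit).neg
  · exact pos_poly hF hR hpR hb hc hpos

theorem pos_F {F : Type} [Field F] [Algebra (ZMod p) F] [Algebra K F] [Algebra.IsAlgebraic K F] (hF : IsFF p F) {v : FFPrime K}
    (hR : R ≠ 0) (hpR : ¬ p ∣ R) {b1 b2 : K} (hb1 : b1 ≠ 0) (hb2 : b2 ≠ 0)
    (hsep : ∀ u : FFPrime K, u ≠ v → u.o b1 ≠ 0 → u.o b2 = 0) {x : F}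
    (hx : ∀ w : FFPrime F, w.LiesOver v (algebraMap K F) → algebraMap K F b1 * x ^ R ∈ w.M 0) :
    ∃ x1 ∈ SS p hR (algebraMap K F b1), ∃ x2 ∈ SS p hR (algebraMap K F b2), x1 + x2 = x := by
  classical
  set c1 := algebraMap K F b1 with hc1
  set c2 := algebraMap K F b2 with hc2
  have hc10 : c1 ≠ 0 := (map_ne_zero_iff _ (algebraMap K F).injective).mpr hb1
  have hc20 : c2 ≠ 0 := (map_ne_zero_iff _ (algebraMap K F).injective).mpr hb2
  let S := (FFPrime.finite_supp hF c1).toFinset ∪ (FFPrime.finite_supp hF c2).toFinset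
  have hS1 : ∀ w : FFPrime F, w.o c1 ≠ 0 → w ∈ S := fun w h => Finset.mem_union_left _ ((Set.Finite.mem_toFinset _).mpr h)
  have hS2 : ∀ w : FFPrime F, w.o c2 ≠ 0 → w ∈ S := fun w h => Finset.mem_union_right _ ((Set.Finite.mem_toFinset _).mpr h)
  let N : ℕ := ∑ w ∈ S, ((w.o c1).natAbs + (w.o c2).natAbs)
  have hN : ∀ w ∈ S, (w.o c1).natAbs + (w.o c2).natAbs ≤ N := fun w hw =>
    Finset.single_le_sum (f := fun w : FFPrime F => (w.o c1).natAbs + (w.o c2).natAbs) (fun _ _ => Nat.zero_le _) hw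
  have hbig : ∀ (w : FFPrime F) (c y : F), (w.o c).natAbs ≤ N → y ∈ w.M N → c * y ^ R ∈ w.M 0 := by
    intro w c y h1 h2
    refine w.mem_of_le (w.mul_mem_M (w.self_mem_M c) (w.pow_mem_M h2 R)) ?_
    have hR1 : (1 : ℤ) ≤ R := by exact_mod_cast Nat.pos_of_ne_zero hR
    have h3 : (N : ℤ) ≤ R * N := by nlinarith [Int.natCast_nonneg N]
    omega
  obtain ⟨x1, hx1⟩ := FFPrime.weak_approx S (fun w => if w.o c2 = 0 then 0 else x) N
  refine ⟨x1, ?_, x - x1, ?_, by ring⟩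
  · refine SS_of hF hR hpR hc10 fun w hw => ?_
    have h1 := hx1 w (hS1 w hw)
    have h2 := hN w (hS1 w hw)
    by_cases h3 : w.o c2 = 0
    · simp only [h3, if_true, sub_zero] at h1
      exact hbig w c1 x1 (by omega) h1
    · simp only [h3, if_false] at h1
      obtain ⟨u, e, he⟩ := exists_below (K := K) w
      have hu : u = v := by
        by_contra h4
        have h5 := hsep u h4 (fun h => hw (by rw [hc1, he.o, h, mul_zero]))
        exact h3 (by rw [hc2, he.o, h5, mul_zero])
      subst hu
      have h6 := add_I w (hx w ⟨e, he⟩) (hbig w c1 _ (by omega) h1) hR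
      rwa [add_sub_cancel] at h6
  · refine SS_of hF hR hpR hc20 fun w hw => ?_
    have h1 := hx1 w (hS2 w hw)
    have h2 := hN w (hS2 w hw)
    simp only [hw, if_false] at h1
    have h3 := (w.M N).neg_mem h1
    rw [neg_sub] at h3
    exact hbig w c2 _ (by omega) h3

lemma exists_bb (hK : IsFF p K) (v : FFPrime K) : ∃ b1 b2 : K, v.o b1 = 1 ∧ v.o b2 = 1 ∧
    ∀ u : FFPrime K, u ≠ v → u.o b1 ≠ 0 → u.o b2 = 0 := by
  classical
  obtain ⟨b1, hb0, hb1⟩ := v.exists_o 1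
  obtain ⟨b2, hb2⟩ := FFPrime.weak_approx (FFPrime.finite_supp hK b1).toFinset (fun u => if u = v then b1 else 1) 2
  refine ⟨b1, b2, hb1, ?_, fun u hu hu1 => ?_⟩
  · have h1 := hb2 v ((Set.Finite.mem_toFinset _).mpr (show v.o b1 ≠ 0 by omega))
    simp only [if_true] at h1
    rw [(v.o_of_sub hb0 (by rw [hb1]; exact h1)).2, hb1]
  · have h1 := hb2 u ((Set.Finite.mem_toFinset _).mpr hu1)
    simp only [hu, if_false] at h1
    rw [(u.o_of_sub one_ne_zero (by rw [u.o_one]; exact u.mem_of_le h1 (by norm_num))).2, u.o_one]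

theorem mult_F {F : Type} [Field F] [Algebra (ZMod p) F] [Algebra K F] (hF : IsFF p F) {v : FFPrime K}
    (hR : R ≠ 0) {b1 : K} (hb1 : v.o b1 = 1) {w : FFPrime F} (hw : w.LiesOver v (algebraMap K F)) {r : F} (hr : r ∉ w.M 0) :
    ∃ y : F, (∀ w' : FFPrime F, w'.LiesOver v (algebraMap K F) → algebraMap K F b1 * y ^ R ∈ w'.M 0) ∧
      algebraMap K F b1 * (r * y) ^ R ∉ w.M 0 := by
  classical
  obtain ⟨e, he⟩ := hw
  have hbw : w.o (algebraMap K F b1) = e := by rw [he.o, hb1, mul_one]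
  have hb10 : algebraMap K F b1 ≠ 0 := by
    intro h
    rw [h, w.o_zero] at hbw
    have := he.1
    omega
  have hr0 : r ≠ 0 := by rintro rfl; exact hr (w.M 0).zero_mem
  have hro := w.o_lt_of_not_mem hr
  obtain ⟨y0, hy00, hy0⟩ := w.exists_o (-((e / R : ℕ) : ℤ))
  have hdm := Nat.div_add_mod e R
  have hml := Nat.mod_lt e (Nat.pos_of_ne_zero hR)
  have hsupp : ∀ w' : FFPrime F, w'.LiesOver v (algebraMap K F) → 0 < w'.o (algebraMap K F b1) := by
    rintro w' ⟨e', he'⟩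
    rw [he'.o, hb1, mul_one]
    exact_mod_cast he'.1
  obtain ⟨y, hy⟩ := FFPrime.weak_approx (FFPrime.finite_supp hF (algebraMap K F b1)).toFinset (fun u => if u = w then y0 else 0) 1
  have hmem : ∀ w' : FFPrime F, w'.LiesOver v (algebraMap K F) → w' ∈ (FFPrime.finite_supp hF (algebraMap K F b1)).toFinset := fun w' h =>
    (Set.Finite.mem_toFinset _).mpr (hsupp w' h).ne'
  have hyw := hy w (hmem w ⟨e, he⟩)
  simp only [if_true] at hyw
  obtain ⟨hyn, hyo⟩ := w.o_of_sub hy00 (w.mem_of_le hyw (by rw [hy0]; linarith [Int.natCast_nonneg (e / R)]))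
  rw [hy0] at hyo
  have hdm' : (R : ℤ) * ((e / R : ℕ) : ℤ) + ((e % R : ℕ) : ℤ) = e := by exact_mod_cast hdm
  refine ⟨y, fun w' hw' => ?_, ?_⟩
  · by_cases h : w' = w
    · subst h
      rw [w'.mem_M (mul_ne_zero hb10 (pow_ne_zero _ hyn)), w'.o_mul hb10 (pow_ne_zero _ hyn), w'.o_pow, hbw, hyo]
      rw [mul_neg]
      omega
    · have h1 := hy w' (hmem w' hw')
      simp only [h, if_false, sub_zero] at h1
      refine w'.mem_of_le (w'.mul_mem_M (w'.self_mem_M _) (w'.pow_mem_M h1 R)) ?_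
      have := hsupp w' hw'
      omega
  · have hry := mul_ne_zero hr0 hyn
    refine w.not_mem_of (mul_ne_zero hb10 (pow_ne_zero _ hry)) ?_
    rw [w.o_mul hb10 (pow_ne_zero _ hry), w.o_pow, w.o_mul hr0 hyn, hbw, hyo]
    have hR1 : (1 : ℤ) ≤ R := by exact_mod_cast Nat.pos_of_ne_zero hR
    have : (R : ℤ) * w.o r ≤ R * (-1) := mul_le_mul_of_nonneg_left (by omega) (by omega)
    rw [mul_add, mul_neg]
    omega

lemma vIC_map {F L : Type} [Field F] [Field L] [Algebra K F] [Algebra K L] [Algebra F L] [IsScalarTower K F L] (v : FFPrime K) (y : F) :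
    algebraMap F L y ∈ valIntegralClosure v L ↔ y ∈ valIntegralClosure v F := by
  constructor
  · rintro ⟨P, h1, h2, h3⟩
    refine ⟨P, h1, h2, ?_⟩
    rw [Polynomial.aeval_algebraMap_apply] at h3
    exact (map_eq_zero_iff _ (algebraMap F L).injective).mp h3
  · rintro ⟨P, h1, h2, h3⟩
    refine ⟨P, h1, h2, ?_⟩
    rw [Polynomial.aeval_algebraMap_apply, h3, map_zero]

lemma exists_level (hK : IsFF p K) (BK : Type) [Field BK] [Algebra K BK] [Algebra.IsAlgebraic K BK] (v : FFPrime K) {q C1 C2 : ℕ}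
    (h1 : ∀ F : IntermediateField K BK, FiniteDimensional K F → ∀ w : FFPrime F, w.LiesOver v (algebraMap K F) →
      padicValNat q (w.ramIdx v (algebraMap K F)) ≤ C1)
    (h2 : ∀ F : IntermediateField K BK, FiniteDimensional K F → ∀ w : FFPrime F, w.LiesOver v (algebraMap K F) →
      padicValNat q (w.resDeg v) ≤ C2) (T : Finset BK) :
    ∃ (F : Type) (_ : Field F) (_ : Algebra (ZMod p) F) (_ : Algebra K F) (_ : Algebra F BK), IsScalarTower K F BK ∧
      FiniteDimensional K F ∧ IsFF p F ∧ (∀ t ∈ T, ∃ y, algebraMap F BK y = t) ∧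
      ∀ (w : FFPrime F) (e : ℕ), w.LiesOverWith v (algebraMap K F) e → padicValNat q e ≤ C1 ∧ padicValNat q (w.resDeg v) ≤ C2 := by
  let F := IntermediateField.adjoin K (T : Set BK)
  have hfd : FiniteDimensional K F := IntermediateField.finiteDimensional_adjoin fun x _ => Algebra.IsIntegral.isIntegral x
  let iA : Algebra (ZMod p) F := ((algebraMap K F).comp (algebraMap (ZMod p) K)).toAlgebra
  refine ⟨F, inferInstance, iA, inferInstance, inferInstance, inferInstance, hfd, IsFF.ext hK,
    fun t ht => ⟨⟨t, IntermediateField.subset_adjoin K _ ht⟩, rfl⟩, fun w e he => ⟨?_, h2 F hfd w ⟨e, he⟩⟩⟩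
  have := h1 F hfd w ⟨e, he⟩
  rwa [FFPrime.ramIdx_eq he] at this

theorem main_aux (hK : IsFF p K) {q : ℕ} (hq : q.Prime) (hqp : q ≠ p) (BK : Type) [Field BK] [Algebra K BK] [Algebra.IsAlgebraic K BK]
    (v : FFPrime K) (hbd : UniformlyQBoundedAt q BK v) : FODefinable (valIntegralClosure v BK) := by
  classical
  obtain ⟨⟨C1, h1⟩, ⟨C2, h2⟩⟩ := hbd
  obtain ⟨b1, b2, hb1, hb2, hsep⟩ := exists_bb hK v
  have hb10 : b1 ≠ 0 := by rintro rfl; simp at hb1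
  have hb20 : b2 ≠ 0 := by rintro rfl; simp at hb2
  obtain ⟨R, hRq⟩ : ∃ R, R = q ^ (padicValNat q (v.deg p) + C2 + (C1 + 1)) := ⟨_, rfl⟩
  have hR : R ≠ 0 := by rw [hRq]; exact pow_ne_zero _ hq.ne_zero
  have hpp := (Fact.out : p.Prime)
  have hpR : ¬ p ∣ R := by
    intro h
    rw [hRq] at h
    exact hqp ((Nat.prime_dvd_prime_iff_eq hpp hq).mp (hpp.dvd_of_dvd_pow h)).symm
  have level := fun T => exists_level hK BK v h1 h2 T
  let _ : Algebra (ZMod p) BK := ((algebraMap K BK).comp (algebraMap (ZMod p) K)).toAlgebra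
  set a1 := algebraMap K BK b1 with ha1
  set a2 := algebraMap K BK b2 with ha2
  have ha10 : a1 ≠ 0 := (map_ne_zero_iff _ (algebraMap K BK).injective).mpr hb10
  have ha20 : a2 ≠ 0 := (map_ne_zero_iff _ (algebraMap K BK).injective).mpr hb20
  -- the ideal
  have hI : {x | ∃ x1 ∈ SS p hR a1, ∃ x2 ∈ SS p hR a2, x1 + x2 = x} = {x | a1 * x ^ R ∈ valIntegralClosure v BK} := by
    ext x
    constructor
    · rintro ⟨x1, hx1, x2, hx2, rfl⟩
      obtain ⟨T1, hT1⟩ := SS_down hR hx1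
      obtain ⟨T2, hT2⟩ := SS_down hR hx2
      obtain ⟨F, i1, i2, i3, i4, i5, hfd, hF, hT, hbd⟩ := level (T1 ∪ T2 ∪ {x1, x2})
      obtain ⟨y1, rfl⟩ := hT x1 (by simp)
      obtain ⟨y2, rfl⟩ := hT x2 (by simp)
      have hy1 := hT1 F (algebraMap F BK) (algebraMap K F b1) y1 (IsScalarTower.algebraMap_apply K F BK b1).symm rfl
        (fun t ht => hT t (by simp [ht]))
      have hy2 := hT2 F (algebraMap F BK) (algebraMap K F b2) y2 (IsScalarTower.algebraMap_apply K F BK b2).symm rfl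
        (fun t ht => hT t (by simp [ht]))
      rw [Set.mem_ofPred_eq, ha1, IsScalarTower.algebraMap_apply K F BK b1, ← map_add, ← map_pow, ← map_mul, vIC_map]
      refine mem_closure_of_forall hF v _ ?_
      rintro w ⟨e, he⟩
      obtain ⟨hb1', hb2'⟩ := hbd w e he
      have n1 := neg_F hK hF he hq hb1' hb2' hRq hR hpR hb1 hy1
      have n2 := neg_F hK hF he hq hb1' hb2' hRq hR hpR hb2 hy2
      refine add_I w n1 ?_ hR
      have h3 : algebraMap K F b1 * y2 ^ R = algebraMap K F (b1 * b2⁻¹) * (algebraMap K F b2 * y2 ^ R) := by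
        rw [map_mul, map_inv₀]
        have : algebraMap K F b2 ≠ 0 := (map_ne_zero_iff _ (algebraMap K F).injective).mpr hb20
        field_simp
      have h4 : algebraMap K F (b1 * b2⁻¹) ∈ w.M 0 := by
        have := w.self_mem_M (algebraMap K F (b1 * b2⁻¹))
        rwa [he.o, v.o_mul hb10 (inv_ne_zero hb20), v.o_inv, hb1, hb2, add_neg_cancel, mul_zero] at this
      rw [h3]
      have := w.mul_mem_M h4 n2
      rwa [add_zero] at this
    · intro hx
      obtain ⟨F, i1, i2, i3, i4, i5, hfd, hF, hT, hbd⟩ := level {x}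
      obtain ⟨y, rfl⟩ := hT x (by simp)
      rw [Set.mem_ofPred_eq, ha1, IsScalarTower.algebraMap_apply K F BK b1, ← map_pow, ← map_mul, vIC_map] at hx
      obtain ⟨x1, hx1, x2, hx2, h⟩ := pos_F hF hR hpR hb10 hb20 hsep (x := y) (fun w hw => mem_M_of_mem_closure v hx w hw)
      refine ⟨algebraMap F BK x1, ?_, algebraMap F BK x2, ?_, by rw [← map_add, h]⟩
      · rw [ha1, IsScalarTower.algebraMap_apply K F BK b1]
        exact SS_map (algebraMap F BK) hR hx1
      · rw [ha2, IsScalarTower.algebraMap_apply K F BK b2]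
        exact SS_map (algebraMap F BK) hR hx2
  have hO : valIntegralClosure v BK = {r | ∀ y ∈ {x | a1 * x ^ R ∈ valIntegralClosure v BK}, r * y ∈ {x | a1 * x ^ R ∈ valIntegralClosure v BK}} := by
    ext r
    constructor
    · intro hr y hy
      obtain ⟨F, i1, i2, i3, i4, i5, hfd, hF, hT, -⟩ := level {r, y}
      obtain ⟨r, rfl⟩ := hT r (by simp)
      obtain ⟨y, rfl⟩ := hT y (by simp)
      rw [vIC_map] at hr
      rw [Set.mem_ofPred_eq, ha1, IsScalarTower.algebraMap_apply K F BK b1, ← map_pow, ← map_mul, vIC_map] at hy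
      rw [Set.mem_ofPred_eq, ha1, IsScalarTower.algebraMap_apply K F BK b1, ← map_mul, ← map_pow, ← map_mul, vIC_map]
      refine mem_closure_of_forall hF v _ fun w hw => ?_
      have m1 := mem_M_of_mem_closure v hr w hw
      have m2 := mem_M_of_mem_closure v hy w hw
      rw [show algebraMap K F b1 * (r * y) ^ R = r ^ R * (algebraMap K F b1 * y ^ R) by ring]
      have := w.mul_mem_M (w.pow_mem_M0 m1 R) m2
      rwa [add_zero] at this
    · intro hr
      obtain ⟨F, i1, i2, i3, i4, i5, hfd, hF, hT, -⟩ := level {r}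
      obtain ⟨r, rfl⟩ := hT r (by simp)
      rw [vIC_map]
      refine mem_closure_of_forall hF v _ fun w hw => ?_
      by_contra hcon
      obtain ⟨y, hy1, hy2⟩ := mult_F hF hR hb1 hw hcon
      have h3 := hr (algebraMap F BK y) (by
        rw [Set.mem_ofPred_eq, ha1, IsScalarTower.algebraMap_apply K F BK b1, ← map_pow, ← map_mul, vIC_map]
        exact mem_closure_of_forall hF v _ hy1)
      rw [Set.mem_ofPred_eq, ha1, IsScalarTower.algebraMap_apply K F BK b1, ← map_mul, ← map_pow, ← map_mul, vIC_map] at h3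
      exact hy2 (mem_M_of_mem_closure v h3 w hw)
  unfold FODefinable
  let _ : FirstOrder.Ring.CompatibleRing BK := FirstOrder.Ring.compatibleRingOfRing BK
  rw [hO, ← hI]
  exact def_mult (def_add (SS_def hR ha10) (SS_def hR ha20))

end

end

/-- If the prime `v` of the global function field `K` is uniformly
`q`-bounded in the algebraic extension `BK` of `K`, then the integral closure in `BK`
of the valuation ring of `v` is first-order definable over `BK`. -/
theorem statement1 (p q : ℕ) [Fact p.Prime] (hq : q.Prime) (hqp : q ≠ p)
    (K : Type) [Field K] [Algebra (RatFunc (ZMod p)) K]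
    [FiniteDimensional (RatFunc (ZMod p)) K]
    (BK : Type) [Field BK] [Algebra K BK] [Algebra.IsAlgebraic K BK]
    (v : FFPrime K)
    (hbd : UniformlyQBoundedAt q BK v) :
    FODefinable (valIntegralClosure v BK) := by
  let _ : Algebra (ZMod p) K :=
    ((algebraMap (RatFunc (ZMod p)) K).comp (algebraMap (ZMod p) (RatFunc (ZMod p)))).toAlgebra
  have hK : IsFF p K := IsFF.ext (IsFF.ratFunc (p := p))
  exact main_aux hK hq hqp BK v hbd
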